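/- (Louder–Wilton 2018, Wise 2018; Baumslag's third conjecture) Let m be a natural number, let r be a nontrivial, cyclically reduced element of the free group on Fin m that is not a proper power, and let n ≥ 2. Then the one-relator group with torsion G = ⟨Fin m | rⁿ = 1⟩ is coherent: every finitely generated subgroup H of G is finitely presented, i.e. H is isomorphic to the quotient of a finitely generated free group by the normal closure of a finite set of relators. -/

import Mathlib

/-- A word over `A` is cyclically reduced if its first and last letters are not
mutually inverse; an element of the free group is cyclically reduced if its
reduced word is. -/
def FreeGroup.CyclicallyReduced {A : Type*} [DecidableEq A] (w : FreeGroup A) : Prop :=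
  ∀ x : A × Bool, w.toWord.head? = some x → w.toWord.getLast? ≠ some (x.1, !x.2)


set_option linter.all false

namespace ORT

noncomputable section Kaplansky

variable {Q : Type*} [Group Q]

/-- The Hilbert space `ℓ²(Q)`. -/
abbrev E2 (Q : Type*) := lp (fun _ : Q => ℂ) 2

/-- Permutation operator on `ℓ²(Q)`. -/
def permL (e : Q ≃ Q) : E2 Q →ₗᵢ[ℂ] E2 Q where
  toFun v := ⟨fun q => v (e q), by
    have h := (memℓp_gen_iff (by norm_num : 0 < (2 : ENNReal).toReal)).1 (lp.memℓp v)
    exact memℓp_gen (e.summable_iff.2 h)⟩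
  map_add' x y := by ext q; rfl
  map_smul' x y := by ext q; simp
  norm_map' v := by
    rw [lp.norm_eq_tsum_rpow (by norm_num), lp.norm_eq_tsum_rpow (by norm_num)]
    congr 1
    exact e.tsum_eq (fun q => ‖v q‖ ^ (2 : ENNReal).toReal)

@[simp] lemma permL_apply (e : Q ≃ Q) (v : E2 Q) (q : Q) : permL e v q = v (e q) := rfl

/-- Left regular representation. -/
def lregRep (Q : Type*) [Group Q] : Q →* (E2 Q →L[ℂ] E2 Q) where
  toFun g := (permL (Equiv.mulLeft g⁻¹)).toContinuousLinearMap
  map_one' := by ext v q; simp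
  map_mul' g h := by ext v q; simp [mul_assoc]

@[simp] lemma lregRep_apply (g : Q) (v : E2 Q) (q : Q) : lregRep Q g v q = v (g⁻¹ * q) := rfl

/-- Action of the group algebra on `ℓ²(Q)`. -/
def regA (Q : Type*) [Group Q] : MonoidAlgebra ℂ Q →ₐ[ℂ] (E2 Q →L[ℂ] E2 Q) :=
  MonoidAlgebra.lift ℂ _ Q (lregRep Q)

lemma regA_of (g : Q) : regA Q (MonoidAlgebra.of ℂ Q g) = lregRep Q g := by
  simp [regA]

variable {ι : Type*} [Fintype ι] [DecidableEq ι]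

/-- `ℓ²(Q)^ι`. -/
abbrev EP (Q ι : Type*) := PiLp 2 (fun _ : ι => E2 Q)

/-- Matrix action. -/
def matA (M : Matrix ι ι (MonoidAlgebra ℂ Q)) : EP Q ι →L[ℂ] EP Q ι :=
  ((PiLp.continuousLinearEquiv 2 ℂ (fun _ : ι => E2 Q)).symm.toContinuousLinearMap).comp
    ((ContinuousLinearMap.pi fun i => ∑ j, (regA Q (M i j)).comp
      (ContinuousLinearMap.proj j)).comp
      (PiLp.continuousLinearEquiv 2 ℂ (fun _ : ι => E2 Q)).toContinuousLinearMap)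

lemma matA_apply (M : Matrix ι ι (MonoidAlgebra ℂ Q)) (v : EP Q ι) (i : ι) :
    matA M v i = ∑ j, regA Q (M i j) (v j) := by
  simp [matA]

lemma matA_mul (M N : Matrix ι ι (MonoidAlgebra ℂ Q)) (v : EP Q ι) :
    matA (M * N) v = matA M (matA N v) := by
  ext i : 1
  simp only [matA_apply, Matrix.mul_apply, map_sum, map_mul, ContinuousLinearMap.sum_apply]
  rw [Finset.sum_comm]
  rfl

/-- Right translation. -/
def rT (ι : Type*) [Fintype ι] (h : Q) : EP Q ι →L[ℂ] EP Q ι :=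
  ((PiLp.continuousLinearEquiv 2 ℂ (fun _ : ι => E2 Q)).symm.toContinuousLinearMap).comp
    ((ContinuousLinearMap.pi fun i => ((permL (Equiv.mulRight h)).toContinuousLinearMap).comp
      (ContinuousLinearMap.proj i)).comp
      (PiLp.continuousLinearEquiv 2 ℂ (fun _ : ι => E2 Q)).toContinuousLinearMap)

lemma rT_apply (h : Q) (v : EP Q ι) (i : ι) (q : Q) : rT ι h v i q = v i (q * h) := by
  simp [rT]

lemma rT_apply' (h : Q) (v : EP Q ι) (i : ι) : rT ι h v i = permL (Equiv.mulRight h) (v i) := by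
  simp [rT]

lemma rT_inner (h : Q) (v w : EP Q ι) : inner ℂ (rT ι h v) w = inner ℂ v (rT ι h⁻¹ w) := by
  simp only [PiLp.inner_apply]
  refine Finset.sum_congr rfl fun i _ => ?_
  have : w i = permL (Equiv.mulRight h) (rT ι h⁻¹ w i) := by
    ext q; simp [rT_apply]
  rw [this, rT_apply', LinearIsometry.inner_map_map]

lemma regA_perm (h : Q) (a : MonoidAlgebra ℂ Q) (v : E2 Q) :
    regA Q a (permL (Equiv.mulRight h) v) = permL (Equiv.mulRight h) (regA Q a v) := by
  induction a using MonoidAlgebra.induction_on with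
  | of g => rw [regA_of]; ext q; simp [mul_assoc]
  | add x y hx hy => simp [hx, hy]
  | smul r x hx => simp [hx]

lemma matA_rT (h : Q) (M : Matrix ι ι (MonoidAlgebra ℂ Q)) (v : EP Q ι) :
    matA M (rT ι h v) = rT ι h (matA M v) := by
  ext i : 1
  simp [matA_apply, rT_apply', regA_perm]

open Classical in
/-- The delta vectors. -/
def dl (i : ι) (g : Q) : EP Q ι := PiLp.single 2 i (lp.single 2 g (1 : ℂ))

open Classical in
lemma regA_single (a : MonoidAlgebra ℂ Q) (q : Q) :
    regA Q a (lp.single 2 1 (1 : ℂ)) q = a.coeff q := by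
  induction a using MonoidAlgebra.induction_on with
  | of g =>
    rw [regA_of]
    simp [MonoidAlgebra.of, Finsupp.single_apply, Pi.single_apply, inv_mul_eq_one]
  | add x y hx hy => simp [hx, hy]
  | smul r x hx => simp [hx]

lemma coeff_one_mul_comm (a b : MonoidAlgebra ℂ Q) : (a * b).coeff 1 = (b * a).coeff 1 := by
  induction a using MonoidAlgebra.induction_on with
  | of g =>
    induction b using MonoidAlgebra.induction_on with
    | of h =>
      rw [← map_mul, ← map_mul]
      have : g * h = 1 ↔ h * g = 1 := by
        rw [mul_eq_one_iff_eq_inv, mul_eq_one_iff_inv_eq, eq_comm]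
      classical
      simp [MonoidAlgebra.of, Finsupp.single_apply, this]
    | add x y hx hy => simp only [mul_add, add_mul, MonoidAlgebra.coeff_add, Finsupp.add_apply, hx, hy]
    | smul r x hx => simp only [mul_smul_comm, smul_mul_assoc, MonoidAlgebra.coeff_smul, Finsupp.smul_apply, hx]
  | add x y hx hy => simp only [mul_add, add_mul, MonoidAlgebra.coeff_add, Finsupp.add_apply, hx, hy]
  | smul r x hx => simp only [mul_smul_comm, smul_mul_assoc, MonoidAlgebra.coeff_smul, Finsupp.smul_apply, hx]

open Classical in
lemma kap_idem (f : Matrix ι ι (MonoidAlgebra ℂ Q)) (hf : f * f = f)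
    (htr : ∑ i, (f i i).coeff 1 = 0) : f = 0 := by
  set S : Submodule ℂ (EP Q ι) := LinearMap.ker (1 - matA f : EP Q ι →L[ℂ] EP Q ι).toLinearMap with hS
  have hSc : IsClosed (S : Set (EP Q ι)) := ContinuousLinearMap.isClosed_ker _
  haveI : CompleteSpace S := hSc.completeSpace_coe
  have memS : ∀ v, v ∈ S ↔ matA f v = v := by
    intro v
    rw [hS, LinearMap.mem_ker]
    change v - matA f v = 0 ↔ _
    rw [sub_eq_zero, eq_comm]
  set p := S.starProjection with hp
  have pS : ∀ v, p v ∈ S := fun v => by simp [hp]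
  have pR : ∀ h v, p (rT ι h v) = rT ι h (p v) := by
    intro h v
    apply Submodule.eq_starProjection_of_mem_orthogonal
    · rw [memS, matA_rT, (memS _).1 (pS v)]
    · rw [← map_sub, Submodule.mem_orthogonal']
      intro u hu
      rw [rT_inner]
      have h1 : rT ι h⁻¹ u ∈ S := by rw [memS, matA_rT, (memS _).1 hu]
      exact Submodule.inner_left_of_mem_orthogonal h1 (by simpa [hp] using S.sub_starProjection_mem_orthogonal v)
  have rdl : ∀ (i : ι) (g : Q), dl i g = rT ι g⁻¹ (dl i 1) := by
    intro i g
    ext j q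
    simp only [rT_apply, dl, PiLp.single_apply]
    by_cases hj : j = i
    · subst hj; simp [lp.single_apply, Pi.single_apply, mul_inv_eq_one]
    · simp [hj]
  have key : ∀ (a : MonoidAlgebra ℂ Q) (i j : ι),
      (p (PiLp.single 2 i (regA Q a (lp.single 2 1 (1 : ℂ))))) j 1 = regA Q a ((p (dl i 1)) j) 1 := by
    intro a i j
    have hadd : ∀ x y : E2 Q, (PiLp.single 2 i (x + y) : EP Q ι) = PiLp.single 2 i x + PiLp.single 2 i y := by
      intro x y; ext k : 1; by_cases hk : k = i <;> simp [hk, PiLp.single_apply]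
    have hsm : ∀ (r : ℂ) (x : E2 Q), (PiLp.single 2 i (r • x) : EP Q ι) = r • PiLp.single 2 i x := by
      intro x y; ext k : 1; by_cases hk : k = i <;> simp [hk, PiLp.single_apply]
    induction a using MonoidAlgebra.induction_on with
    | of g =>
      rw [regA_of]
      have h1 : lregRep Q g (lp.single 2 1 (1 : ℂ)) = lp.single 2 g (1 : ℂ) := by
        ext q; simp [lp.single_apply, Pi.single_apply, inv_mul_eq_one, eq_comm]
      rw [h1]
      change (p (dl i g)) j 1 = _
      rw [rdl, pR, rT_apply]; simp
    | add x y hx hy => simp [hadd, hx, hy]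
    | smul r x hx => simp [hsm, hx]
  have hfd : ∀ j, matA f (dl j 1) = ∑ i, PiLp.single 2 i (regA Q (f i j) (lp.single 2 1 (1 : ℂ))) := by
    intro j
    ext k : 1
    simp only [matA_apply, dl, PiLp.single_apply, WithLp.ofLp_sum, Finset.sum_apply]
    rw [Finset.sum_eq_single j (by intro b _ hb; simp [hb]) (by simp)]
    rw [Finset.sum_eq_single k (by intro b _ hb; simp [hb.symm]) (by simp)]
    simp
  have tr1 : ∑ j, (p (matA f (dl j 1))) j 1 = ∑ j, (matA f (p (dl j 1))) j 1 := by
    simp only [hfd, map_sum, WithLp.ofLp_sum, Finset.sum_apply, matA_apply, lp.coeFn_sum, key]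
    rw [Finset.sum_comm]
  have pf : ∀ v, p (matA f v) = matA f v := by
    intro v
    rw [hp, Submodule.starProjection_eq_self_iff, memS, ← matA_mul, hf]
  have h0 : ∑ j, (p (dl j 1)) j 1 = 0 := by
    have : ∀ j, (matA f (p (dl j 1))) = p (dl j 1) := fun j => (memS _).1 (pS _)
    simp only [pf, this] at tr1
    rw [← tr1, ← htr]
    refine Finset.sum_congr rfl fun j _ => ?_
    rw [hfd, WithLp.ofLp_sum, Finset.sum_apply, Finset.sum_eq_single j]
    · simp [PiLp.single_apply, regA_single]
    · intro b _ hb; simp [PiLp.single_apply, hb.symm]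
    · simp
  have h1 : ∀ j, (p (dl j 1)) j 1 = ((‖p (dl j 1)‖ ^ 2 : ℝ) : ℂ) := by
    intro j
    have e1 : inner ℂ (dl j (1 : Q)) (p (dl j 1)) = (p (dl j 1)) j 1 := by
      rw [PiLp.inner_apply, Finset.sum_eq_single j]
      · simp [dl, PiLp.single_apply, lp.inner_single_left]
      · intro b _ hb; simp [dl, PiLp.single_apply, hb]
      · simp
    rw [← e1, hp]
    have := Submodule.inner_starProjection_left_eq_right S (dl j (1 : Q)) (S.starProjection (dl j 1))
    have h7 : S.starProjection (S.starProjection (dl j (1 : Q))) = S.starProjection (dl j (1 : Q)) :=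
      Submodule.starProjection_eq_self_iff.2 (pS _)
    rw [h7] at this
    rw [← this, inner_self_eq_norm_sq_to_K]
    simp
  have h2 : ∀ j, p (dl j (1 : Q)) = 0 := by
    simp only [h1] at h0
    rw [← Complex.ofReal_sum] at h0
    have h0' := Complex.ofReal_eq_zero.1 h0
    rw [Finset.sum_eq_zero_iff_of_nonneg (fun i _ => by positivity)] at h0'
    intro j
    have := h0' j (Finset.mem_univ _)
    simpa using this
  have h3 : ∀ (a : MonoidAlgebra ℂ Q) (i : ι), p (PiLp.single 2 i (regA Q a (lp.single 2 1 (1 : ℂ)))) = 0 := by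
    intro a i
    have hadd : ∀ x y : E2 Q, (PiLp.single 2 i (x + y) : EP Q ι) = PiLp.single 2 i x + PiLp.single 2 i y := by
      intro x y; ext k : 1; by_cases hk : k = i <;> simp [hk, PiLp.single_apply]
    have hsm : ∀ (r : ℂ) (x : E2 Q), (PiLp.single 2 i (r • x) : EP Q ι) = r • PiLp.single 2 i x := by
      intro x y; ext k : 1; by_cases hk : k = i <;> simp [hk, PiLp.single_apply]
    induction a using MonoidAlgebra.induction_on with
    | of g =>
      rw [regA_of]
      have h1 : lregRep Q g (lp.single 2 1 (1 : ℂ)) = lp.single 2 g (1 : ℂ) := by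
        ext q; simp [lp.single_apply, Pi.single_apply, inv_mul_eq_one, eq_comm]
      rw [h1]
      change p (dl i g) = _
      rw [rdl, pR, h2, map_zero]
    | add x y hx hy => simp [hadd, hx, hy]
    | smul r x hx => simp [hsm, hx]
  ext i j q
  have h4 : matA f (dl j (1 : Q)) = 0 := by
    rw [← pf, hfd, map_sum]
    exact Finset.sum_eq_zero fun i _ => h3 _ _
  have h5 : (matA f (dl j (1 : Q))) i q = (f i j).coeff q := by
    rw [hfd, WithLp.ofLp_sum, Finset.sum_apply, Finset.sum_eq_single i]
    · simp [PiLp.single_apply, regA_single]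
    · intro b _ hb; simp [PiLp.single_apply, hb.symm]
    · simp
  rw [← h5, h4]; simp

/-- Kaplansky's direct finiteness theorem for matrices over complex group algebras. -/
theorem kaplansky (X Y : Matrix ι ι (MonoidAlgebra ℂ Q)) (h : X * Y = 1) : Y * X = 1 := by
  have hf : (1 - Y * X) * (1 - Y * X) = 1 - Y * X := by
    have : Y * X * (Y * X) = Y * X := by
      rw [Matrix.mul_assoc, ← Matrix.mul_assoc X, h, Matrix.one_mul]
    rw [sub_mul, mul_sub, mul_sub, this]
    simp
  have htr : ∑ i, ((1 - Y * X) i i).coeff 1 = 0 := by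
    have e : ∑ i, ((Y * X) i i).coeff (1 : Q) = ∑ i, ((X * Y) i i).coeff 1 := by
      simp only [Matrix.mul_apply, MonoidAlgebra.coeff_sum, Finsupp.finset_sum_apply]
      rw [Finset.sum_comm]
      simp only [coeff_one_mul_comm]
    simp only [Matrix.sub_apply, MonoidAlgebra.coeff_sub, Finsupp.sub_apply, Finset.sum_sub_distrib, e, h]
    simp
  exact (sub_eq_zero.1 (kap_idem _ hf htr)).symm

end Kaplansky

end ORT


set_option linter.all false

namespace ORT

noncomputable section RelHopf

variable {A X : Type} [Group A] [Fintype X] [DecidableEq X]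

/-- Free product of `A` with the free group on `X`. -/
abbrev FP (A X : Type) [Group A] := Monoid.Coprod A (FreeGroup X)

/-- Complex group algebra of the free product. -/
abbrev GA (A X : Type) [Group A] := MonoidAlgebra ℂ (FP A X)

abbrev gof (g : FP A X) : GA A X := MonoidAlgebra.of ℂ (FP A X) g

lemma gof_mul (g h : FP A X) : gof (g * h) = gof g * gof h := map_mul _ _ _
lemma gof_one : gof (1 : FP A X) = 1 := map_one _

/-- The affine permutation `m ↦ g * m + d`. -/
def affP (g : FP A X) (d : GA A X) : Equiv.Perm (GA A X) where
  toFun m := gof g * m + d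
  invFun m := gof g⁻¹ * (m - d)
  left_inv m := by
    simp only [add_sub_cancel_right, ← mul_assoc, ← gof_mul, inv_mul_cancel, gof_one, one_mul]
  right_inv m := by
    simp only [← mul_assoc, ← gof_mul, mul_inv_cancel, gof_one, one_mul, sub_add_cancel]

lemma affP_apply (g : FP A X) (d m : GA A X) : affP g d m = gof g * m + d := rfl

/-- generator -/
abbrev gx (j : X) : FP A X := Monoid.Coprod.inr (FreeGroup.of j)

def foxP (i : X) : FP A X →* Equiv.Perm (GA A X) :=
  Monoid.Coprod.lift
    { toFun := fun a => affP (Monoid.Coprod.inl a) 0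
      map_one' := by ext m : 1; simp only [affP_apply, map_one, gof_one]; simp
      map_mul' := fun a b => by
        ext m : 1
        rw [Equiv.Perm.mul_apply, affP_apply, affP_apply, affP_apply, map_mul, gof_mul]
        simp only [add_zero, mul_assoc] }
    (FreeGroup.lift fun j => affP (gx j) (if i = j then 1 else 0))

/-- Fox derivative. -/
def foxD (i : X) (g : FP A X) : GA A X := foxP i g 0

lemma foxP_apply (i : X) (g : FP A X) : ∀ m, foxP i g m = gof g * m + foxD i g := by
  have hmul : ∀ x y : FP A X, (∀ m, foxP i x m = gof x * m + foxD i x) →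
      (∀ m, foxP i y m = gof y * m + foxD i y) →
      ∀ m, foxP i (x * y) m = gof (x * y) * m + foxD i (x * y) := by
    intro x y hx hy m
    have e : foxD i (x * y) = gof x * foxD i y + foxD i x := by
      rw [foxD, map_mul, Equiv.Perm.mul_apply, hx]; rfl
    rw [e, map_mul, Equiv.Perm.mul_apply, hx, hy, gof_mul, mul_add, mul_assoc, add_assoc]
  have hinv : ∀ x : FP A X, (∀ m, foxP i x m = gof x * m + foxD i x) →
      ∀ m, foxP i x⁻¹ m = gof x⁻¹ * m + foxD i x⁻¹ := by
    intro x hx m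
    have key : ∀ m, foxP i x⁻¹ m = gof x⁻¹ * (m - foxD i x) := by
      intro m
      rw [map_inv, Equiv.Perm.inv_eq_iff_eq, hx, ← mul_assoc, ← gof_mul, mul_inv_cancel, gof_one, one_mul, sub_add_cancel]
    rw [foxD, key, key, mul_sub, mul_sub, mul_zero, zero_sub, sub_eq_add_neg]
  induction g using Monoid.Coprod.induction_on with
  | inl a => intro m; simp [foxD, foxP, affP_apply]
  | inr b =>
    induction b using FreeGroup.induction_on with
    | C1 => intro m; rw [map_one, gof_one]; simp [foxD]
    | of j => intro m; simp [foxD, foxP, affP_apply]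
    | inv_of j h => rw [map_inv]; exact hinv _ h
    | mul x y hx hy => rw [map_mul]; exact hmul _ _ hx hy
  | mul x y hx hy => exact hmul _ _ hx hy

lemma foxD_mul (i : X) (x y : FP A X) : foxD i (x * y) = foxD i x + gof x * foxD i y := by
  rw [foxD, map_mul, Equiv.Perm.mul_apply, foxP_apply i x, add_comm]; rfl

lemma foxD_inl (i : X) (a : A) : foxD i (Monoid.Coprod.inl a : FP A X) = 0 := by
  simp [foxD, foxP, affP_apply]

lemma foxD_one (i : X) : foxD i (1 : FP A X) = 0 := by
  simp [foxD]

lemma foxD_gx (i j : X) : foxD i (gx j : FP A X) = if i = j then 1 else 0 := by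
  simp [foxD, foxP, affP_apply]

lemma foxD_inv (i : X) (x : FP A X) : foxD i x⁻¹ = - (gof x⁻¹ * foxD i x) := by
  have := foxD_mul i x⁻¹ x
  rw [inv_mul_cancel, foxD_one] at this
  exact eq_neg_of_add_eq_zero_left this.symm

/-- letters -/
def lval : A ⊕ X × Bool → FP A X
  | .inl a => Monoid.Coprod.inl a
  | .inr (j, true) => gx j
  | .inr (j, false) => (gx j)⁻¹

def wval (w : List (A ⊕ X × Bool)) : FP A X := (w.map lval).prod

@[simp] lemma wval_nil : wval ([] : List (A ⊕ X × Bool)) = 1 := rfl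
@[simp] lemma wval_cons (l : A ⊕ X × Bool) (w) : wval (l :: w) = lval l * wval w := by
  simp [wval]
@[simp] lemma wval_append (v w : List (A ⊕ X × Bool)) : wval (v ++ w) = wval v * wval w := by
  simp [wval]

lemma wval_surj (g : FP A X) : ∃ w, wval w = g := by
  induction g using Monoid.Coprod.induction_on with
  | inl a => exact ⟨[.inl a], by simp [lval]⟩
  | inr b =>
    induction b using FreeGroup.induction_on with
    | C1 => exact ⟨[], by simp⟩
    | of j => exact ⟨[.inr (j, true)], by simp [lval]⟩
    | inv_of j h => exact ⟨[.inr (j, false)], by simp [lval]⟩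
    | mul x y hx hy =>
      obtain ⟨v, hv⟩ := hx
      obtain ⟨w, hw⟩ := hy
      exact ⟨v ++ w, by simp [hv, hw]⟩
  | mul x y hx hy =>
    obtain ⟨v, hv⟩ := hx
    obtain ⟨w, hw⟩ := hy
    exact ⟨v ++ w, by simp [hv, hw]⟩

variable (θ : FP A X →* FP A X)

def thA : GA A X →+* GA A X := MonoidAlgebra.mapDomainRingHom ℂ θ

lemma thA_of (g : FP A X) : thA θ (gof g) = gof (θ g) := by
  simp [thA]

lemma fox_chain (hθ : ∀ a, θ (Monoid.Coprod.inl a) = Monoid.Coprod.inl a) (i : X) (g : FP A X) :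
    foxD i (θ g) = ∑ j, thA θ (foxD j g) * foxD i (θ (gx j)) := by
  obtain ⟨w, rfl⟩ := wval_surj g
  induction w with
  | nil => simp [foxD_one]
  | cons l w ih =>
    rw [wval_cons, map_mul, foxD_mul, ih]
    simp only [foxD_mul, map_add, map_mul, thA_of, add_mul, Finset.sum_add_distrib, Finset.mul_sum,
      mul_assoc]
    congr 1
    rcases l with a | ⟨j, b⟩
    · simp [lval, hθ, foxD_inl]
    · cases b
      · simp only [lval, map_inv, foxD_inv, foxD_gx, map_neg, map_mul]
        rw [Finset.sum_eq_single j]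
        · simp only [if_true, map_one, mul_one, thA_of, neg_mul]; simp [thA]
        · intro b _ hb; simp [hb]
        · simp
      · simp only [lval, foxD_gx]
        rw [Finset.sum_eq_single j]
        · simp
        · intro b _ hb; simp [hb]
        · simp

lemma coeff_gof (g h : FP A X) (x : GA A X) : (gof g * x).coeff h = x.coeff (g⁻¹ * h) := by
  simp [gof, MonoidAlgebra.of]

lemma fox_coeff (j : X) (w : List (A ⊕ X × Bool)) : ∀ g : FP A X,
    ∃ a b : ℕ, (gof g * thA θ (foxD j (wval w))).coeff 1 = (a : ℂ) - b ∧
      (0 < a → ∃ w1 w2, w = w1 ++ .inr (j, true) :: w2 ∧ g * θ (wval w1) = 1) ∧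
      (0 < b → ∃ w1 w2, w = w1 ++ .inr (j, false) :: w2 ∧ g * θ (wval w1 * (gx j)⁻¹) = 1) := by
  classical
  induction w with
  | nil => intro g; exact ⟨0, 0, by simp [foxD_one], by simp, by simp⟩
  | cons l w ih =>
    intro g
    obtain ⟨a, b, h1, h2, h3⟩ := ih (g * θ (lval l))
    have e1 : gof g * thA θ (foxD j (wval (l :: w))) = gof g * thA θ (foxD j (lval l))
        + gof (g * θ (lval l)) * thA θ (foxD j (wval w)) := by
      rw [wval_cons, foxD_mul, map_add, map_mul, thA_of, gof_mul, mul_add, mul_assoc]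
    have h2' : 0 < a → ∃ w1 w2, l :: w = w1 ++ .inr (j, true) :: w2 ∧ g * θ (wval w1) = 1 := by
      intro h
      obtain ⟨w1, w2, rfl, h5⟩ := h2 h
      exact ⟨l :: w1, w2, by simp, by simpa [mul_assoc] using h5⟩
    have h3' : 0 < b → ∃ w1 w2, l :: w = w1 ++ .inr (j, false) :: w2 ∧
        g * θ (wval w1 * (gx j)⁻¹) = 1 := by
      intro h
      obtain ⟨w1, w2, rfl, h5⟩ := h3 h
      exact ⟨l :: w1, w2, by simp, by simpa [mul_assoc] using h5⟩
    have triv : foxD j (lval l) = 0 → ∃ a b : ℕ,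
      (gof g * thA θ (foxD j (wval (l :: w)))).coeff 1 = (a : ℂ) - b ∧
      (0 < a → ∃ w1 w2, l :: w = w1 ++ .inr (j, true) :: w2 ∧ g * θ (wval w1) = 1) ∧
      (0 < b → ∃ w1 w2, l :: w = w1 ++ .inr (j, false) :: w2 ∧ g * θ (wval w1 * (gx j)⁻¹) = 1) := by
      intro h
      exact ⟨a, b, by rw [e1, h]; simpa using h1, h2', h3'⟩
    have cg : ∀ h : FP A X, (gof h).coeff 1 = if h = 1 then (1 : ℂ) else 0 := by
      intro h; simp [MonoidAlgebra.of, Finsupp.single_apply]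
    rcases l with c | ⟨k, ε⟩
    · exact triv (by simp [lval, foxD_inl])
    · by_cases hk : j = k
      · subst hk
        cases ε
        · by_cases hg : g * θ (gx j)⁻¹ = 1
          · refine ⟨a, b + 1, ?_, h2', fun _ => ⟨[], w, by simp, by simpa using hg⟩⟩
            rw [e1]
            simp only [lval, foxD_inv, foxD_gx, if_true, mul_one, map_neg, thA_of] at h1 ⊢
            rw [MonoidAlgebra.coeff_add, Finsupp.add_apply, h1, mul_neg, ← map_mul,
              MonoidAlgebra.coeff_neg, Finsupp.neg_apply, cg, if_pos hg]
            push_cast; ring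
          · refine ⟨a, b, ?_, h2', h3'⟩
            rw [e1]
            simp only [lval, foxD_inv, foxD_gx, if_true, mul_one, map_neg, thA_of] at h1 ⊢
            rw [MonoidAlgebra.coeff_add, Finsupp.add_apply, h1, mul_neg, ← map_mul,
              MonoidAlgebra.coeff_neg, Finsupp.neg_apply, cg, if_neg hg]
            simp
        · by_cases hg : g = 1
          · refine ⟨a + 1, b, ?_, fun _ => ⟨[], w, by simp, by simpa using hg⟩, h3'⟩
            rw [e1]
            simp only [lval, foxD_gx, if_true, mul_one, map_one] at h1 ⊢
            rw [MonoidAlgebra.coeff_add, Finsupp.add_apply, h1, cg, if_pos hg]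
            push_cast; ring
          · refine ⟨a, b, ?_, h2', h3'⟩
            rw [e1]
            simp only [lval, foxD_gx, if_true, mul_one, map_one] at h1 ⊢
            rw [MonoidAlgebra.coeff_add, Finsupp.add_apply, h1, cg, if_neg hg]
            simp
      · refine triv ?_
        cases ε <;> simp [lval, foxD_gx, foxD_inv, hk]

/-- Relative Hopf property. -/
theorem rel_hopf (hθ : ∀ a, θ (Monoid.Coprod.inl a) = Monoid.Coprod.inl a)
    (hs : Function.Surjective θ) : Function.Injective θ := by
  choose g hg using fun j : X => hs (gx j)
  set J : Matrix X X (GA A X) := fun j i => foxD i (θ (gx j)) with hJ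
  set V : Matrix X X (GA A X) := fun j k => thA θ (foxD k (g j)) with hV
  have hVJ : V * J = 1 := by
    ext1 j i
    rw [Matrix.mul_apply]
    have := fox_chain θ hθ i (g j)
    rw [hg, foxD_gx] at this
    rw [← this, Matrix.one_apply]
    simp [eq_comm]
  have hJV := kaplansky V J hVJ
  have key : ∀ u : FP A X, (∀ i, foxD i (θ u) = 0) → ∀ j, thA θ (foxD j u) = 0 := by
    intro u hu
    have : Matrix.vecMul (fun j => thA θ (foxD j u)) J = 0 := by
      ext1 i
      simp only [Matrix.vecMul, dotProduct, Pi.zero_apply]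
      rw [← hu i, fox_chain θ hθ]
    have h2 : Matrix.vecMul (Matrix.vecMul (fun j => thA θ (foxD j u)) J) V = 0 := by
      rw [this]; simp
    rw [Matrix.vecMul_vecMul, hJV, Matrix.vecMul_one] at h2
    intro j
    exact congrFun h2 j
  have main : ∀ (N : ℕ) (w : List (A ⊕ X × Bool)), w.length ≤ N →
      (∃ a, θ (wval w) = Monoid.Coprod.inl a) → ∃ a, wval w = Monoid.Coprod.inl a := by
    intro N
    induction N with
    | zero =>
      intro w hw _
      have : w = [] := by simpa using hw
      subst this
      exact ⟨1, by simp⟩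
    | succ N ih =>
      intro w hw ⟨a, ha⟩
      rcases w with _ | ⟨l, w⟩
      · exact ⟨1, by simp⟩
      have inj1 : ∀ v : List (A ⊕ X × Bool), v.length ≤ N → θ (wval v) = 1 → wval v = 1 := by
        intro v hv h
        obtain ⟨c, hc⟩ := ih v hv ⟨1, by simpa using h⟩
        rw [hc, hθ] at h
        rw [hc, h]
      simp only [List.length_cons] at hw
      rcases l with c | ⟨j, ε⟩
      · rw [wval_cons, map_mul] at ha
        simp only [lval, hθ] at ha
        obtain ⟨d, hd⟩ := ih w (by omega) ⟨c⁻¹ * a, by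
          rw [map_mul, map_inv]; exact eq_inv_mul_of_mul_eq ha⟩
        exact ⟨c * d, by simp [lval, hd]⟩
      · have h0 := key (wval (.inr (j, ε) :: w)) (by intro i; rw [ha, foxD_inl]) j
        suffices h : ∃ w1 w2, w = w1 ++ .inr (j, !ε) :: w2 ∧ θ (wval w1) = 1 by
          obtain ⟨w1, w2, rfl, h1⟩ := h
          simp only [List.length_append, List.length_cons] at hw
          have h2 := inj1 w1 (by omega) h1
          have h3 : wval (.inr (j, ε) :: (w1 ++ .inr (j, !ε) :: w2)) = wval w2 := by
            cases ε <;> simp [h2, lval]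
          rw [h3] at ha ⊢
          exact ih w2 (by omega) ⟨a, ha⟩
        cases ε
        · obtain ⟨p, q, h1, h2, h3⟩ := fox_coeff θ j w 1
          rw [wval_cons, foxD_mul] at h0
          simp only [lval, foxD_inv, foxD_gx, if_true, mul_one, map_add, map_neg, map_mul,
            thA_of] at h0
          have h5 : thA θ (foxD j (wval w)) = 1 := by
            have h6 : gof (θ (gx j)) * (-gof (θ (gx j)⁻¹) + gof (θ (gx j)⁻¹) * thA θ (foxD j (wval w))) = 0 := by
              rw [h0, mul_zero]
            rw [mul_add, ← mul_assoc, mul_neg, ← map_mul, ← map_mul, mul_inv_cancel, map_one, map_one, one_mul] at h6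
            exact (neg_add_eq_zero.1 h6).symm
          rw [h5, gof_one, one_mul] at h1
          have h7 : (p : ℂ) = q + 1 := by
            have : ((1 : GA A X)).coeff 1 = (1 : ℂ) := by simp [MonoidAlgebra.one_def]
            rw [this] at h1
            rw [h1]; ring
          have h8 : p = q + 1 := by exact_mod_cast h7
          obtain ⟨w1, w2, h9, h10⟩ := h2 (by omega)
          exact ⟨w1, w2, by simpa using h9, by simpa using h10⟩
        · obtain ⟨p, q, h1, h2, h3⟩ := fox_coeff θ j w (θ (gx j))
          rw [wval_cons, foxD_mul] at h0
          simp only [lval, foxD_gx, if_true, map_one, map_add, map_mul, thA_of] at h0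
          have h5 : gof (θ (gx j)) * thA θ (foxD j (wval w)) = -1 := by
            exact (neg_eq_of_add_eq_zero_right h0).symm
          rw [h5] at h1
          have h7 : (q : ℂ) = p + 1 := by
            have : (-(1 : GA A X)).coeff 1 = (-1 : ℂ) := by simp [MonoidAlgebra.one_def]
            rw [this] at h1
            linear_combination h1
          have h8 : q = p + 1 := by exact_mod_cast h7
          obtain ⟨w1, w2, h9, h10⟩ := h3 (by omega)
          refine ⟨w1, w2, by simpa using h9, ?_⟩
          rw [map_mul, map_inv] at h10
          simpa [mul_assoc, mul_inv_eq_one, mul_eq_one_iff_eq_inv] using h10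
  rw [injective_iff_map_eq_one]
  intro u hu
  obtain ⟨w, rfl⟩ := wval_surj u
  obtain ⟨a, ha⟩ := main w.length w le_rfl ⟨1, by simpa using hu⟩
  rw [ha, hθ] at hu
  rw [ha, hu]

end RelHopf

end ORT


set_option linter.all false

namespace ORT

noncomputable section Setup

variable {α : Type}

/-- inverse letter -/
def invL (l : α × Bool) : α × Bool := (l.1, !l.2)

/-- value of a letter -/
def ell (l : α × Bool) : FreeGroup α := if l.2 then FreeGroup.of l.1 else (FreeGroup.of l.1)⁻¹

lemma ell_mk (l : α × Bool) (w : List (α × Bool)) : FreeGroup.mk (l :: w) = ell l * FreeGroup.mk w := by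
  rcases l with ⟨a, b⟩
  cases b
  · simp only [ell, FreeGroup.of, FreeGroup.inv_mk, FreeGroup.invRev]
    rw [if_neg (by simp), FreeGroup.mul_mk]; rfl
  · simp only [ell, FreeGroup.of]
    rw [if_pos trivial, FreeGroup.mul_mk]; rfl

/-- The combinatorial data of a cyclically reduced word with a stacking, and an exponent. -/
structure Dat (α : Type) where
  L : ℕ
  pos : NeZero L
  y : ZMod L → α × Bool
  red : ∀ i, y (i + 1) ≠ invL (y i)
  n : ℕ
  hn : 2 ≤ n
  rk : ZMod L → ℕ
  rk_inj : Function.Injective rk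
  ord1 : ∀ i j, y i = y j → (rk i < rk j ↔ rk (i + 1) < rk (j + 1))
  ord2 : ∀ i j, y i = invL (y j) → (rk i < rk (j + 1) ↔ rk (i + 1) < rk j)

attribute [instance] Dat.pos

variable (D : Dat α) {V : Type} [MulAction (FreeGroup α) V]

/-- The words along the cycle. -/
def Dat.W (i : ZMod D.L) : ℕ → FreeGroup α
  | 0 => 1
  | k + 1 => ell (D.y (i + k)) * Dat.W i k

/-- The rotation-translation map. -/
def sig : Equiv.Perm (V × ZMod D.L) where
  toFun p := (ell (D.y p.2) • p.1, p.2 + 1)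
  invFun p := ((ell (D.y (p.2 - 1)))⁻¹ • p.1, p.2 - 1)
  left_inv p := by simp
  right_inv p := by simp

lemma sig_apply (p : V × ZMod D.L) : sig D p = (ell (D.y p.2) • p.1, p.2 + 1) := rfl

lemma sig_pow (k : ℕ) (p : V × ZMod D.L) : (sig D ^ k) p = (D.W p.2 k • p.1, p.2 + k) := by
  induction k with
  | zero => simp [Dat.W]
  | succ k ih =>
    rw [pow_succ', Equiv.Perm.mul_apply, ih, sig_apply, Dat.W, mul_smul]
    simp [add_assoc]

/-- Edge underlying a letter at a vertex. -/
def edge (l : α × Bool) (x : V) : V × α := (if l.2 then x else (FreeGroup.of l.1)⁻¹ • x, l.1)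

/-- Edge of a point. -/
def eta (p : V × ZMod D.L) : V × α := edge (D.y p.2) p.1

/-- source point -/
def srcP (p : V × ZMod D.L) : V × ZMod D.L := if (D.y p.2).2 then p else sig D p
def tgtP (p : V × ZMod D.L) : V × ZMod D.L := if (D.y p.2).2 then sig D p else p

lemma srcP_fst (p : V × ZMod D.L) : (srcP D p).1 = (eta D p).1 := by
  rw [srcP, eta, edge, sig_apply, ell]
  split_ifs <;> simp

lemma tgtP_fst (p : V × ZMod D.L) : (tgtP D p).1 = FreeGroup.of (eta D p).2 • (eta D p).1 := by
  rw [tgtP, eta, edge, sig_apply, ell]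
  split_ifs <;> simp

lemma eta_gen {p q : V × ZMod D.L} (h : eta D p = eta D q) :
    D.y p.2 = D.y q.2 ∨ D.y p.2 = invL (D.y q.2) := by
  have h2 : (D.y p.2).1 = (D.y q.2).1 := congrArg Prod.snd h
  rcases hp : D.y p.2 with ⟨a, b⟩
  rcases hq : D.y q.2 with ⟨a', b'⟩
  rw [hp, hq] at h2
  simp only at h2
  subst h2
  cases b <;> cases b' <;> simp [invL]

lemma eta_same {p q : V × ZMod D.L} (h : eta D p = eta D q) (h2 : D.y p.2 = D.y q.2) :
    p.1 = q.1 := by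
  have h1 : (eta D p).1 = (eta D q).1 := congrArg Prod.fst h
  simp only [eta, edge, h2] at h1
  split_ifs at h1
  · exact h1
  · exact smul_left_cancel _ h1

lemma eta_opp {p q : V × ZMod D.L} (h : eta D p = eta D q) (h2 : D.y p.2 = invL (D.y q.2)) :
    p.1 = (sig D q).1 := by
  have h1 : (eta D p).1 = (eta D q).1 := congrArg Prod.fst h
  rcases hq : D.y q.2 with ⟨a', b'⟩
  rw [hq] at h2
  simp only [eta, edge, h2, sig_apply, ell, invL, hq] at h1 ⊢
  cases b' <;> simp at h1 ⊢
  · exact h1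
  · rw [← h1]; simp

lemma eta_opp' {p q : V × ZMod D.L} (h : eta D p = eta D q) (h2 : D.y p.2 = invL (D.y q.2)) :
    (sig D p).1 = q.1 := by
  refine (eta_opp D h.symm ?_).symm
  rw [h2]; simp [invL]

lemma not_sig_eq {p q : V × ZMod D.L} (h2 : D.y p.2 = invL (D.y q.2)) : p ≠ sig D q := by
  rintro rfl
  exact D.red _ h2

lemma eta_ord {p q : V × ZMod D.L} (h : eta D p = eta D q) :
    (D.rk (srcP D p).2 < D.rk (srcP D q).2 ↔ D.rk (tgtP D p).2 < D.rk (tgtP D q).2) := by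
  rcases eta_gen D h with h2 | h2
  · have := D.ord1 _ _ h2
    simp only [srcP, tgtP, h2]
    split_ifs
    · exact this
    · exact this.symm
  · have := D.ord2 _ _ h2
    simp only [srcP, tgtP, h2, invL]
    by_cases hb : (D.y q.2).2 <;> simp [hb, sig_apply]
    · exact this.symm
    · exact this

lemma src_inj {p q : V × ZMod D.L} (h : eta D p = eta D q) (h1 : (srcP D p).2 = (srcP D q).2) :
    p = q := by
  rcases eta_gen D h with h2 | h2
  · refine Prod.ext (eta_same D h h2) ?_
    simp only [srcP, h2] at h1
    split_ifs at h1
    · exact h1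
    · simpa [sig_apply] using h1
  · exfalso
    simp only [srcP, h2, invL] at h1
    by_cases hb : (D.y q.2).2 <;> simp [hb, sig_apply] at h1
    · refine D.red p.2 ?_
      rw [h1, h2]; simp [invL]
    · refine D.red q.2 ?_
      rw [← h1, h2]

/-- top points at vertices -/
def Vtop (N : Set (V × ZMod D.L)) (p : V × ZMod D.L) : Prop :=
  p ∈ N ∧ ∀ q ∈ N, q.1 = p.1 → D.rk q.2 ≤ D.rk p.2

def Etop (N : Set (V × ZMod D.L)) (p : V × ZMod D.L) : Prop :=
  p ∈ N ∧ ∀ q ∈ N, eta D q = eta D p → D.rk (srcP D q).2 ≤ D.rk (srcP D p).2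

variable {D}
variable {N : Set (V × ZMod D.L)}

lemma srcP_mem (hs : ∀ p ∈ N, sig D p ∈ N) {p} (hp : p ∈ N) : srcP D p ∈ N := by
  rw [srcP]; split_ifs
  · exact hp
  · exact hs _ hp

lemma tgtP_mem (hs : ∀ p ∈ N, sig D p ∈ N) {p} (hp : p ∈ N) : tgtP D p ∈ N := by
  rw [tgtP]; split_ifs
  · exact hs _ hp
  · exact hp

lemma etop_of_src (hs : ∀ p ∈ N, sig D p ∈ N) {p} (hp : p ∈ N) (h : Vtop D N (srcP D p)) :
    Etop D N p := by
  refine ⟨hp, fun q hq he => h.2 _ (srcP_mem hs hq) ?_⟩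
  rw [srcP_fst, srcP_fst, he]

lemma etop_of_tgt (hs : ∀ p ∈ N, sig D p ∈ N) {p} (hp : p ∈ N) (h : Vtop D N (tgtP D p)) :
    Etop D N p := by
  refine ⟨hp, fun q hq he => ?_⟩
  have h1 := h.2 _ (tgtP_mem hs hq) (by rw [tgtP_fst, tgtP_fst, he])
  by_contra hc
  push Not at hc
  have := (eta_ord D he.symm).1 hc
  omega

lemma etop_of_vtop (hs : ∀ p ∈ N, sig D p ∈ N) {p} (h : Vtop D N p) : Etop D N p := by
  by_cases hb : (D.y p.2).2
  · exact etop_of_src hs h.1 (by rw [srcP, if_pos hb]; exact h)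
  · exact etop_of_tgt hs h.1 (by rw [tgtP, if_neg hb]; exact h)

lemma etop_of_vtop' (hs : ∀ p ∈ N, sig D p ∈ N) {p} (hp : p ∈ N) (h : Vtop D N (sig D p)) :
    Etop D N p := by
  by_cases hb : (D.y p.2).2
  · exact etop_of_tgt hs hp (by rw [tgtP, if_pos hb]; exact h)
  · exact etop_of_src hs hp (by rw [srcP, if_neg hb]; exact h)

lemma sig_pow_mem (hs : ∀ p ∈ N, sig D p ∈ N) (k : ℕ) {p} (hp : p ∈ N) : (sig D ^ k) p ∈ N := by
  induction k with
  | zero => simpa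
  | succ k ih => rw [pow_succ', Equiv.Perm.mul_apply]; exact hs _ ih

lemma sig_surjOn (hf : N.Finite) (hs : ∀ p ∈ N, sig D p ∈ N) {p} (hp : p ∈ N) :
    ∃ q ∈ N, sig D q = p := by
  have : sig D '' N = N := by
    apply Set.eq_of_subset_of_ncard_le
    · rintro _ ⟨q, hq, rfl⟩; exact hs q hq
    · rw [Set.ncard_image_of_injective _ (sig D).injective]
    · exact hf
  rw [← this] at hp
  obtain ⟨q, hq, rfl⟩ := hp
  exact ⟨q, hq, rfl⟩

lemma card_vtop (hf : N.Finite) : {p | Vtop D N p}.ncard = (Prod.fst '' N).ncard := by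
  have : Prod.fst '' {p | Vtop D N p} = Prod.fst '' N := by
    apply Set.Subset.antisymm
    · exact Set.image_mono fun p hp => hp.1
    · rintro _ ⟨p, hp, rfl⟩
      obtain ⟨q, hq, hm⟩ := Set.exists_max_image {q ∈ N | q.1 = p.1} (fun q => D.rk q.2)
        (hf.subset fun q hq => hq.1) ⟨p, hp, rfl⟩
      exact ⟨q, ⟨hq.1, fun q' h1 h2 => hm q' ⟨h1, h2.trans hq.2⟩⟩, hq.2⟩
  rw [← this, Set.ncard_image_of_injOn]
  intro p hp q hq h
  refine Prod.ext h (D.rk_inj (le_antisymm (hq.2 p hp.1 h) (hp.2 q hq.1 h.symm)))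

lemma card_etop (hf : N.Finite) : {p | Etop D N p}.ncard = (eta D '' N).ncard := by
  have : eta D '' {p | Etop D N p} = eta D '' N := by
    apply Set.Subset.antisymm
    · exact Set.image_mono fun p hp => hp.1
    · rintro _ ⟨p, hp, rfl⟩
      obtain ⟨q, hq, hm⟩ := Set.exists_max_image {q ∈ N | eta D q = eta D p} (fun q => D.rk (srcP D q).2)
        (hf.subset fun q hq => hq.1) ⟨p, hp, rfl⟩
      exact ⟨q, ⟨hq.1, fun q' h1 h2 => hm q' ⟨h1, h2.trans hq.2⟩⟩, hq.2⟩
  rw [← this, Set.ncard_image_of_injOn]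
  intro p hp q hq h
  exact src_inj D h (D.rk_inj (le_antisymm (hq.2 p hp.1 h) (hp.2 q hq.1 h.symm)))

/-- The w-cycles inequality. -/
theorem win (hf : N.Finite) (hs : ∀ p ∈ N, sig D p ∈ N)
    (hirr : ∀ p ∈ N, ∃ q ∈ N, q ≠ p ∧ eta D q = eta D p) :
    (Prod.fst '' N).ncard + {p ∈ N | p.2 = 0}.ncard ≤ (eta D '' N).ncard := by
  obtain ⟨imax, himax⟩ := Finite.exists_max D.rk
  obtain ⟨imin, himin⟩ := Finite.exists_min D.rk
  -- tops at imax
  have hmax : ∀ p ∈ N, p.2 = imax → Vtop D N p := fun p hp h => ⟨hp, fun q _ _ => h ▸ himax q.2⟩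
  have hmin : ∀ p ∈ N, p.2 = imin → ¬ Vtop D N p := by
    intro p hp h ht
    obtain ⟨q, hq, hne, he⟩ := hirr p hp
    have single : ∀ q ∈ N, q.1 = p.1 → q = p := by
      intro q hq h1
      refine Prod.ext h1 (D.rk_inj (le_antisymm (ht.2 q hq h1) ?_))
      rw [h]; exact himin _
    rcases eta_gen D he with h2 | h2
    · exact hne (single q hq (eta_same D he h2))
    · have h3 := single _ (hs q hq) (eta_opp' D he h2)
      refine D.red q.2 ?_
      have : p.2 = q.2 + 1 := by rw [← h3]; rfl
      rw [← this, h2]; simp [invL]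
  set X : Set (V × ZMod D.L) := {p | Etop D N p ∧ ¬ Vtop D N (sig D p)} with hX
  have hEf : {p | Etop D N p}.Finite := hf.subset fun p hp => hp.1
  have hsub : {p | p ∈ N ∧ Vtop D N (sig D p)} ⊆ {p | Etop D N p} :=
    fun p hp => etop_of_vtop' hs hp.1 hp.2
  have c1 : {p | p ∈ N ∧ Vtop D N (sig D p)}.ncard = {p | Vtop D N p}.ncard := by
    have : sig D '' {p | p ∈ N ∧ Vtop D N (sig D p)} = {p | Vtop D N p} := by
      apply Set.Subset.antisymm
      · rintro _ ⟨p, hp, rfl⟩; exact hp.2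
      · intro p hp
        obtain ⟨q, hq, rfl⟩ := sig_surjOn hf hs hp.1
        exact ⟨q, ⟨hq, hp⟩, rfl⟩
    rw [← this, Set.ncard_image_of_injective _ (sig D).injective]
  have c2 : X.ncard + {p | Vtop D N p}.ncard = {p | Etop D N p}.ncard := by
    rw [← c1, ← Set.ncard_union_eq (hs := hEf.subset fun p hp => hp.1) (ht := hEf.subset hsub)]
    · congr 1
      ext p
      constructor
      · rintro (h | h)
        · exact h.1
        · exact hsub h
      · intro h
        by_cases h' : Vtop D N (sig D p)
        · exact Or.inr ⟨h.1, h'⟩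
        · exact Or.inl ⟨h, h'⟩
    · rw [Set.disjoint_left]
      intro p h1 h2
      exact h1.2 h2.2
  have ex : ∀ p : V × ZMod D.L, p ∈ N → p.2 = imax → ∃ t < D.L, (sig D ^ t) p ∈ X := by
    intro p hp h
    have hex : ∃ t, ¬ Vtop D N ((sig D ^ t) p) := by
      refine ⟨(imin - imax).val, hmin _ (sig_pow_mem hs _ hp) ?_⟩
      rw [sig_pow, h]; simp
    classical
    have hle : Nat.find hex ≤ (imin - imax).val := by
      apply Nat.find_min'
      refine hmin _ (sig_pow_mem hs _ hp) ?_
      rw [sig_pow, h]; simp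
    have hlt : (imin - imax).val < D.L := ZMod.val_lt _
    have hsp := Nat.find_spec hex
    have h0 : Nat.find hex ≠ 0 := by
      intro h0
      rw [h0] at hsp
      exact hsp (by simpa using hmax p hp h)
    obtain ⟨t, ht⟩ := Nat.exists_eq_succ_of_ne_zero h0
    have hm := Nat.find_min hex (m := t) (by omega)
    push Not at hm
    refine ⟨t, by omega, etop_of_vtop hs hm, ?_⟩
    rw [ht, pow_succ', Equiv.Perm.mul_apply] at hsp
    exact hsp
  choose! t ht1 ht2 using ex
  have c3 : {p ∈ N | p.2 = imax}.ncard ≤ X.ncard := by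
    apply Set.ncard_le_ncard_of_injOn (fun p => (sig D ^ t p) p) (ht := hEf.subset fun p hp => hp.1)
    · intro p hp; exact ht2 p hp.1 hp.2
    · intro p hp q hq h
      simp only at h
      have h2 : p.2 + t p = q.2 + t q := by
        have := congrArg Prod.snd h
        simpa [sig_pow] using this
      rw [hp.2, hq.2] at h2
      have h3 : ((t p : ℕ) : ZMod D.L) = (t q : ℕ) := add_left_cancel h2
      have h4 : t p = t q := by
        have := congrArg ZMod.val h3
        rwa [ZMod.val_natCast_of_lt (ht1 p hp.1 hp.2), ZMod.val_natCast_of_lt (ht1 q hq.1 hq.2)] at this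
      rw [h4] at h
      exact (sig D ^ t q).injective h
  have c4 : {p ∈ N | p.2 = 0}.ncard ≤ {p ∈ N | p.2 = imax}.ncard := by
    apply Set.ncard_le_ncard_of_injOn (fun p => (sig D ^ imax.val) p) (ht := hf.subset fun p hp => hp.1)
    · intro p hp
      refine ⟨sig_pow_mem hs _ hp.1, ?_⟩
      rw [sig_pow, hp.2]; simp
    · intro p _ q _ h; exact (sig D ^ imax.val).injective h
  rw [card_vtop hf, card_etop hf] at c2
  omega

end Setup

end ORT


set_option linter.all false

namespace ORT

noncomputable section Cocycles

variable {α : Type} {V V' : Type} [MulAction (FreeGroup α) V] [MulAction (FreeGroup α) V']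
variable {M M' : Type} [Group M] [Group M']

/-- The skew-product permutation representation. -/
def cocP (c : V × α → M) : FreeGroup α →* Equiv.Perm (V × M) :=
  FreeGroup.lift fun a =>
    { toFun := fun q => (FreeGroup.of a • q.1, c (q.1, a) * q.2)
      invFun := fun q => ((FreeGroup.of a)⁻¹ • q.1, (c ((FreeGroup.of a)⁻¹ • q.1, a))⁻¹ * q.2)
      left_inv := fun q => by simp
      right_inv := fun q => by simp }

/-- The cocycle determined by `c`. -/
def coc (c : V × α → M) (g : FreeGroup α) (x : V) : M := (cocP c g (x, 1)).2

lemma cocP_apply (c : V × α → M) (g : FreeGroup α) :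
    ∀ (x : V) (m : M), cocP c g (x, m) = (g • x, coc c g x * m) := by
  have hmul : ∀ g h : FreeGroup α, (∀ (x : V) (m : M), cocP c g (x, m) = (g • x, coc c g x * m)) →
      (∀ (x : V) (m : M), cocP c h (x, m) = (h • x, coc c h x * m)) →
      ∀ (x : V) (m : M), cocP c (g * h) (x, m) = ((g * h) • x, coc c (g * h) x * m) := by
    intro g h hg hh x m
    have e : coc c (g * h) x = coc c g (h • x) * coc c h x := by
      rw [coc, map_mul, Equiv.Perm.mul_apply, hh, hg]; simp
    rw [e, map_mul, Equiv.Perm.mul_apply, hh, hg, mul_smul, mul_assoc]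
  induction g using FreeGroup.induction_on with
  | C1 => intro x m; simp [coc]
  | of a => intro x m; simp [coc, cocP]
  | inv_of a h =>
    intro x m
    have key : ∀ (x : V) (m : M), cocP c (FreeGroup.of a)⁻¹ (x, m) =
        ((FreeGroup.of a)⁻¹ • x, (c ((FreeGroup.of a)⁻¹ • x, a))⁻¹ * m) := by
      intro x m
      rw [map_inv, Equiv.Perm.inv_eq_iff_eq]
      simp [cocP]
    rw [coc, key, key]; simp
  | mul x y hx hy => exact hmul _ _ hx hy

variable (c : V × α → M)

@[simp] lemma coc_one (x : V) : coc c 1 x = 1 := by simp [coc]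

lemma coc_mul (g h : FreeGroup α) (x : V) : coc c (g * h) x = coc c g (h • x) * coc c h x := by
  rw [coc, map_mul, Equiv.Perm.mul_apply, cocP_apply, cocP_apply]; simp

@[simp] lemma coc_of (a : α) (x : V) : coc c (FreeGroup.of a) x = c (x, a) := by
  simp [coc, cocP]

lemma coc_inv (g : FreeGroup α) (x : V) : coc c g⁻¹ x = (coc c g (g⁻¹ • x))⁻¹ := by
  have := coc_mul c g g⁻¹ x
  rw [mul_inv_cancel, coc_one] at this
  exact eq_inv_of_mul_eq_one_right this.symm

lemma coc_ell (l : α × Bool) (x : V) :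
    coc c (ell l) x = if l.2 then c (edge l x) else (c (edge l x))⁻¹ := by
  rcases l with ⟨a, b⟩
  cases b <;> simp [ell, edge, coc_inv]

lemma coc_unique (u : FreeGroup α → V → M) (hm : ∀ g h x, u (g * h) x = u g (h • x) * u h x)
    (ho : ∀ a x, u (FreeGroup.of a) x = c (x, a)) (g : FreeGroup α) : ∀ x, u g x = coc c g x := by
  have h1 : ∀ x, u 1 x = 1 := by
    intro x
    have := hm 1 1 x
    simpa using this
  induction g using FreeGroup.induction_on with
  | C1 => intro x; rw [h1, coc_one]
  | of a => intro x; rw [ho, coc_of]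
  | inv_of a h =>
    intro x
    have := hm (FreeGroup.of a) (FreeGroup.of a)⁻¹ x
    rw [mul_inv_cancel, h1, h] at this
    rw [coc_inv]
    exact eq_inv_of_mul_eq_one_right this.symm
  | mul x y hx hy => intro z; rw [hm, coc_mul, hx, hy]

lemma coc_map (φ : M →* M') (g : FreeGroup α) (x : V) :
    coc (fun e => φ (c e)) g x = φ (coc c g x) := by
  symm
  apply coc_unique (fun e => φ (c e)) (fun g x => φ (coc c g x))
  · intro g h x; rw [coc_mul, map_mul]
  · intro a x; rw [coc_of]

lemma coc_pull (f : V → V') (hf : ∀ (g : FreeGroup α) x, f (g • x) = g • f x) (c : V' × α → M)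
    (g : FreeGroup α) (x : V) : coc (fun e : V × α => c (f e.1, e.2)) g x = coc c g (f x) := by
  symm
  apply coc_unique (fun e : V × α => c (f e.1, e.2)) (fun g x => coc c g (f x))
  · intro g h x; rw [coc_mul, hf]
  · intro a x; rw [coc_of]

lemma coc_gauge (τ : V → M) (g : FreeGroup α) (x : V) :
    coc (fun e => τ (FreeGroup.of e.2 • e.1) * c e * (τ e.1)⁻¹) g x
      = τ (g • x) * coc c g x * (τ x)⁻¹ := by
  symm
  apply coc_unique (fun e => τ (FreeGroup.of e.2 • e.1) * c e * (τ e.1)⁻¹)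
    (fun g x => τ (g • x) * coc c g x * (τ x)⁻¹)
  · intro g h x; rw [coc_mul, mul_smul]; group
  · intro a x; rw [coc_of]

lemma coc_mulc {M : Type} [CommGroup M] (c c' : V × α → M) (g : FreeGroup α) (x : V) :
    coc (fun e => c e * c' e) g x = coc c g x * coc c' g x := by
  symm
  apply coc_unique (fun e => c e * c' e) (fun g x => coc c g x * coc c' g x)
  · intro g h x; rw [coc_mul, coc_mul]; exact mul_mul_mul_comm _ _ _ _
  · intro a x; rw [coc_of, coc_of]

lemma coc_mk_congr (c c' : V × α → M) (x : V) (w : List (α × Bool))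
    (h : ∀ w1 l w2, w = w1 ++ l :: w2 → c (edge l (FreeGroup.mk w2 • x)) = c' (edge l (FreeGroup.mk w2 • x))) :
    coc c (FreeGroup.mk w) x = coc c' (FreeGroup.mk w) x := by
  induction w with
  | nil => simp [← FreeGroup.one_eq_mk]
  | cons l w ih =>
    rw [ell_mk, coc_mul, coc_mul, ih, coc_ell, coc_ell, h [] l w rfl]
    intro w1 l' w2 hw
    exact h (l :: w1) l' w2 (by simp [hw])

/-- normal form of cocycle being trivial -/
lemma coc_trivial (g : FreeGroup α) (x : V) : coc (fun _ : V × α => (1 : M)) g x = 1 := by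
  symm
  exact coc_unique (fun _ : V × α => (1 : M)) (fun _ _ => 1) (by simp) (by simp) g x

variable (D : Dat α)

lemma W_zero (i : ZMod D.L) : D.W i 0 = 1 := rfl
lemma W_succ (i : ZMod D.L) (k : ℕ) : D.W i (k + 1) = ell (D.y (i + k)) * D.W i k := rfl

lemma W_add (i : ZMod D.L) (k l : ℕ) : D.W i (k + l) = D.W (i + k) l * D.W i k := by
  induction l with
  | zero => simp [W_zero]
  | succ l ih => rw [← add_assoc, W_succ, ih, W_succ]; push_cast; simp only [mul_assoc, add_assoc]

lemma W_one (i : ZMod D.L) : D.W i 1 = ell (D.y i) := by simp [W_succ, W_zero]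

/-- The full period. -/
abbrev Dat.nL : ℕ := D.n * D.L

lemma nL_cast : ((D.nL : ℕ) : ZMod D.L) = 0 := by simp [Dat.nL]

lemma nL_pos : 0 < D.nL := Nat.mul_pos (by have := D.hn; omega) (Nat.pos_of_neZero _)

/-- Holonomy around the relator based at a point. -/
def hol (p : V × ZMod D.L) : M := coc c (D.W p.2 D.nL) p.1

/-- fixed points -/
def Fixd (V : Type) [MulAction (FreeGroup α) V] : Set (V × ZMod D.L) := {p | (sig D ^ D.nL) p = p}

lemma mem_Fixd (p : V × ZMod D.L) : p ∈ Fixd D V ↔ D.W p.2 D.nL • p.1 = p.1 := by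
  rw [Fixd, Set.mem_setOf_eq, sig_pow, nL_cast, add_zero, Prod.ext_iff]
  simp

lemma Fixd_sig {p : V × ZMod D.L} (hp : p ∈ Fixd D V) : sig D p ∈ Fixd D V := by
  change (sig D ^ D.nL) (sig D p) = sig D p
  rw [← Equiv.Perm.mul_apply, ← pow_succ, pow_succ', Equiv.Perm.mul_apply]
  rw [show (sig D ^ D.nL) p = p from hp]

lemma hol_sig {p : V × ZMod D.L} (hp : p ∈ Fixd D V) :
    hol c D (sig D p) = coc c (ell (D.y p.2)) p.1 * hol c D p * (coc c (ell (D.y p.2)) p.1)⁻¹ := by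
  have h1 : D.W (p.2 + 1) D.nL * D.W p.2 1 = ell (D.y p.2) * D.W p.2 D.nL := by
    have e1 := W_add D p.2 1 D.nL
    have e2 := W_succ D p.2 D.nL
    rw [add_comm, e2, nL_cast, add_zero] at e1
    push_cast at e1
    exact e1.symm
  rw [W_one] at h1
  have h2 := congrArg (fun g => coc c g p.1) h1
  simp only [coc_mul, (mem_Fixd D p).1 hp] at h2
  rw [hol, sig_apply]
  exact eq_mul_inv_of_mul_eq h2

lemma hol_sig_one {p : V × ZMod D.L} (hp : p ∈ Fixd D V) (h : hol c D p = 1) :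
    hol c D (sig D p) = 1 := by
  rw [hol_sig c D hp, h]; simp

lemma Fixd_pow {p : V × ZMod D.L} (hp : p ∈ Fixd D V) (k : ℕ) : (sig D ^ k) p ∈ Fixd D V :=
  sig_pow_mem (fun _ => Fixd_sig D) k hp

lemma hol_pow_one {p : V × ZMod D.L} (hp : p ∈ Fixd D V) (h : hol c D p = 1) (k : ℕ) :
    hol c D ((sig D ^ k) p) = 1 := by
  induction k with
  | zero => simpa
  | succ k ih =>
    rw [pow_succ', Equiv.Perm.mul_apply]
    exact hol_sig_one c D (Fixd_pow D hp k) ih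

lemma pth_congr (c c' : V × α → M) (p : V × ZMod D.L) (k : ℕ)
    (h : ∀ j < k, c (eta D ((sig D ^ j) p)) = c' (eta D ((sig D ^ j) p))) :
    coc c (D.W p.2 k) p.1 = coc c' (D.W p.2 k) p.1 := by
  induction k with
  | zero => simp [W_zero]
  | succ k ih =>
    rw [W_succ, coc_mul, coc_mul, ih fun j hj => h j (by omega), coc_ell, coc_ell]
    have := h k (by omega)
    rw [sig_pow] at this
    rw [eta] at this
    simp only at this
    rw [this]

lemma hol_congr (c c' : V × α → M) {N : Set (V × ZMod D.L)} (hs : ∀ p ∈ N, sig D p ∈ N)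
    (h : ∀ e ∈ eta D '' N, c e = c' e) {p} (hp : p ∈ N) : hol c D p = hol c' D p :=
  pth_congr D c c' p _ fun j _ => h _ ⟨_, sig_pow_mem hs j hp, rfl⟩

/-- Irreducible families of relator cycles. -/
structure Irr (N : Set (V × ZMod D.L)) : Prop where
  sg : ∀ p ∈ N, sig D p ∈ N
  fx : ∀ p ∈ N, p ∈ Fixd D V
  ir : ∀ p ∈ N, ∃ q ∈ N, q ≠ p ∧ eta D q = eta D p

variable {D}

lemma Irr.sUnion {S : Set (Set (V × ZMod D.L))} (h : ∀ N ∈ S, Irr D N) : Irr D (⋃₀ S) where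
  sg := by rintro p ⟨N, hN, hp⟩; exact ⟨N, hN, (h N hN).sg p hp⟩
  fx := by rintro p ⟨N, hN, hp⟩; exact (h N hN).fx p hp
  ir := by
    rintro p ⟨N, hN, hp⟩
    obtain ⟨q, hq, h1⟩ := (h N hN).ir p hp
    exact ⟨q, ⟨N, hN, hq⟩, h1⟩

variable (D) in
/-- The largest irreducible subfamily. -/
def core (N : Set (V × ZMod D.L)) : Set (V × ZMod D.L) := ⋃₀ {B | B ⊆ N ∧ Irr D B}

lemma core_irr (N : Set (V × ZMod D.L)) : Irr D (core D N) := Irr.sUnion fun _ h => h.2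
lemma core_sub (N : Set (V × ZMod D.L)) : core D N ⊆ N := Set.sUnion_subset fun _ h => h.1
lemma sub_core {N B : Set (V × ZMod D.L)} (h : B ⊆ N) (hB : Irr D B) : B ⊆ core D N :=
  fun p hp => ⟨B, ⟨h, hB⟩, hp⟩

lemma zpow_fix {p : V × ZMod D.L} (hp : p ∈ Fixd D V) (z : ℤ) :
    ∃ k < D.nL, (sig D ^ z) p = (sig D ^ k) p := by
  have hpos : (0 : ℤ) < D.nL := by exact_mod_cast nL_pos D
  have h1 := Int.emod_nonneg z hpos.ne'
  have h2 := Int.emod_lt_of_pos z hpos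
  refine ⟨(z % D.nL).toNat, by omega, ?_⟩
  rw [← zpow_natCast, Int.toNat_of_nonneg h1]
  conv_lhs => rw [← Int.emod_add_mul_ediv z D.nL, zpow_add, zpow_mul, Equiv.Perm.mul_apply]
  have h := Equiv.Perm.zpow_apply_eq_self_of_apply_eq_self (f := sig D ^ D.nL) (x := p) hp
    (z / D.nL)
  rw [zpow_natCast, h]

/-- Collapsing lemma. -/
theorem collapse (N B : Set (V × ZMod D.L)) (hf : N.Finite) (hs : ∀ p ∈ N, sig D p ∈ N)
    (hx : ∀ p ∈ N, p ∈ Fixd D V) (tf : ∀ p ∈ N, ∀ k, 0 < k → k < D.nL → (sig D ^ k) p ≠ p)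
    (hB : Irr D B) (hBN : B ⊆ N) (hmax : ∀ B' ⊆ N, Irr D B' → B' ⊆ B) :
    ∃ ε : Set (V × α), ε ⊆ eta D '' N ∧ Disjoint ε (eta D '' B) ∧
      (∀ (M : Type) [Group M] (c : V × α → M), (∀ p ∈ B, hol c D p = 1) →
        ∃ c' : V × α → M, (∀ e ∉ ε, c' e = c e) ∧ ∀ p ∈ N, hol c' D p = 1) ∧
      (∀ (M : Type) [Group M] (c c' : V × α → M), (∀ p ∈ N, hol c D p = 1) →
        (∀ p ∈ N, hol c' D p = 1) → (∀ e ∈ eta D '' N, e ∉ ε → c e = c' e) →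
        ∀ e ∈ ε, c e = c' e) := by
  classical
  induction hk : N.ncard using Nat.strong_induction_on generalizing N with
  | _ k ih =>
  by_cases hNB : N ⊆ B
  · have : N = B := Set.Subset.antisymm hNB hBN
    subst this
    exact ⟨∅, by simp, by simp, fun M _ c h => ⟨c, by simp, h⟩, by simp⟩
  have hnI : ¬ Irr D N := fun h => hNB (hmax N le_rfl h)
  have : ∃ p ∈ N, ∀ q ∈ N, eta D q = eta D p → q = p := by
    by_contra hcon
    push Not at hcon
    refine hnI ⟨hs, hx, fun p hp => ?_⟩
    obtain ⟨q, h1, h2, h3⟩ := hcon p hp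
    exact ⟨q, h1, h3, h2⟩
  obtain ⟨p, hp, huniq⟩ := this
  set O : Set (V × ZMod D.L) := {q | ∃ j : ℤ, (sig D ^ j) p = q} with hO
  have pO : p ∈ O := ⟨0, by simp⟩
  have hpB : p ∉ B := by
    intro h
    obtain ⟨q, hq, h1, h2⟩ := hB.ir p h
    exact h1 (huniq q (hBN hq) h2)
  have hON : ∀ q ∈ O, ∃ j : ℕ, (sig D ^ j) p = q := by
    rintro q ⟨z, rfl⟩
    obtain ⟨k, -, hk⟩ := zpow_fix (hx p hp) z
    exact ⟨k, hk.symm⟩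
  have hBO : ∀ q ∈ B, q ∉ O := by
    rintro q hq ⟨j, rfl⟩
    obtain ⟨k, -, hk⟩ := zpow_fix (hB.fx _ hq) (-j)
    rw [← Equiv.Perm.mul_apply, ← zpow_add] at hk
    simp only [neg_add_cancel, zpow_zero, Equiv.Perm.coe_one, id_eq] at hk
    exact hpB (hk ▸ sig_pow_mem hB.sg k hq)
  set N' := N \ O with hN'
  have hs' : ∀ q ∈ N', sig D q ∈ N' := by
    rintro q ⟨hq, hqO⟩
    refine ⟨hs q hq, ?_⟩
    rintro ⟨j, hj⟩
    refine hqO ⟨-1 + j, ?_⟩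
    rw [zpow_add, Equiv.Perm.mul_apply, hj]
    simp
  have hN'N : N' ⊆ N := Set.diff_subset
  have hlt : N'.ncard < k := by
    rw [← hk]
    exact Set.ncard_lt_ncard ⟨hN'N, fun h => (h hp).2 pO⟩ hf
  obtain ⟨ε, h1, h2, h3, h4⟩ := ih _ hlt N' (hf.subset hN'N) hs' (fun q hq => hx q hq.1)
    (fun q hq => tf q hq.1) (fun q hq => ⟨hBN hq, hBO q hq⟩)
    (fun B' hB' hI => hmax B' (hB'.trans hN'N) hI) rfl
  have heN' : eta D p ∉ eta D '' N' := by
    rintro ⟨q, hq, he⟩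
    have := huniq q hq.1 he
    exact hq.2 (this ▸ pO)
  have hjne : ∀ j : ℕ, j < D.nL - 1 → eta D ((sig D ^ j) (sig D p)) ≠ eta D p := by
    intro j hj he
    rw [← Equiv.Perm.mul_apply, ← pow_succ] at he
    exact tf p hp (j + 1) (by omega) (by omega) (huniq _ (sig_pow_mem hs _ hp) he)
  have hol_split : ∀ (M : Type) [Group M] (c : V × α → M), hol c D p =
      coc c (D.W (sig D p).2 (D.nL - 1)) (sig D p).1 * coc c (ell (D.y p.2)) p.1 := by
    intro M _ c
    have e : D.nL = 1 + (D.nL - 1) := by have := nL_pos D; omega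
    rw [hol, e, W_add, coc_mul, W_one]
    simp [sig_apply]
  refine ⟨insert (eta D p) ε, ?_, ?_, ?_, ?_⟩
  · rintro e (rfl | he)
    · exact ⟨p, hp, rfl⟩
    · exact Set.image_mono hN'N (h1 he)
  · rw [Set.disjoint_left]
    rintro e (rfl | he) ⟨q, hq, hqe⟩
    · have := huniq q (hBN hq) hqe
      exact hpB (this ▸ hq)
    · exact Set.disjoint_left.1 h2 he ⟨q, hq, hqe⟩
  · intro M _ c hc
    obtain ⟨c', hc1, hc2⟩ := h3 M c hc
    set R := coc c' (D.W (sig D p).2 (D.nL - 1)) (sig D p).1 with hR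
    set t : M := if (D.y p.2).2 then R⁻¹ else R with ht
    refine ⟨Function.update c' (eta D p) t, ?_, ?_⟩
    · intro e he
      rw [Set.mem_insert_iff, not_or] at he
      rw [Function.update_of_ne he.1, hc1 e he.2]
    · have hp1 : hol (Function.update c' (eta D p) t) D p = 1 := by
        rw [hol_split]
        have : coc (Function.update c' (eta D p) t) (D.W (sig D p).2 (D.nL - 1)) (sig D p).1 = R := by
          rw [hR]
          apply pth_congr
          intro j hj
          rw [Function.update_of_ne (hjne j hj)]
        rw [this, coc_ell]
        change R * (if (D.y p.2).2 = true then Function.update c' (eta D p) t (eta D p)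
          else (Function.update c' (eta D p) t (eta D p))⁻¹) = 1
        rw [Function.update_self, ht]
        split_ifs <;> simp
      intro q hq
      by_cases hqO : q ∈ O
      · obtain ⟨j, rfl⟩ := hON q hqO
        exact hol_pow_one _ D (hx p hp) hp1 j
      · rw [hol_congr D _ c' hs' _ (⟨hq, hqO⟩ : q ∈ N')]
        · exact hc2 q ⟨hq, hqO⟩
        · intro e he
          rw [Function.update_of_ne]
          rintro rfl
          exact heN' he
  · intro M _ c c' hc hc' hag
    have hε : ∀ e ∈ ε, c e = c' e := by
      apply h4 M c c' (fun q hq => hc q hq.1) (fun q hq => hc' q hq.1)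
      intro e he hne
      apply hag e (Set.image_mono hN'N he)
      rintro (rfl | h)
      · exact heN' he
      · exact hne h
    rintro e (rfl | he)
    · have e1 := hc p hp
      have e2 := hc' p hp
      rw [hol_split] at e1 e2
      have e3 : coc c (D.W (sig D p).2 (D.nL - 1)) (sig D p).1 =
          coc c' (D.W (sig D p).2 (D.nL - 1)) (sig D p).1 := by
        apply pth_congr
        intro j hj
        by_cases h : eta D ((sig D ^ j) (sig D p)) ∈ ε
        · exact hε _ h
        · apply hag _ ⟨_, sig_pow_mem hs j (hs p hp), rfl⟩
          rintro (h' | h')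
          · exact hjne j hj h'
          · exact h h'
      rw [e3, ← e2] at e1
      have e4 := mul_left_cancel e1
      rw [coc_ell, coc_ell] at e4
      change (if (D.y p.2).2 = true then c (eta D p) else (c (eta D p))⁻¹) =
        (if (D.y p.2).2 = true then c' (eta D p) else (c' (eta D p))⁻¹) at e4
      split_ifs at e4
      · exact e4
      · exact inv_injective e4
    · exact hε e he

end Cocycles

end ORT


set_option linter.all false

namespace ORT

noncomputable section Order

variable {α : Type}

lemma exists_hom {r : FreeGroup α} (hr : r ≠ 1)
    (hpow : ¬ ∃ (s : FreeGroup α) (k : ℕ), 2 ≤ k ∧ r = s ^ k)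
    (K : Subgroup (FreeGroup α)) (hrK : r ∈ K) (hK : ¬ K ≤ Subgroup.zpowers r) :
    ∃ φ : K →* Multiplicative ℤ, φ ⟨r, hrK⟩ = 1 ∧ ∃ z, φ z ≠ 1 := by
  classical
  haveI : IsFreeGroup K := subgroupIsFreeOfIsFree K
  let b := IsFreeGroup.basis K
  let E := fun x : IsFreeGroup.Generators K => b.lift (fun y => if y = x then Multiplicative.ofAdd (1:ℤ) else 1)
  have hE : ∀ x y, E x (b y) = if y = x then Multiplicative.ofAdd (1:ℤ) else 1 := by
    intro x y; simp [E]
  by_cases hs : ∃ x y : IsFreeGroup.Generators K, x ≠ y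
  · obtain ⟨x, y, hxy⟩ := hs
    by_cases h0 : E x ⟨r, hrK⟩ = 1
    · exact ⟨E x, h0, b x, by rw [hE]; simp⟩
    · set A := Multiplicative.toAdd (E x ⟨r, hrK⟩) with hA
      set B := Multiplicative.toAdd (E y ⟨r, hrK⟩) with hB
      refine ⟨(E x) ^ B * (E y) ^ (-A), ?_, b y, ?_⟩
      · simp only [MonoidHom.mul_apply, MonoidHom.zpow_apply]
        apply Multiplicative.toAdd.injective
        simp only [toAdd_mul, toAdd_zpow, toAdd_one, smul_eq_mul, ← hA, ← hB]
        ring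
      · simp only [MonoidHom.mul_apply, MonoidHom.zpow_apply, hE]
        rw [if_neg hxy.symm, if_pos trivial]
        intro h
        have h' := congrArg Multiplicative.toAdd h
        simp only [toAdd_mul, toAdd_zpow, toAdd_one, smul_eq_mul, toAdd_ofAdd, one_zpow] at h'
        apply h0
        apply Multiplicative.toAdd.injective
        rw [← hA]; simp at h' ⊢; exact h'
  · exfalso
    push Not at hs
    apply hK
    -- K is cyclic
    have hcyc : ∃ k : K, ∀ g : K, g ∈ Subgroup.zpowers k := by
      rcases isEmpty_or_nonempty (IsFreeGroup.Generators K) with he | ⟨⟨x⟩⟩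
      · refine ⟨1, fun g => ?_⟩
        have : Subsingleton K := (b.repr.toEquiv).subsingleton
        rw [Subsingleton.elim g 1]; exact one_mem _
      · refine ⟨b x, fun g => ?_⟩
        have : ∀ w : FreeGroup (IsFreeGroup.Generators K), b.repr.symm w ∈ Subgroup.zpowers (b x) := by
          intro w
          induction w using FreeGroup.induction_on with
          | C1 => rw [map_one]; exact one_mem _
          | of a => rw [hs a x]; exact Subgroup.mem_zpowers _
          | inv_of a h => rw [map_inv]; exact inv_mem h
          | mul u v hu hv => rw [map_mul]; exact mul_mem hu hv
        simpa using this (b.repr g)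
    obtain ⟨k, hk⟩ := hcyc
    obtain ⟨j, hj⟩ := Subgroup.mem_zpowers_iff.1 (hk ⟨r, hrK⟩)
    have hj' : (k : FreeGroup α) ^ j = r := by simpa using congrArg Subtype.val hj
    have hkr : (k : FreeGroup α) ∈ Subgroup.zpowers r := by
      have h0 : j ≠ 0 := by rintro rfl; simp at hj'; exact hr hj'.symm
      have h1 : j.natAbs < 2 := by
        by_contra hge
        push Not at hge
        apply hpow
        rcases Int.natAbs_eq j with h | h
        · refine ⟨k, j.natAbs, hge, ?_⟩
          rw [← zpow_natCast, ← h, hj']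
        · refine ⟨(k:FreeGroup α)⁻¹, j.natAbs, hge, ?_⟩
          rw [← zpow_natCast, inv_zpow', ← h, hj']
      have h2 : j = 1 ∨ j = -1 := by omega
      rcases h2 with rfl | rfl
      · simp at hj'; rw [hj']; exact Subgroup.mem_zpowers _
      · rw [← hj']; simp
    intro g hg
    obtain ⟨i, hi⟩ := Subgroup.mem_zpowers_iff.1 (hk ⟨g, hg⟩)
    have hi' : (k : FreeGroup α) ^ i = g := by simpa using congrArg Subtype.val hi
    rw [← hi']
    exact Subgroup.zpow_mem _ hkr _

lemma exists_cone {r : FreeGroup α} (hr : r ≠ 1)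
    (hpow : ¬ ∃ (s : FreeGroup α) (k : ℕ), 2 ≤ k ∧ r = s ^ k) (n : ℕ) :
    ∀ (Z : Finset (FreeGroup α)), Z.card ≤ n → (∀ z ∈ Z, z ∉ Subgroup.zpowers r) →
    ∃ P : Set (FreeGroup α), (∀ a ∈ P, ∀ b ∈ P, a * b ∈ P) ∧
      (∀ c ∈ Subgroup.zpowers r, ∀ a, (a ∈ P → c * a ∈ P) ∧ (a ∈ P → a * c ∈ P)) ∧
      (∀ c ∈ Subgroup.zpowers r, c ∉ P) ∧ ∀ z ∈ Z, z ∈ P ∨ z⁻¹ ∈ P := by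
  classical
  induction n with
  | zero =>
    intro Z hZ _
    refine ⟨∅, by simp, by simp, by simp, ?_⟩
    simp at hZ; simp [hZ]
  | succ n ih =>
    intro Z hZ hZC
    by_cases hne : Z = ∅
    · exact ⟨∅, by simp, by simp, by simp, by simp [hne]⟩
    obtain ⟨z0, hz0⟩ := Finset.nonempty_of_ne_empty hne
    set K := Subgroup.closure (insert r (Z : Set (FreeGroup α))) with hK
    have hrK : r ∈ K := Subgroup.subset_closure (Set.mem_insert _ _)
    have hZK : ∀ z ∈ Z, z ∈ K := fun z hz => Subgroup.subset_closure (Set.mem_insert_of_mem _ hz)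
    obtain ⟨φ, hφr, w, hw⟩ := exists_hom hr hpow K hrK (fun h => hZC z0 hz0 (h (hZK _ hz0)))
    have hφC : ∀ c ∈ Subgroup.zpowers r, ∃ h : c ∈ K, φ ⟨c, h⟩ = 1 := by
      rintro c ⟨i, rfl⟩
      refine ⟨Subgroup.zpow_mem _ hrK i, ?_⟩
      have : (⟨r ^ i, Subgroup.zpow_mem _ hrK i⟩ : K) = ⟨r, hrK⟩ ^ i := rfl
      change φ ⟨r ^ i, _⟩ = 1
      rw [this, map_zpow, hφr, one_zpow]
    let Z' := Z.filter (fun z => ∃ h : z ∈ K, φ ⟨z, h⟩ = 1)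
    have hlt : Z'.card < Z.card := by
      apply Finset.card_lt_card
      refine ⟨Finset.filter_subset _ _, fun hsub => hw ?_⟩
      have : ∀ g (hg : g ∈ K), φ ⟨g, hg⟩ = 1 := by
        intro g hg
        induction hg using Subgroup.closure_induction with
        | mem x hx =>
          rcases hx with rfl | hx
          · exact hφr
          · obtain ⟨h, h'⟩ := (Finset.mem_filter.1 (hsub hx)).2
            exact h'
        | one => exact map_one φ
        | mul x y hx hy h1 h2 =>
          have : (⟨x * y, mul_mem hx hy⟩ : K) = ⟨x, hx⟩ * ⟨y, hy⟩ := rfl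
          rw [this, map_mul, h1, h2, one_mul]
        | inv x hx h1 =>
          have : (⟨x⁻¹, inv_mem hx⟩ : K) = ⟨x, hx⟩⁻¹ := rfl
          rw [this, map_inv, h1, inv_one]
      exact this w.1 w.2
    obtain ⟨P', h1, h2, h3, h4⟩ := ih Z' (by omega) (fun z hz => hZC z (Finset.mem_filter.1 hz).1)
    let Φ : FreeGroup α → ℤ := fun g => if h : g ∈ K then Multiplicative.toAdd (φ ⟨g, h⟩) else 0
    have hΦm : ∀ a ∈ K, ∀ b ∈ K, Φ (a * b) = Φ a + Φ b := by
      intro a ha b hb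
      simp only [Φ, dif_pos ha, dif_pos hb, dif_pos (mul_mem ha hb)]
      rw [← toAdd_mul, ← map_mul]; rfl
    have hΦC : ∀ c ∈ Subgroup.zpowers r, c ∈ K ∧ Φ c = 0 := by
      intro c hc
      obtain ⟨h, h'⟩ := hφC c hc
      exact ⟨h, by simp [Φ, dif_pos h, h']⟩
    refine ⟨{g | g ∈ K ∧ (0 < Φ g ∨ (Φ g = 0 ∧ g ∈ P'))}, ?_, ?_, ?_, ?_⟩
    · rintro a ⟨ha, ha'⟩ b ⟨hb, hb'⟩
      refine ⟨mul_mem ha hb, ?_⟩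
      rw [hΦm a ha b hb]
      rcases ha' with ha' | ⟨ha', ha2⟩ <;> rcases hb' with hb' | ⟨hb', hb2⟩
      · left; omega
      · left; omega
      · left; omega
      · right; exact ⟨by omega, h1 a ha2 b hb2⟩
    · intro c hc a
      obtain ⟨hcK, hc0⟩ := hΦC c hc
      constructor
      · rintro ⟨ha, ha'⟩
        refine ⟨mul_mem hcK ha, ?_⟩
        rw [hΦm c hcK a ha, hc0, zero_add]
        exact ha'.imp id fun h => ⟨h.1, (h2 c hc a).1 h.2⟩
      · rintro ⟨ha, ha'⟩
        refine ⟨mul_mem ha hcK, ?_⟩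
        rw [hΦm a ha c hcK, hc0, add_zero]
        exact ha'.imp id fun h => ⟨h.1, (h2 c hc a).2 h.2⟩
    · rintro c hc ⟨hcK, h⟩
      rw [(hΦC c hc).2] at h
      rcases h with h | h
      · exact lt_irrefl _ h
      · exact h3 c hc h.2
    · intro z hz
      have hzK := hZK z hz
      have hinv : Φ z⁻¹ = - Φ z := by
        have := hΦm z hzK z⁻¹ (inv_mem hzK)
        rw [mul_inv_cancel, (hΦC 1 (one_mem _)).2] at this
        omega
      rcases lt_trichotomy (Φ z) 0 with h | h | h
      · right; exact ⟨inv_mem hzK, Or.inl (by omega)⟩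
      · have : z ∈ Z' := by
          refine Finset.mem_filter.2 ⟨hz, hzK, ?_⟩
          simpa [Φ, dif_pos hzK] using h
        rcases h4 z this with h' | h'
        · left; exact ⟨hzK, Or.inr ⟨h, h'⟩⟩
        · right; exact ⟨inv_mem hzK, Or.inr ⟨by omega, h'⟩⟩
      · left; exact ⟨hzK, Or.inl h⟩

/-- initial words of a sequence of letters -/
def sl {β : Type} (y : ℕ → β × Bool) : ℕ → List (β × Bool)
  | 0 => []
  | k + 1 => y k :: sl y k

lemma sl_length {β : Type} (y : ℕ → β × Bool) (k : ℕ) : (sl y k).length = k := by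
  induction k with
  | zero => rfl
  | succ k ih => simp [sl, ih]

lemma sl_red {β : Type} (y : ℕ → β × Bool) (k : ℕ) (h : ∀ j, j + 1 < k → y (j + 1) ≠ invL (y j)) :
    FreeGroup.IsReduced (sl y k) := by
  induction k with
  | zero => exact FreeGroup.IsReduced.nil
  | succ k ih =>
    cases k with
    | zero => exact FreeGroup.IsReduced.singleton
    | succ k =>
      refine FreeGroup.isReduced_cons_cons.2 ⟨?_, ih fun j hj => h j (by omega)⟩
      intro h1
      by_contra h2
      apply h k (by omega)
      refine Prod.ext h1 ?_
      simp only [invL]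
      revert h2
      cases (y (k+1)).2 <;> cases (y k).2 <;> simp

lemma sl_norm {β : Type} [DecidableEq β] (y : ℕ → β × Bool) (k : ℕ)
    (h : ∀ j, j + 1 < k → y (j + 1) ≠ invL (y j)) :
    FreeGroup.norm (FreeGroup.mk (sl y k)) = k := by
  rw [FreeGroup.norm, FreeGroup.toWord_mk, (sl_red y k h).reduce_eq, sl_length]

lemma W_sl (D : Dat α) (i : ZMod D.L) (k : ℕ) :
    D.W i k = FreeGroup.mk (sl (fun j => D.y (i + j)) k) := by
  induction k with
  | zero => rfl
  | succ k ih => rw [W_succ, sl, ell_mk, ih]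

lemma exists_dat [DecidableEq α] {r : FreeGroup α} (hr : r ≠ 1)
    (hcyc : ∀ x : α × Bool, r.toWord.head? = some x → r.toWord.getLast? ≠ some (x.1, !x.2))
    (hpow : ¬ ∃ (s : FreeGroup α) (k : ℕ), 2 ≤ k ∧ r = s ^ k) (n : ℕ) (hn : 2 ≤ n) :
    ∃ D : Dat α, D.n = n ∧ D.W 0 D.L = r := by
  classical
  obtain ⟨w, hw⟩ : ∃ w, w = r.toWord := ⟨_, rfl⟩
  rw [← hw] at hcyc
  obtain ⟨L, hL⟩ : ∃ L, L = w.length := ⟨_, rfl⟩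
  have hL0 : 0 < L := by
    rw [hL, List.length_pos_iff]
    rw [hw]
    simpa using hr
  haveI : NeZero L := ⟨hL0.ne'⟩
  have hwr : FreeGroup.IsReduced w := by rw [hw]; exact FreeGroup.isReduced_toWord
  have hvl : ∀ i : ZMod L, i.val < L := fun i => ZMod.val_lt i
  let y : ZMod L → α × Bool := fun i => w[L - 1 - i.val]'(by omega)
  have hval : ∀ i : ZMod L, i.val + 1 < L → (i + 1).val = i.val + 1 := by
    intro i hi
    rw [ZMod.val_add, ZMod.val_one_eq_one_mod, Nat.add_mod_mod, Nat.mod_eq_of_lt hi]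
  have hval0 : ∀ i : ZMod L, i.val + 1 = L → i + 1 = 0 := by
    intro i hi
    have : ((i.val + 1 : ℕ) : ZMod L) = 0 := by rw [hi]; simp
    simpa using this
  have hred : ∀ i, y (i + 1) ≠ invL (y i) := by
    intro i
    rcases Nat.lt_or_ge (i.val + 1) L with h | h
    · have h1 := List.isChain_iff_getElem.1 hwr (L - 2 - i.val) (by omega)
      have e : ∀ (j k : ℕ) (hj : j < w.length) (hk : k < w.length), j = k → w[j] = w[k] := by
        intro j k hj hk h; subst h; rfl
      have e1 : y (i + 1) = w[L - 2 - i.val]'(by omega) :=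
        e _ _ _ _ (by rw [hval i h]; omega)
      have e2 : y i = w[L - 2 - i.val + 1]'(by omega) :=
        e _ _ _ _ (by omega)
      rw [← e1, ← e2] at h1
      intro h2
      rw [h2] at h1
      simp [invL] at h1
    · have hi : i.val + 1 = L := by have := hvl i; omega
      have hy : y i = w[0] := by
        simp only [y]; congr 1; omega
      rw [hval0 i hi, hy]
      intro h
      refine hcyc w[0] ?_ ?_
      · rw [List.head?_eq_getElem?]; simp
      · rw [List.getLast?_eq_getElem?]
        rw [List.getElem?_eq_getElem (by omega)]
        simp only [y, ZMod.val_zero, invL] at h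
        rw [← h]; congr 2; omega
  let Y : ℕ → α × Bool := fun k => y k
  let U : ℕ → FreeGroup α := fun k => FreeGroup.mk (sl Y k)
  have hUs : ∀ k, U (k + 1) = ell (Y k) * U k := by
    intro k; simp only [U, sl]; rw [ell_mk]
  have hnorm : ∀ k, FreeGroup.norm (U k) = k := by
    intro k
    apply sl_norm
    intro j _
    have := hred j
    simpa [Y] using this
  have hUL : U L = r := by
    have : ∀ k ≤ L, sl Y k = w.drop (L - k) := by
      intro k hk
      induction k with
      | zero => simp [sl, hL]
      | succ k ih =>
        rw [sl, ih (by omega), List.drop_eq_getElem_cons (i := L - (k + 1)) (by omega)]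
        have h1 : (k : ZMod L).val = k := ZMod.val_cast_of_lt (by omega)
        congr 1
        · simp only [Y, y]; congr 1; rw [h1]; omega
        · congr 1; omega
    have h2 := this L le_rfl
    simp only [U]
    rw [h2, Nat.sub_self, List.drop_zero, hw, FreeGroup.mk_toWord]
  have hper : ∀ k, U (k + L) = U k * r := by
    intro k
    induction k with
    | zero => simp [hUL, U, sl, ← FreeGroup.one_eq_mk]
    | succ k ih =>
      rw [show k + 1 + L = (k + L) + 1 by ring, hUs, ih, hUs, mul_assoc]
      simp [Y]
  have hperk : ∀ k s, U (k + s * L) = U k * r ^ s := by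
    intro k s
    induction s with
    | zero => simp
    | succ s ih => rw [show k + (s + 1) * L = (k + s * L) + L by ring, hper, ih, pow_succ, mul_assoc]
  let u : ZMod L → FreeGroup α := fun i => U i.val
  have hdist : ∀ i j, i ≠ j → (u i)⁻¹ * u j ∉ Subgroup.zpowers r := by
    have key : ∀ i j : ZMod L, ∀ s : ℕ, u j = u i * r ^ s → i = j := by
      intro i j s h
      simp only [u] at h
      rw [← hperk] at h
      have h' := congrArg FreeGroup.norm h
      rw [hnorm, hnorm] at h'
      rcases Nat.eq_zero_or_pos s with rfl | hs
      · apply ZMod.val_injective L; omega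
      · have := hvl j
        have : L ≤ s * L := Nat.le_mul_of_pos_left L hs
        omega
    rintro i j hij hm
    obtain ⟨z, hz⟩ := Subgroup.mem_zpowers_iff.1 hm
    rcases Int.eq_nat_or_neg z with ⟨s, rfl | rfl⟩
    · apply hij; apply key i j s
      rw [← zpow_natCast, hz]; group
    · apply hij; symm; apply key j i s
      rw [← zpow_natCast]
      have : r ^ (s : ℤ) = ((u i)⁻¹ * u j)⁻¹ := by rw [← hz]; simp
      rw [this]; group
  let Z : Finset (FreeGroup α) := ((Finset.univ : Finset (ZMod L × ZMod L)).filter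
    (fun p => p.1 ≠ p.2)).image (fun p => (u p.1)⁻¹ * u p.2)
  obtain ⟨P, P1, P2, P3, P4⟩ := exists_cone hr hpow _ Z le_rfl (by
    intro z hz
    obtain ⟨p, hp, rfl⟩ := Finset.mem_image.1 hz
    exact hdist _ _ (Finset.mem_filter.1 hp).2)
  let lt : ZMod L → ZMod L → Prop := fun i j => (u i)⁻¹ * u j ∈ P
  have lt_irr : ∀ i, ¬ lt i i := by
    intro i h
    simp only [lt, inv_mul_cancel] at h
    exact P3 1 (one_mem _) h
  have lt_tr : ∀ i j k, lt i j → lt j k → lt i k := by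
    intro i j k h1 h2
    have := P1 _ h1 _ h2
    simp only [lt]
    convert this using 1
    group
  have lt_tot : ∀ i j, i ≠ j → lt i j ∨ lt j i := by
    intro i j hij
    have := P4 ((u i)⁻¹ * u j) (Finset.mem_image.2 ⟨(i, j), by simp [hij], rfl⟩)
    rcases this with h | h
    · exact Or.inl h
    · right; simp only [lt]; convert h using 1; group
  let rk : ZMod L → ℕ := fun i => (Finset.univ.filter (fun k => lt k i)).card
  have rk_lt : ∀ i j, lt i j → rk i < rk j := by
    intro i j h
    apply Finset.card_lt_card
    refine ⟨fun k hk => ?_, fun hsub => ?_⟩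
    · simp only [Finset.mem_filter, Finset.mem_univ, true_and] at hk ⊢
      exact lt_tr _ _ _ hk h
    · have := hsub (show i ∈ Finset.univ.filter (fun k => lt k j) by simpa using h)
      simp only [Finset.mem_filter, Finset.mem_univ, true_and] at this
      exact lt_irr _ this
  have rk_iff : ∀ i j, rk i < rk j ↔ lt i j := by
    intro i j
    refine ⟨fun h => ?_, rk_lt i j⟩
    by_contra hn
    by_cases hij : i = j
    · subst hij; exact lt_irrefl _ h
    · rcases lt_tot i j hij with h' | h'
      · exact hn h'
      · have := rk_lt _ _ h'; omega
  have hustep : ∀ i, ∃ c ∈ Subgroup.zpowers r, ell (y i) * u i = u (i + 1) * c := by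
    intro i
    have hY : Y i.val = y i := by simp [Y]
    rcases Nat.lt_or_ge (i.val + 1) L with h | h
    · refine ⟨1, one_mem _, ?_⟩
      simp only [u]
      rw [hval i h, hUs, hY, mul_one]
    · have hi : i.val + 1 = L := by have := hvl i; omega
      refine ⟨r, Subgroup.mem_zpowers _, ?_⟩
      simp only [u]
      rw [hval0 i hi, ← hY, ← hUs, hi, hUL, ZMod.val_zero]
      simp [U, sl, ← FreeGroup.one_eq_mk]
  have hPC : ∀ c ∈ Subgroup.zpowers r, ∀ d ∈ Subgroup.zpowers r, ∀ a, c * a * d ∈ P ↔ a ∈ P := by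
    intro c hc d hd a
    constructor
    · intro h
      have := (P2 d⁻¹ (inv_mem hd) _).2 ((P2 c⁻¹ (inv_mem hc) _).1 h)
      convert this using 1; group
    · intro h
      exact (P2 d hd _).2 ((P2 c hc _).1 h)
  refine ⟨⟨L, inferInstance, y, hred, n, hn, rk, ?_, ?_, ?_⟩, rfl, ?_⟩
  · intro i j h
    by_contra hij
    rcases lt_tot i j hij with h' | h'
    · have := rk_lt _ _ h'; omega
    · have := rk_lt _ _ h'; omega
  · intro i j hij
    rw [rk_iff, rk_iff]
    obtain ⟨c, hc, ec⟩ := hustep i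
    obtain ⟨d, hd, ed⟩ := hustep j
    have e : (u i)⁻¹ * u j = c⁻¹ * ((u (i + 1))⁻¹ * u (j + 1)) * d := by
      rw [show u j = (ell (y j))⁻¹ * (u (j + 1) * d) by rw [← ed]; group,
        show u i = (ell (y i))⁻¹ * (u (i + 1) * c) by rw [← ec]; group, hij]
      group
    simp only [lt]
    rw [e, hPC _ (inv_mem hc) _ hd]
  · intro i j hij
    rw [rk_iff, rk_iff]
    obtain ⟨c, hc, ec⟩ := hustep i
    obtain ⟨d, hd, ed⟩ := hustep j
    have hl : ell (y i) = (ell (y j))⁻¹ := by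
      rw [hij]
      rcases y j with ⟨a, b⟩
      cases b <;> simp [ell, invL]
    have e : (u i)⁻¹ * u (j + 1) = c⁻¹ * ((u (i + 1))⁻¹ * u j) * d⁻¹ := by
      rw [show u (j + 1) = ell (y j) * u j * d⁻¹ by rw [ed]; group,
        show u i = (ell (y i))⁻¹ * (u (i + 1) * c) by rw [← ec]; group, hl]
      group
    simp only [lt]
    rw [e, hPC _ (inv_mem hc) _ (inv_mem hd)]
  · rw [W_sl]
    simp only [zero_add]
    exact hUL

end Order

end ORT


set_option linter.all false

namespace ORT

noncomputable section Fin

variable {α : Type} {V V' : Type} [MulAction (FreeGroup α) V] [MulAction (FreeGroup α) V']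
variable {M : Type} [Group M] {D : Dat α}

/-- equivariance -/
def Eqv (f : V → V') : Prop := ∀ (g : FreeGroup α) x, f (g • x) = g • f x

variable (D) in
/-- induced map on points -/
def pm (f : V → V') (p : V × ZMod D.L) : V' × ZMod D.L := (f p.1, p.2)

/-- induced map on edges -/
def em (f : V → V') (e : V × α) : V' × α := (f e.1, e.2)

section
variable {f : V → V'}

lemma edge_em (hf : Eqv (α := α) f) (l : α × Bool) (x : V) : edge l (f x) = em f (edge l x) := by
  rcases l with ⟨a, b⟩
  cases b <;> simp [edge, em]
  exact (hf _ _).symm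

lemma sig_pm (hf : Eqv (α := α) f) (p : V × ZMod D.L) : sig D (pm D f p) = pm D f (sig D p) := by
  simp [sig_apply, pm, hf _ _]

lemma sig_pow_pm (hf : Eqv (α := α) f) (k : ℕ) (p : V × ZMod D.L) : (sig D ^ k) (pm D f p) = pm D f ((sig D ^ k) p) := by
  simp [sig_pow, pm, hf _ _]

lemma eta_pm (hf : Eqv (α := α) f) (p : V × ZMod D.L) : eta D (pm D f p) = em f (eta D p) := by
  simp only [eta, pm]; exact edge_em hf _ _

lemma Fixd_pm (hf : Eqv (α := α) f) {p : V × ZMod D.L} (hp : p ∈ Fixd D V) : pm D f p ∈ Fixd D V' := by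
  change (sig D ^ D.nL) _ = _
  rw [sig_pow_pm hf, show (sig D ^ D.nL) p = p from hp]

lemma Irr.image (hf : Eqv (α := α) f) {N : Set (V × ZMod D.L)} (hN : Irr D N) : Irr D (pm D f '' N) where
  sg := by rintro _ ⟨p, hp, rfl⟩; exact ⟨_, hN.sg p hp, (sig_pm hf p).symm⟩
  fx := by rintro _ ⟨p, hp, rfl⟩; exact Fixd_pm hf (hN.fx p hp)
  ir := by
    rintro _ ⟨p, hp, rfl⟩
    obtain ⟨q, hq, hne, he⟩ := hN.ir p hp
    refine ⟨_, ⟨q, hq, rfl⟩, ?_, by rw [eta_pm hf, eta_pm hf, he]⟩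
    intro h
    apply hne
    have h2 : q.2 = p.2 := (Prod.ext_iff.1 h).2
    exact Prod.ext (eta_same D he (by rw [h2])) h2

lemma coc_em (hf : Eqv (α := α) f) (c : V' × α → M) (g : FreeGroup α) (x : V) :
    coc (fun e => c (em f e)) g x = coc c g (f x) := coc_pull f hf c g x

lemma hol_em (hf : Eqv (α := α) f) (c : V' × α → M) (p : V × ZMod D.L) :
    hol (fun e => c (em f e)) D p = hol c D (pm D f p) := coc_em hf c _ _

end

lemma eta_snd_inj {p q : V × ZMod D.L} (h : eta D p = eta D q) (h2 : p.2 = q.2) : p = q :=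
  Prod.ext (eta_same D h (by rw [h2])) h2

lemma finite_eta {T : Set (V × α)} (hT : T.Finite) : {p : V × ZMod D.L | eta D p ∈ T}.Finite := by
  have : Set.Finite (T ×ˢ (Set.univ : Set (ZMod D.L))) := hT.prod Set.finite_univ
  refine Set.Finite.of_injOn (f := fun p : V × ZMod D.L => (eta D p, p.2)) ?_ ?_ this
  · intro p hp; exact ⟨hp, trivial⟩
  · intro p _ q _ h
    exact eta_snd_inj (Prod.ext_iff.1 h).1 (Prod.ext_iff.1 h).2

/-- edges traversed by a word -/
def eo (x : V) : List (α × Bool) → List (V × α)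
  | [] => []
  | l :: w => edge l (FreeGroup.mk w • x) :: eo x w

lemma mem_eo (x : V) (w1 : List (α × Bool)) (l) (w2) :
    edge l (FreeGroup.mk w2 • x) ∈ eo x (w1 ++ l :: w2) := by
  induction w1 with
  | nil => simp [eo]
  | cons a w ih => simp [eo, ih]

/-- cocycles trivial on all generators of a stabilizer are trivial on it -/
lemma coc_closure (c : V × α → M) (x : V) (S : Set (FreeGroup α)) (hS : ∀ g ∈ S, g • x = x)
    (h1 : ∀ g ∈ S, coc c g x = 1) : ∀ g ∈ Subgroup.closure S, g • x = x ∧ coc c g x = 1 := by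
  intro g hg
  induction hg using Subgroup.closure_induction with
  | mem g hg => exact ⟨hS g hg, h1 g hg⟩
  | one => simp
  | mul a b _ _ ha hb => rw [mul_smul, coc_mul, hb.1, ha.1, ha.2, hb.2]; simp
  | inv a _ ha =>
    have : a⁻¹ • x = x := by rw [inv_smul_eq_iff, ha.1]
    rw [coc_inv, this, ha.2]; simp

lemma coc_conj (c : V × α → M) (x : V) (hst : ∀ g : FreeGroup α, g • x = x → coc c g x = 1)
    (g h : FreeGroup α) (hh : h • g • x = g • x) : coc c h (g • x) = 1 := by
  have h0 : (g⁻¹ * h * g) • x = x := by rw [mul_smul, mul_smul, hh]; simp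
  have := hst _ h0
  rw [coc_mul, coc_mul, hh, coc_inv, inv_smul_smul] at this
  have h2 := congrArg (fun t => coc c g x * t * (coc c g x)⁻¹) this
  simpa [mul_assoc] using h2

/-- base vertex -/
abbrev bs (K : Subgroup (FreeGroup α)) : FreeGroup α ⧸ K := ((1 : FreeGroup α) : FreeGroup α ⧸ K)

lemma smul_bs (K : Subgroup (FreeGroup α)) (g : FreeGroup α) : g • bs K = (g : FreeGroup α ⧸ K) := by
  change ((g • (1 : FreeGroup α) : FreeGroup α) : FreeGroup α ⧸ K) = _
  rw [smul_eq_mul, mul_one]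

lemma smul_bs_eq {K : Subgroup (FreeGroup α)} {g : FreeGroup α} : g • bs K = bs K ↔ g ∈ K := by
  rw [smul_bs, QuotientGroup.eq]; simp

lemma exists_smul_bs {K : Subgroup (FreeGroup α)} (x : FreeGroup α ⧸ K) :
    ∃ g : FreeGroup α, g • bs K = x := by
  obtain ⟨g, rfl⟩ := QuotientGroup.mk_surjective x
  exact ⟨g, smul_bs K g⟩

lemma sgn_ell (e : V × α) (b : Bool) (T : V × α → FreeGroup (V × α)) (h : T e = FreeGroup.of e) :
    (if b then T e else (T e)⁻¹) = ell (e, b) := by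
  rw [h, ell]

theorem Fixd_finite {K : Subgroup (FreeGroup α)} (hK : K.FG) : (Fixd D (FreeGroup α ⧸ K)).Finite := by
  classical
  obtain ⟨S, hS⟩ := hK
  let T0 : Set ((FreeGroup α ⧸ K) × α) := ⋃ g ∈ S, {e | e ∈ eo (bs K) g.toWord}
  have hT0 : T0.Finite := by
    apply Set.Finite.biUnion S.finite_toSet
    intro g _
    exact List.finite_toSet _
  let c : (FreeGroup α ⧸ K) × α → FreeGroup ((FreeGroup α ⧸ K) × α) :=
    fun e => if e ∈ T0 then 1 else FreeGroup.of e
  have hst : ∀ g : FreeGroup α, g • bs K = bs K → coc c g (bs K) = 1 := by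
    intro g hg
    have hg' : g ∈ Subgroup.closure (S : Set (FreeGroup α)) := by
      rw [hS]; exact smul_bs_eq.1 hg
    suffices hh : ∀ g ∈ (S : Set (FreeGroup α)), coc c g (bs K) = 1 by
      exact (coc_closure c (bs K) (S : Set (FreeGroup α))
        (fun g hg => smul_bs_eq.2 (hS.le (Subgroup.subset_closure hg))) hh g hg').2
    · intro g hg
      have e0 := coc_trivial (V := FreeGroup α ⧸ K) (M := FreeGroup ((FreeGroup α ⧸ K) × α))
        (FreeGroup.mk g.toWord) (bs K)
      have e1 := coc_mk_congr c (fun _ => 1) (bs K) g.toWord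
      rw [e0, FreeGroup.mk_toWord] at e1
      apply e1
      intro w1 l w2 hw
      have : edge l (FreeGroup.mk w2 • bs K) ∈ T0 := by
        refine Set.mem_biUnion hg ?_
        change _ ∈ eo _ _
        rw [hw]; exact mem_eo _ _ _ _
      simp only [c, if_pos this]
  have key : ∀ p ∈ Fixd D (FreeGroup α ⧸ K), ∃ j < D.nL, eta D ((sig D ^ j) p) ∈ T0 := by
    intro p hp
    by_contra hno
    push Not at hno
    let Y : ℕ → ((FreeGroup α ⧸ K) × α) × Bool := fun j => (eta D ((sig D ^ j) p), (D.y (p.2 + j)).2)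
    have h1 : ∀ k ≤ D.nL, coc c (D.W p.2 k) p.1 = FreeGroup.mk (sl Y k) := by
      intro k hk
      induction k with
      | zero => simp [W_zero, sl, ← FreeGroup.one_eq_mk]
      | succ k ih =>
        rw [W_succ, coc_mul, ih (by omega), sl, ell_mk, coc_ell]
        congr 1
        have h2 := hno k (by omega)
        have e : edge (D.y (p.2 + k)) (D.W p.2 k • p.1) = eta D ((sig D ^ k) p) := by
          rw [sig_pow]; rfl
        rw [e]
        exact sgn_ell _ _ c (by simp only [c, if_neg h2])
    have h2 := h1 _ le_rfl
    have h3 : coc c (D.W p.2 D.nL) p.1 = 1 := by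
      obtain ⟨g, hg⟩ := exists_smul_bs p.1
      have hp' := (mem_Fixd D p).1 hp
      rw [← hg] at hp' ⊢
      exact coc_conj c _ hst g _ hp'
    rw [h3] at h2
    have h4 := sl_norm Y D.nL (by
      intro j _ h
      have e1 : eta D ((sig D ^ (j+1)) p) = eta D ((sig D ^ j) p) := congrArg Prod.fst h
      have e2 := congrArg Prod.snd h
      simp only [Y, invL] at e2
      have e3 : (D.y (p.2 + j + 1)).1 = (D.y (p.2 + j)).1 := by
        have := congrArg Prod.snd e1
        simpa [sig_pow, eta, edge, add_assoc] using this
      apply D.red (p.2 + j)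
      refine Prod.ext e3 ?_
      rw [invL, ← e2]; push_cast; rw [add_assoc])
    rw [← h2, FreeGroup.norm_one] at h4
    exact (nL_pos D).ne h4
  have hsub : Fixd D (FreeGroup α ⧸ K) ⊆ ⋃ j ∈ Finset.range D.nL,
      (fun p => (sig D ^ j) p) ⁻¹' {p | eta D p ∈ T0} := by
    intro p hp
    obtain ⟨j, hj, h⟩ := key p hp
    exact Set.mem_biUnion (Finset.mem_coe.2 (Finset.mem_range.2 hj)) h
  refine Set.Finite.subset ?_ hsub
  apply Set.Finite.biUnion (Finset.finite_toSet _)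
  intro j _
  exact (finite_eta hT0).preimage (sig D ^ j).injective.injOn

/-- projection between coset spaces -/
def qm {K K' : Subgroup (FreeGroup α)} (h : K ≤ K') : FreeGroup α ⧸ K → FreeGroup α ⧸ K' :=
  Subgroup.quotientMapOfLE h

lemma qm_eqv {K K' : Subgroup (FreeGroup α)} (h : K ≤ K') : Eqv (α := α) (qm h) := by
  intro g x
  obtain ⟨k, rfl⟩ := QuotientGroup.mk_surjective x
  rfl

lemma qm_bs {K K' : Subgroup (FreeGroup α)} (h : K ≤ K') : qm h (bs K) = bs K' := rfl

lemma qm_qm {K K' K'' : Subgroup (FreeGroup α)} (h : K ≤ K') (h' : K' ≤ K'') (x) :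
    qm h' (qm h x) = qm (h.trans h') x := by
  obtain ⟨k, rfl⟩ := QuotientGroup.mk_surjective x
  rfl

lemma qm_smul_bs {K K' : Subgroup (FreeGroup α)} (h : K ≤ K') (g : FreeGroup α) :
    qm h (g • bs K) = g • bs K' := by rw [qm_eqv, qm_bs]

lemma qm_eq_iff {K K' : Subgroup (FreeGroup α)} (h : K ≤ K') (a b : FreeGroup α) :
    qm h (a • bs K) = qm h (b • bs K) ↔ a⁻¹ * b ∈ K' := by
  rw [qm_smul_bs, qm_smul_bs, smul_bs, smul_bs, QuotientGroup.eq]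

end Fin

end ORT


set_option linter.all false

namespace ORT

noncomputable section Dim

variable {α : Type} {V V' : Type} [MulAction (FreeGroup α) V] [MulAction (FreeGroup α) V']
variable {D : Dat α} (ℓ : ℕ)

/-- additive cocycle -/
def acoc (g : FreeGroup α) (x : V) : (V × α → ZMod ℓ) →ₗ[ZMod ℓ] ZMod ℓ :=
  AddMonoidHom.toZModLinearMap ℓ
    { toFun := fun c => Multiplicative.toAdd (coc (fun e => Multiplicative.ofAdd (c e)) g x)
      map_zero' := by
        have := coc_trivial (M := Multiplicative (ZMod ℓ)) g x
        simp only [Pi.zero_apply, ofAdd_zero]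
        rw [this]; rfl
      map_add' := fun c c' => by
        simp only [Pi.add_apply, ofAdd_add]
        rw [coc_mulc]; rfl }

lemma acoc_def (g : FreeGroup α) (x : V) (c : V × α → ZMod ℓ) :
    acoc ℓ g x c = Multiplicative.toAdd (coc (fun e => Multiplicative.ofAdd (c e)) g x) := rfl

variable {ℓ}

lemma acoc_eq_zero {g : FreeGroup α} {x : V} {c : V × α → ZMod ℓ} :
    acoc ℓ g x c = 0 ↔ coc (fun e => Multiplicative.ofAdd (c e)) g x = 1 := Iff.rfl

lemma acoc_one (x : V) (c : V × α → ZMod ℓ) : acoc ℓ 1 x c = 0 := by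
  rw [acoc_eq_zero, coc_one]

lemma acoc_mul (g h : FreeGroup α) (x : V) (c : V × α → ZMod ℓ) :
    acoc ℓ (g * h) x c = acoc ℓ g (h • x) c + acoc ℓ h x c := by
  rw [acoc_def, coc_mul]; rfl

lemma acoc_of (a : α) (x : V) (c : V × α → ZMod ℓ) : acoc ℓ (FreeGroup.of a) x c = c (x, a) := by
  rw [acoc_def, coc_of]; rfl

/-- coboundary -/
def cob (f : V → ZMod ℓ) : V × α → ZMod ℓ := fun e => f (FreeGroup.of e.2 • e.1) - f e.1

lemma acoc_cob (f : V → ZMod ℓ) (g : FreeGroup α) (x : V) :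
    acoc ℓ g x (cob f) = f (g • x) - f x := by
  rw [acoc_def]
  have := coc_gauge (M := Multiplicative (ZMod ℓ)) (fun _ : V × α => 1) (fun v => Multiplicative.ofAdd (f v)) g x
  have e : (fun e : V × α => Multiplicative.ofAdd (cob f e)) = (fun e => Multiplicative.ofAdd (f (FreeGroup.of e.2 • e.1)) * 1 * (Multiplicative.ofAdd (f e.1))⁻¹) := by
    funext e; simp only [cob, mul_one, ofAdd_sub, div_eq_mul_inv]
  rw [e, this, coc_trivial]
  simp [sub_eq_add_neg]

variable (D) in
/-- additive holonomy -/
def ahol (p : V × ZMod D.L) : (V × α → ZMod ℓ) →ₗ[ZMod ℓ] ZMod ℓ := acoc ℓ (D.W p.2 D.nL) p.1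

lemma ahol_eq_zero {p : V × ZMod D.L} {c : V × α → ZMod ℓ} :
    ahol D p c = 0 ↔ hol (fun e => Multiplicative.ofAdd (c e)) D p = 1 := Iff.rfl

lemma ahol_cob (f : V → ZMod ℓ) {p : V × ZMod D.L} (hp : p ∈ Fixd D V) : ahol D p (cob f) = 0 := by
  rw [ahol, acoc_cob, (mem_Fixd D p).1 hp, sub_self]

variable (ℓ) in
/-- cocycles with vanishing holonomy -/
def Zs (N : Set (V × ZMod D.L)) : Submodule (ZMod ℓ) (V × α → ZMod ℓ) :=
  ⨅ p ∈ N, LinearMap.ker (ahol D p)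

lemma mem_Zs {N : Set (V × ZMod D.L)} {c : V × α → ZMod ℓ} : c ∈ Zs ℓ N ↔ ∀ p ∈ N, ahol D p c = 0 := by
  simp [Zs, Submodule.mem_iInf]

variable (ℓ) in
/-- restriction to a set -/
def res {X : Type} (E : Set X) : (X → ZMod ℓ) →ₗ[ZMod ℓ] (E → ZMod ℓ) :=
  LinearMap.funLeft (ZMod ℓ) (ZMod ℓ) Subtype.val

lemma res_apply {X : Type} (E : Set X) (c : X → ZMod ℓ) (e : E) : res ℓ E c e = c e.1 := rfl

open Classical in
variable (ℓ) in
/-- extension by zero -/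
def ext0 {X : Type} (E : Set X) : (E → ZMod ℓ) →ₗ[ZMod ℓ] (X → ZMod ℓ) where
  toFun c := fun e => if h : e ∈ E then c ⟨e, h⟩ else 0
  map_add' c c' := by funext e; by_cases h : e ∈ E <;> simp [h]
  map_smul' a c := by funext e; by_cases h : e ∈ E <;> simp [h]

lemma res_ext0 {X : Type} (E : Set X) (c : E → ZMod ℓ) : res ℓ E (ext0 ℓ E c) = c := by
  funext e
  simp [res_apply, ext0]

lemma ext0_not {X : Type} {E : Set X} (c : E → ZMod ℓ) {e : X} (he : e ∉ E) : ext0 ℓ E c e = 0 := by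
  simp [ext0, he]

lemma ext0_mem {X : Type} {E : Set X} (c : E → ZMod ℓ) {e : X} (he : e ∈ E) :
    ext0 ℓ E c e = c ⟨e, he⟩ := by
  simp [ext0, he]

lemma ahol_pow {p : V × ZMod D.L} (hp : p ∈ Fixd D V) {c : V × α → ZMod ℓ} (h : ahol D p c = 0)
    (k : ℕ) : ahol D ((sig D ^ k) p) c = 0 :=
  ahol_eq_zero.2 (hol_pow_one (fun e => Multiplicative.ofAdd (c e)) D hp (ahol_eq_zero.1 h) k)

lemma exists_zero_pt {p : V × ZMod D.L} (hp : p ∈ Fixd D V) :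
    ∃ m k, ((sig D ^ m) p).2 = 0 ∧ (sig D ^ k) ((sig D ^ m) p) = p := by
  have hv := ZMod.val_lt p.2
  have h1 : D.L ≤ D.nL := Nat.le_mul_of_pos_left _ (by have := D.hn; omega)
  refine ⟨D.L - p.2.val, D.nL - (D.L - p.2.val), ?_, ?_⟩
  · rw [sig_pow]
    simp only
    rw [Nat.cast_sub hv.le]; simp
  · rw [← Equiv.Perm.mul_apply, ← pow_add, Nat.sub_add_cancel (by omega)]
    exact hp

lemma norm_rank [Fact ℓ.Prime] {S : Type} [Fintype S] (ρ : S → S) (n : ℕ) (hρ : ∀ s, ρ^[n] s = s)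
    (hn : ℓ ∣ n) (Nm : (S → ZMod ℓ) →ₗ[ZMod ℓ] (S → ZMod ℓ))
    (hNm : ∀ a s, Nm a s = ∑ j ∈ Finset.range n, a (ρ^[j] s)) :
    2 * Module.finrank (ZMod ℓ) (LinearMap.range Nm) ≤ Fintype.card S := by
  have h1 : ∀ a s, Nm a (ρ s) = Nm a s := by
    intro a s
    rw [hNm, hNm]
    have e1 := Finset.sum_range_succ (fun j => a (ρ^[j] s)) n
    have e2 := Finset.sum_range_succ' (fun j => a (ρ^[j] s)) n
    rw [e1] at e2
    simp only [hρ, Function.iterate_zero, id] at e2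
    have := add_right_cancel e2
    rw [this]
    rfl
  have h2 : ∀ a j s, Nm a (ρ^[j] s) = Nm a s := by
    intro a j
    induction j with
    | zero => intro s; rfl
    | succ j ih => intro s; rw [Function.iterate_succ_apply, ih, h1]
  have h3 : LinearMap.range Nm ≤ LinearMap.ker Nm := by
    rintro _ ⟨a, rfl⟩
    rw [LinearMap.mem_ker]
    funext s
    rw [hNm]
    simp only [h2, Finset.sum_const, Finset.card_range, nsmul_eq_mul]
    rw [(ZMod.natCast_eq_zero_iff n ℓ).2 hn, zero_mul]; rfl
  have h4 := LinearMap.finrank_range_add_finrank_ker Nm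
  have h5 := Submodule.finrank_mono h3
  rw [Module.finrank_fintype_fun_eq_card] at h4
  omega

theorem dim_bound [Fact ℓ.Prime] (hℓ : ℓ ∣ D.n) {N : Set (V × ZMod D.L)} (hf : N.Finite)
    (hN : Irr D N) :
    2 * (Prod.fst '' N).ncard + {p ∈ N | p.2 = 0}.ncard ≤
      2 * Module.finrank (ZMod ℓ) ((Zs ℓ N).map (res ℓ (eta D '' N))) := by
  classical
  have hwin := win hf hN.sg hN.ir
  set E := eta D '' N with hE
  haveI : Fintype E := (hf.image _).fintype
  let S := {p : V × ZMod D.L // p ∈ N ∧ p.2 = 0}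
  haveI : Fintype S := (hf.subset (fun p (hp : p ∈ {p | p ∈ N ∧ p.2 = 0}) => hp.1)).fintype
  have hSc : {p ∈ N | p.2 = 0}.ncard = Fintype.card S := by
    rw [← Nat.card_coe_set_eq]
    exact Nat.card_eq_fintype_card (α := S)
  let ρ : S → S := fun s => ⟨(sig D ^ D.L) s.1, sig_pow_mem hN.sg _ s.2.1, by
    rw [sig_pow]; simp [s.2.2]⟩
  have hρj : ∀ j (s : S), (ρ^[j] s).1 = (sig D ^ (j * D.L)) s.1 := by
    intro j
    induction j with
    | zero => intro s; simp
    | succ j ih =>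
      intro s
      rw [Function.iterate_succ_apply', show (j + 1) * D.L = D.L + j * D.L by ring, pow_add,
        Equiv.Perm.mul_apply, ← ih]
  have hρ : ∀ s, ρ^[D.n] s = s := by
    intro s
    apply Subtype.ext
    rw [hρj]
    exact hN.fx _ s.2.1
  let A : (V × α → ZMod ℓ) →ₗ[ZMod ℓ] (S → ZMod ℓ) :=
    LinearMap.pi fun s => acoc ℓ (D.W 0 D.L) s.1.1
  let Nm : (S → ZMod ℓ) →ₗ[ZMod ℓ] (S → ZMod ℓ) :=
    LinearMap.pi fun s => ∑ j ∈ Finset.range D.n, LinearMap.proj (ρ^[j] s)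
  have hNm : ∀ a s, Nm a s = ∑ j ∈ Finset.range D.n, a (ρ^[j] s) := by
    intro a s; simp [Nm]
  have hfac : ∀ c (s : S), ahol D s.1 c = Nm (A c) s := by
    intro c s
    rw [hNm, ahol, s.2.2]
    have : ∀ j, acoc ℓ (D.W 0 (j * D.L)) s.1.1 c = ∑ i ∈ Finset.range j, (A c) (ρ^[i] s) := by
      intro j
      induction j with
      | zero => simp [W_zero, acoc_one]
      | succ j ih =>
        rw [Finset.sum_range_succ, ← ih, show (j + 1) * D.L = j * D.L + D.L by ring, W_add,
          acoc_mul, add_comm]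
        congr 1
        simp only [A, LinearMap.pi_apply]
        rw [hρj, sig_pow, s.2.2]
        simp
    exact this D.n
  have hrk := norm_rank ρ D.n hρ hℓ Nm hNm
  let T := Nm ∘ₗ A ∘ₗ ext0 ℓ E
  have h1 := LinearMap.finrank_range_add_finrank_ker T
  rw [Module.finrank_fintype_fun_eq_card] at h1
  have h2 : Module.finrank (ZMod ℓ) (LinearMap.range T) ≤ Module.finrank (ZMod ℓ) (LinearMap.range Nm) :=
    Submodule.finrank_mono (LinearMap.range_comp_le_range _ _)
  have h3 : LinearMap.ker T ≤ (Zs ℓ N).map (res ℓ E) := by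
    intro c hc
    refine ⟨ext0 ℓ E c, ?_, res_ext0 E c⟩
    have hz : ∀ s : S, ahol D s.1 (ext0 ℓ E c) = 0 := by
      intro s
      rw [hfac]
      exact congrFun (LinearMap.mem_ker.1 hc) s
    refine mem_Zs.2 fun p hp => ?_
    obtain ⟨m, k, hm, hk⟩ := exists_zero_pt (hN.fx p hp)
    rw [← hk]
    exact ahol_pow (Fixd_pow D (hN.fx p hp) m) (hz ⟨_, sig_pow_mem hN.sg m hp, hm⟩) k
  have h4 := Submodule.finrank_mono h3
  have h5 : E.ncard = Fintype.card E := by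
    rw [← Nat.card_coe_set_eq, Nat.card_eq_fintype_card]
  omega

/-- linear algebra -/
lemma la_bound {k A B C : Type} [Field k] [AddCommGroup A] [AddCommGroup B] [AddCommGroup C]
    [Module k A] [Module k B] [Module k C] [FiniteDimensional k B] [FiniteDimensional k C]
    (Z : Submodule k A) (T : A →ₗ[k] B) (ev : A →ₗ[k] C) (P : Submodule k B)
    (h : ∀ c ∈ Z, ev c = 0 → T c ∈ P) :
    Module.finrank k (Z.map T) ≤ Module.finrank k P + Module.finrank k (Z.map ev) := by
  let T1 : Z →ₗ[k] B := T ∘ₗ Z.subtype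
  let e1 : Z →ₗ[k] C := ev ∘ₗ Z.subtype
  have hr1 : Z.map T = LinearMap.range T1 := by rw [LinearMap.range_comp, Submodule.range_subtype]
  have hr2 : Z.map ev = LinearMap.range e1 := by rw [LinearMap.range_comp, Submodule.range_subtype]
  rw [hr1, hr2]
  let Q : Z →ₗ[k] B ⧸ P := P.mkQ ∘ₗ T1
  have hker : LinearMap.ker e1 ≤ LinearMap.ker Q := by
    intro c hc
    rw [LinearMap.mem_ker]
    exact (Submodule.Quotient.mk_eq_zero P).2 (h c.1 c.2 hc)
  -- finrank range Q ≤ finrank range e1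
  have hQ : Module.finrank k (LinearMap.range Q) ≤ Module.finrank k (LinearMap.range e1) := by
    let Q' := (LinearMap.ker e1).liftQ Q hker
    have e2 : LinearMap.range Q = LinearMap.range Q' := (Submodule.range_liftQ _ _ _).symm
    have e3 := (LinearMap.quotKerEquivRange e1)
    haveI : FiniteDimensional k (Z ⧸ LinearMap.ker e1) := Module.Finite.equiv e3.symm
    rw [e2, ← e3.finrank_eq]
    exact LinearMap.finrank_range_le Q'
  let R := LinearMap.range T1
  let q : R →ₗ[k] B ⧸ P := P.mkQ ∘ₗ R.subtype
  have hq := LinearMap.finrank_range_add_finrank_ker q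
  have hq1 : LinearMap.range q = LinearMap.range Q := by
    rw [LinearMap.range_comp, Submodule.range_subtype, LinearMap.range_comp]
  have hq2 : Module.finrank k (LinearMap.ker q) ≤ Module.finrank k P := by
    let i : LinearMap.ker q →ₗ[k] P := LinearMap.codRestrict P (R.subtype ∘ₗ (LinearMap.ker q).subtype) (by
      intro c
      exact (Submodule.Quotient.mk_eq_zero P).1 (LinearMap.mem_ker.1 c.2))
    apply LinearMap.finrank_le_finrank_of_injective (f := i)
    intro a b hab
    apply Subtype.ext; apply Subtype.ext
    exact congrArg (fun z : P => z.1) hab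
  rw [hq1] at hq
  change Module.finrank k R ≤ _
  omega

end Dim

end ORT


set_option linter.all false

namespace ORT

noncomputable section Cls

lemma W_conj {α : Type} (D : Dat α) (i : ZMod D.L) (j : ℕ) :
    D.W i (j * D.L) = D.W 0 i.val * D.W 0 (j * D.L) * (D.W 0 i.val)⁻¹ := by
  have e1 := W_add D 0 i.val (j * D.L)
  have e2 := W_add D 0 (j * D.L) i.val
  rw [add_comm, e1] at e2
  simp only [Nat.cast_mul, CharP.cast_eq_zero, mul_zero, add_zero, ZMod.natCast_val, zero_add,
    ZMod.cast_id', id] at e2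
  exact eq_mul_inv_of_mul_eq e2

/-- The context of the main argument. -/
structure Ctx (α : Type) where
  D : Dat α
  G0 : Finset (FreeGroup α)
  F0 : Subgroup (FreeGroup α)
  rF : ∀ u, u * D.W 0 D.nL * u⁻¹ ∈ F0
  G0F : ∀ g ∈ G0, g ∈ F0
  tfF : ∀ g k, 0 < k → k < D.n → g * D.W 0 (k * D.L) * g⁻¹ ∉ F0
  ℓ : ℕ
  hp : Fact ℓ.Prime
  hd : ℓ ∣ D.n

attribute [instance] Ctx.hp

variable {α : Type} (C : Ctx α)

/-- conjugates of the relator -/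
def Ctx.cj : Set (FreeGroup α) := {h | ∃ u, h = u * C.D.W 0 C.D.nL * u⁻¹}

/-- the limit subgroup -/
def Ctx.H : Subgroup (FreeGroup α) := Subgroup.closure (C.G0 ∪ C.cj)

/-- the subgroups under consideration -/
structure Ctx.Y (K : Subgroup (FreeGroup α)) : Prop where
  fg : K.FG
  g0 : ∀ g ∈ C.G0, g ∈ K
  cl : K ≤ Subgroup.closure (C.G0 ∪ ((K : Set (FreeGroup α)) ∩ C.cj))

variable {C} {K K' : Subgroup (FreeGroup α)}

lemma Ctx.Y.leH (hK : C.Y K) : K ≤ C.H :=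
  hK.cl.trans (Subgroup.closure_mono (Set.union_subset_union_right _ Set.inter_subset_right))

lemma Ctx.Y.leF (hK : C.Y K) : K ≤ C.F0 := by
  refine hK.leH.trans ?_
  rw [Ctx.H, Subgroup.closure_le]
  rintro g (hg | ⟨u, rfl⟩)
  · exact C.G0F g hg
  · exact C.rF u

lemma Ctx.Y.sup (hK : C.Y K) (hK' : C.Y K') : C.Y (K ⊔ K') where
  fg := hK.fg.sup hK'.fg
  g0 := fun g hg => (le_sup_left : K ≤ K ⊔ K') (hK.g0 g hg)
  cl := by
    refine sup_le (hK.cl.trans ?_) (hK'.cl.trans ?_) <;>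
    · apply Subgroup.closure_mono
      apply Set.union_subset_union_right
      apply Set.inter_subset_inter_left
      first
      | exact (le_sup_left : K ≤ K ⊔ K')
      | exact (le_sup_right : K' ≤ K ⊔ K')

lemma Ctx.Y.init : C.Y (Subgroup.closure (C.G0 : Set (FreeGroup α))) where
  fg := ⟨C.G0, rfl⟩
  g0 := fun g hg => Subgroup.subset_closure hg
  cl := Subgroup.closure_mono Set.subset_union_left

lemma Ctx.Y.adj (hK : C.Y K) {h : FreeGroup α} (hh : h ∈ C.cj) : ∃ K', C.Y K' ∧ K ≤ K' ∧ h ∈ K' := by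
  refine ⟨K ⊔ Subgroup.closure {h}, ?_, le_sup_left,
    (le_sup_right : Subgroup.closure {h} ≤ _) (Subgroup.subset_closure rfl)⟩
  refine ⟨hK.fg.sup ⟨{h}, by simp⟩, fun g hg => (le_sup_left : K ≤ _) (hK.g0 g hg), ?_⟩
  refine sup_le (hK.cl.trans ?_) ?_
  · apply Subgroup.closure_mono
    apply Set.union_subset_union_right
    apply Set.inter_subset_inter_left
    exact (le_sup_left : K ≤ K ⊔ _)
  · apply Subgroup.closure_mono
    rintro _ rfl
    exact Or.inr ⟨(le_sup_right : Subgroup.closure _ ≤ _) (Subgroup.subset_closure rfl), hh⟩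

lemma Ctx.Y.absorb1 {h : FreeGroup α} (hh : h ∈ C.H) :
    ∀ {K}, C.Y K → ∃ K', C.Y K' ∧ K ≤ K' ∧ h ∈ K' := by
  induction hh using Subgroup.closure_induction with
  | mem x hx =>
    intro K hK
    rcases hx with hx | hx
    · exact ⟨K, hK, le_rfl, hK.g0 x hx⟩
    · exact hK.adj hx
  | one => intro K hK; exact ⟨K, hK, le_rfl, one_mem _⟩
  | mul a b _ _ ha hb =>
    intro K hK
    obtain ⟨K1, h1, h2, h3⟩ := ha hK
    obtain ⟨K2, h4, h5, h6⟩ := hb h1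
    exact ⟨K2, h4, h2.trans h5, mul_mem (h5 h3) h6⟩
  | inv a _ ha =>
    intro K hK
    obtain ⟨K1, h1, h2, h3⟩ := ha hK
    exact ⟨K1, h1, h2, inv_mem h3⟩

lemma Ctx.Y.absorb {S : Set (FreeGroup α)} (hS : S.Finite) (hSH : ∀ s ∈ S, s ∈ C.H) (hK : C.Y K) :
    ∃ K', C.Y K' ∧ K ≤ K' ∧ ∀ s ∈ S, s ∈ K' := by
  induction S, hS using Set.Finite.induction_on with
  | empty => exact ⟨K, hK, le_rfl, by simp⟩
  | insert _ _ ih =>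
    rename_i a s _ _
    obtain ⟨K1, h1, h2, h3⟩ := ih fun s hs => hSH s (Set.mem_insert_of_mem _ hs)
    obtain ⟨K2, h4, h5, h6⟩ := Ctx.Y.absorb1 (hSH a (Set.mem_insert _ _)) h1
    refine ⟨K2, h4, h2.trans h5, ?_⟩
    rintro s (rfl | hs)
    · exact h6
    · exact h5 (h3 s hs)

/-- merging vertices that become equal in the limit -/
lemma Ctx.Y.merge (hK : C.Y K) {X : Set (FreeGroup α ⧸ K)} (hX : X.Finite) :
    ∃ K', C.Y K' ∧ ∃ h : K ≤ K', ∀ x ∈ X, ∀ y ∈ X, qm hK.leH x = qm hK.leH y → qm h x = qm h y := by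
  choose g hg using fun x : FreeGroup α ⧸ K => exists_smul_bs x
  let S : Set (FreeGroup α) := ((fun p : (FreeGroup α ⧸ K) × (FreeGroup α ⧸ K) => (g p.1)⁻¹ * g p.2) '' (X ×ˢ X)) ∩ C.H
  have hS : S.Finite := ((hX.prod hX).image _).subset Set.inter_subset_left
  obtain ⟨K', h1, h2, h3⟩ := hK.absorb hS (fun s hs => hs.2)
  refine ⟨K', h1, h2, fun x hx y hy hxy => ?_⟩
  rw [← hg x, ← hg y, qm_eq_iff] at hxy ⊢
  exact h3 _ ⟨⟨(x, y), ⟨hx, hy⟩, rfl⟩, hxy⟩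

lemma Ctx.Y.tf (hK : C.Y K) (p : (FreeGroup α ⧸ K) × ZMod C.D.L) (k : ℕ) (h0 : 0 < k)
    (hk : k < C.D.nL) : (sig C.D ^ k) p ≠ p := by
  intro h
  rw [sig_pow] at h
  have h2 : (k : ZMod C.D.L) = 0 := by simpa using congrArg Prod.snd h
  have h1 : C.D.W p.2 k • p.1 = p.1 := congrArg Prod.fst h
  obtain ⟨j, rfl⟩ := (ZMod.natCast_eq_zero_iff _ _).1 h2
  rw [mul_comm] at h0 hk h1
  obtain ⟨g, hg⟩ := exists_smul_bs p.1
  rw [← hg, ← inv_smul_eq_iff, ← mul_smul, ← mul_smul, smul_bs_eq, W_conj] at h1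
  have hj : 0 < j := by
    rcases Nat.eq_zero_or_pos j with rfl | h
    · simp at h0
    · exact h
  have hjn : j < C.D.n := Nat.lt_of_mul_lt_mul_right hk
  apply C.tfF (g⁻¹ * C.D.W 0 p.2.val) j hj hjn
  have := hK.leF h1
  convert this using 1
  group

lemma Ctx.Y.fin (hK : C.Y K) : (Fixd C.D (FreeGroup α ⧸ K)).Finite := Fixd_finite hK.fg

variable {M : Type} [Group M]

lemma cj_mem_Fixd {u : FreeGroup α} (h : u * C.D.W 0 C.D.nL * u⁻¹ ∈ K) :
    ((u⁻¹ • bs K, 0) : (FreeGroup α ⧸ K) × ZMod C.D.L) ∈ Fixd C.D (FreeGroup α ⧸ K) := by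
  rw [mem_Fixd]
  simp only
  rw [← smul_bs_eq, mul_smul, mul_smul, ← eq_inv_smul_iff] at h
  exact h

lemma coc_cj (c : (FreeGroup α ⧸ K) × α → M) (hc : ∀ p ∈ Fixd C.D (FreeGroup α ⧸ K), hol c C.D p = 1)
    {h : FreeGroup α} (hK : h ∈ K) (hh : h ∈ C.cj) : coc c h (bs K) = 1 := by
  obtain ⟨u, rfl⟩ := hh
  have hp := cj_mem_Fixd hK
  have h1 := hc _ hp
  have h2 := (mem_Fixd _ _).1 hp
  simp only [hol] at h1 h2
  rw [coc_mul, coc_mul, h2, h1, coc_inv]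
  simp

lemma Ctx.Y.coc_one (hK : C.Y K) (c : (FreeGroup α ⧸ K) × α → M)
    (hc : ∀ p ∈ Fixd C.D (FreeGroup α ⧸ K), hol c C.D p = 1) (hg : ∀ g ∈ C.G0, coc c g (bs K) = 1)
    (k : FreeGroup α) (hk : k ∈ K) : coc c k (bs K) = 1 := by
  have h1 := coc_closure c (bs K) (C.G0 ∪ ((K : Set (FreeGroup α)) ∩ C.cj)) ?_ ?_ k (hK.cl hk)
  · exact h1.2
  · rintro g (hg | hg)
    · exact smul_bs_eq.2 (hK.g0 g hg)
    · exact smul_bs_eq.2 hg.1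
  · rintro g (hg' | hg')
    · exact hg g hg'
    · exact coc_cj c hc hg'.1 hg'.2

/-- evaluation on the initial generators -/
def Ctx.ev (C : Ctx α) (K : Subgroup (FreeGroup α)) :
    ((FreeGroup α ⧸ K) × α → ZMod C.ℓ) →ₗ[ZMod C.ℓ] (C.G0 → ZMod C.ℓ) :=
  LinearMap.pi fun g => acoc C.ℓ g.1 (bs K)

lemma exists_cob {ℓ : ℕ} (c : (FreeGroup α ⧸ K) × α → ZMod ℓ) (h : ∀ k ∈ K, acoc ℓ k (bs K) c = 0) :
    ∃ f : FreeGroup α ⧸ K → ZMod ℓ, f (bs K) = 0 ∧ c = cob f := by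
  choose s hs using fun x : FreeGroup α ⧸ K => exists_smul_bs x
  have key : ∀ g, acoc ℓ g (bs K) c = acoc ℓ (s (g • bs K)) (bs K) c := by
    intro g
    have h1 : (s (g • bs K))⁻¹ * g ∈ K := by
      rw [← smul_bs_eq, mul_smul, inv_smul_eq_iff, hs]
    have h2 := acoc_mul (s (g • bs K)) ((s (g • bs K))⁻¹ * g) (bs K) c
    rw [smul_bs_eq.2 h1, h _ h1, add_zero, mul_inv_cancel_left] at h2
    exact h2
  refine ⟨fun x => acoc ℓ (s x) (bs K) c, ?_, ?_⟩
  · have := key 1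
    rw [one_smul, acoc_one] at this
    exact this.symm
  · funext e
    obtain ⟨g, hg⟩ := exists_smul_bs e.1
    have h2 := acoc_mul (FreeGroup.of e.2) g (bs K) c
    rw [hg, acoc_of, key, key g, mul_smul, hg] at h2
    simp only [cob]
    rw [h2]; simp

lemma Ctx.Y.cob (hK : C.Y K) {c : (FreeGroup α ⧸ K) × α → ZMod C.ℓ}
    (hc : c ∈ Zs C.ℓ (Fixd C.D (FreeGroup α ⧸ K))) (he : C.ev K c = 0) :
    ∃ f : FreeGroup α ⧸ K → ZMod C.ℓ, f (bs K) = 0 ∧ c = ORT.cob f := by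
  apply exists_cob
  intro k hk
  rw [acoc_eq_zero]
  refine hK.coc_one _ (fun p hp => ahol_eq_zero.1 (mem_Zs.1 hc p hp)) (fun g hg => ?_) k hk
  exact acoc_eq_zero.1 (congrFun he ⟨g, hg⟩)

/-- collapse for the full set of fixed points -/
lemma Ctx.Y.collapse (hK : C.Y K) : ∃ ε : Set ((FreeGroup α ⧸ K) × α),
    ε ⊆ eta C.D '' (Fixd C.D (FreeGroup α ⧸ K)) ∧
    Disjoint ε (eta C.D '' (core C.D (Fixd C.D (FreeGroup α ⧸ K)))) ∧
      (∀ (M : Type) [Group M] (c : (FreeGroup α ⧸ K) × α → M),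
        (∀ p ∈ core C.D (Fixd C.D (FreeGroup α ⧸ K)), hol c C.D p = 1) →
        ∃ c' : (FreeGroup α ⧸ K) × α → M, (∀ e ∉ ε, c' e = c e) ∧
          ∀ p ∈ Fixd C.D (FreeGroup α ⧸ K), hol c' C.D p = 1) ∧
      (∀ (M : Type) [Group M] (c c' : (FreeGroup α ⧸ K) × α → M),
        (∀ p ∈ Fixd C.D (FreeGroup α ⧸ K), hol c C.D p = 1) →
        (∀ p ∈ Fixd C.D (FreeGroup α ⧸ K), hol c' C.D p = 1) →
        (∀ e ∈ eta C.D '' (Fixd C.D (FreeGroup α ⧸ K)), e ∉ ε → c e = c' e) →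
        ∀ e ∈ ε, c e = c' e) :=
  ORT.collapse _ _ hK.fin (fun p hp => Fixd_sig _ hp) (fun p hp => hp) (fun p _ => hK.tf p)
    (core_irr _) (core_sub _) (fun B' hB' hI => sub_core hB' hI)

/-- core of a subgroup -/
abbrev Ctx.co (C : Ctx α) (K : Subgroup (FreeGroup α)) : Set ((FreeGroup α ⧸ K) × ZMod C.D.L) :=
  core C.D (Fixd C.D (FreeGroup α ⧸ K))

lemma irr_sub_co {N : Set ((FreeGroup α ⧸ K) × ZMod C.D.L)} (h : Irr C.D N) : N ⊆ C.co K :=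
  sub_core h.fx h

lemma Ctx.Y.co_fin (hK : C.Y K) : (C.co K).Finite := hK.fin.subset (core_sub _)

/-- additive extension from the core -/
lemma Ctx.Y.extend (hK : C.Y K) (c : (FreeGroup α ⧸ K) × α → ZMod C.ℓ) (hc : c ∈ Zs C.ℓ (C.co K)) :
    ∃ c' ∈ Zs C.ℓ (Fixd C.D (FreeGroup α ⧸ K)), ∀ e ∈ eta C.D '' C.co K, c' e = c e := by
  obtain ⟨ε, h1, h2, h3, h4⟩ := hK.collapse
  obtain ⟨c', h5, h6⟩ := h3 (Multiplicative (ZMod C.ℓ)) (fun e => Multiplicative.ofAdd (c e))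
    (fun p hp => ahol_eq_zero.1 (mem_Zs.1 hc p hp))
  refine ⟨fun e => Multiplicative.toAdd (c' e), mem_Zs.2 fun p hp => ahol_eq_zero.2 (h6 p hp), ?_⟩
  intro e he
  have := h5 e (fun h => Set.disjoint_left.1 h2 h he)
  simp [this]

/-- edges of a σ-closed set have endpoints in it -/
lemma ends_mem {V : Type} [MulAction (FreeGroup α) V] {D : Dat α} {N : Set (V × ZMod D.L)}
    (hs : ∀ p ∈ N, sig D p ∈ N) {e : V × α} (he : e ∈ eta D '' N) :
    e.1 ∈ Prod.fst '' N ∧ FreeGroup.of e.2 • e.1 ∈ Prod.fst '' N := by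
  obtain ⟨p, hp, rfl⟩ := he
  exact ⟨⟨_, srcP_mem hs hp, srcP_fst D p⟩, ⟨_, tgtP_mem hs hp, tgtP_fst D p⟩⟩

/-- coboundaries supported on vertex set `X`, restricted to `E` -/
def cobR (ℓ : ℕ) {V : Type} [MulAction (FreeGroup α) V] (X : Set V) (E : Set (V × α)) :
    Submodule (ZMod ℓ) (E → ZMod ℓ) :=
  LinearMap.range ((res ℓ E) ∘ₗ
    ({ toFun := ORT.cob, map_add' := fun f g => by funext e; simp [ORT.cob]; ring,
       map_smul' := fun a f => by funext e; simp [ORT.cob]; ring } :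
      (V → ZMod ℓ) →ₗ[ZMod ℓ] (V × α → ZMod ℓ)) ∘ₗ ext0 ℓ X)

lemma cobR_finrank {ℓ : ℕ} [Fact ℓ.Prime] {V : Type} [MulAction (FreeGroup α) V] {X : Set V}
    (hX : X.Finite) (E : Set (V × α)) : Module.finrank (ZMod ℓ) (cobR ℓ X E) ≤ X.ncard := by
  haveI : Fintype X := hX.fintype
  refine (LinearMap.finrank_range_le _).trans ?_
  rw [Module.finrank_fintype_fun_eq_card, ← Nat.card_coe_set_eq, Nat.card_eq_fintype_card]

lemma mem_cobR {ℓ : ℕ} {V : Type} [MulAction (FreeGroup α) V] {X : Set V} {E : Set (V × α)}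
    (hE : ∀ e ∈ E, e.1 ∈ X ∧ FreeGroup.of e.2 • e.1 ∈ X) (f : V → ZMod ℓ) :
    res ℓ E (ORT.cob f) ∈ cobR ℓ X E := by
  refine ⟨res ℓ X f, ?_⟩
  funext e
  obtain ⟨h1, h2⟩ := hE e.1 e.2
  simp only [LinearMap.comp_apply, LinearMap.coe_mk, AddHom.coe_mk, res_apply, ORT.cob]
  rw [ext0_mem _ h1, ext0_mem _ h2, res_apply, res_apply]

/-- Betti bound -/
lemma Ctx.Y.betti (hK : C.Y K) : {p ∈ C.co K | p.2 = 0}.ncard ≤ 2 * C.G0.card := by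
  have h1 := dim_bound C.hd hK.co_fin (core_irr (D := C.D) (Fixd C.D (FreeGroup α ⧸ K)))
  set E := eta C.D '' C.co K with hE
  set X := Prod.fst '' C.co K with hX
  haveI : Fintype E := (hK.co_fin.image _).fintype
  have h2 := la_bound (Zs C.ℓ (Fixd C.D (FreeGroup α ⧸ K))) (res C.ℓ E) (C.ev K) (cobR C.ℓ X E) (by
    intro c hc he
    obtain ⟨f, _, rfl⟩ := hK.cob hc he
    exact mem_cobR (fun e he => ends_mem (core_irr _).sg he) f)
  have h3 : (Zs C.ℓ (C.co K)).map (res C.ℓ E) ≤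
      (Zs C.ℓ (Fixd C.D (FreeGroup α ⧸ K))).map (res C.ℓ E) := by
    rintro _ ⟨c, hc, rfl⟩
    obtain ⟨c', h1, h2⟩ := hK.extend c hc
    refine ⟨c', h1, ?_⟩
    funext e
    exact h2 e.1 e.2
  have h4 := Submodule.finrank_mono h3
  have h5 : Module.finrank (ZMod C.ℓ) (cobR C.ℓ X E) ≤ X.ncard := cobR_finrank (hK.co_fin.image Prod.fst) E
  have h6 := Submodule.finrank_le ((Zs C.ℓ (Fixd C.D (FreeGroup α ⧸ K))).map (C.ev K))
  rw [Module.finrank_fintype_fun_eq_card, Fintype.card_coe] at h6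
  omega

lemma Ctx.Y.co_card (hK : C.Y K) : (C.co K).ncard ≤ (2 * C.G0.card) * C.D.L := by
  have h1 := hK.betti
  have hfin : ({p ∈ C.co K | p.2 = 0} ×ˢ (Set.univ : Set (ZMod C.D.L))).Finite :=
    (hK.co_fin.subset (Set.sep_subset _ _)).prod Set.finite_univ
  have h2 : (C.co K).ncard ≤ ({p ∈ C.co K | p.2 = 0} ×ˢ (Set.univ : Set (ZMod C.D.L))).ncard := by
    apply Set.ncard_le_ncard_of_injOn (fun p => ((sig C.D ^ (C.D.L - p.2.val)) p, p.2)) _ _ hfin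
    · intro p hp
      refine ⟨⟨sig_pow_mem (core_irr _).sg _ hp, ?_⟩, trivial⟩
      have hv := ZMod.val_lt p.2
      rw [sig_pow]; simp only
      rw [Nat.cast_sub hv.le]; simp
    · intro p _ q _ h
      have h2 : p.2 = q.2 := (Prod.ext_iff.1 h).2
      have h3 := (Prod.ext_iff.1 h).1
      simp only at h3
      rw [h2] at h3
      exact (sig C.D ^ _).injective h3
  rw [Set.ncard_prod, Set.ncard_univ, Nat.card_eq_fintype_card, ZMod.card] at h2
  exact h2.trans (Nat.mul_le_mul_right _ h1)

end Cls

end ORT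


set_option linter.all false

namespace ORT

noncomputable section Lim

variable {α : Type} {C : Ctx α} {K K' K1 : Subgroup (FreeGroup α)}

/-- evaluations of cocycles vanishing on the edges of `B` -/
def HE (C : Ctx α) (K : Subgroup (FreeGroup α)) (B : Set ((FreeGroup α ⧸ K) × ZMod C.D.L)) :
    Submodule (ZMod C.ℓ) (C.G0 → ZMod C.ℓ) :=
  ((Zs C.ℓ (Fixd C.D (FreeGroup α ⧸ K))) ⊓ LinearMap.ker (res C.ℓ (eta C.D '' B))).map (C.ev K)

lemma mem_HE {B : Set ((FreeGroup α ⧸ K) × ZMod C.D.L)} {v : C.G0 → ZMod C.ℓ} :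
    v ∈ HE C K B ↔ ∃ c, c ∈ Zs C.ℓ (Fixd C.D (FreeGroup α ⧸ K)) ∧ (∀ p ∈ B, c (eta C.D p) = 0) ∧
      C.ev K c = v := by
  constructor
  · rintro ⟨c, ⟨h1, h2⟩, rfl⟩
    exact ⟨c, h1, fun p hp => congrFun h2 ⟨eta C.D p, p, hp, rfl⟩, rfl⟩
  · rintro ⟨c, h1, h2, rfl⟩
    refine ⟨c, ⟨h1, ?_⟩, rfl⟩
    change res C.ℓ _ c = 0
    funext ⟨e, p, hp, he⟩
    subst he
    exact h2 p hp

lemma pull_mem (h : K ≤ K') {c : (FreeGroup α ⧸ K') × α → ZMod C.ℓ}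
    (hc : c ∈ Zs C.ℓ (Fixd C.D (FreeGroup α ⧸ K'))) :
    (fun e => c (em (qm h) e)) ∈ Zs C.ℓ (Fixd C.D (FreeGroup α ⧸ K)) := by
  rw [mem_Zs] at hc ⊢
  intro p hp
  have h1 := ahol_eq_zero.1 (hc _ (Fixd_pm (qm_eqv h) hp))
  rw [ahol_eq_zero, ← h1]
  exact hol_em (qm_eqv h) (fun e => Multiplicative.ofAdd (c e)) p

lemma pull_ev (h : K ≤ K') (c : (FreeGroup α ⧸ K') × α → ZMod C.ℓ) :
    C.ev K (fun e => c (em (qm h) e)) = C.ev K' c := by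
  funext g
  have := coc_em (qm_eqv h) (fun e => Multiplicative.ofAdd (c e)) g.1 (bs K)
  rw [qm_bs] at this
  simp only [Ctx.ev, LinearMap.pi_apply, acoc_def]
  rw [this]

lemma HE_anti (h : K ≤ K') {B : Set ((FreeGroup α ⧸ K) × ZMod C.D.L)}
    {B' : Set ((FreeGroup α ⧸ K') × ZMod C.D.L)} (hB : ∀ p ∈ B, pm C.D (qm h) p ∈ B') :
    HE C K' B' ≤ HE C K B := by
  intro v hv
  obtain ⟨c, h1, h2, rfl⟩ := mem_HE.1 hv
  refine mem_HE.2 ⟨_, pull_mem h h1, fun p hp => ?_, pull_ev h c⟩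
  rw [← eta_pm (qm_eqv h)]
  exact h2 _ (hB p hp)

lemma pm_pm {K'' : Subgroup (FreeGroup α)} (h : K ≤ K') (h' : K' ≤ K'') (p : (FreeGroup α ⧸ K) × ZMod C.D.L) :
    pm C.D (qm h') (pm C.D (qm h) p) = pm C.D (qm (h.trans h')) p := by
  simp [pm, qm_qm]

lemma co_pm (h : K ≤ K') {p : (FreeGroup α ⧸ K) × ZMod C.D.L} (hp : p ∈ C.co K) :
    pm C.D (qm h) p ∈ C.co K' :=
  irr_sub_co (Irr.image (qm_eqv h) (core_irr _)) ⟨p, hp, rfl⟩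

/-- maximal image in the limit -/
lemma exists_K1 (C : Ctx α) : ∃ K1, ∃ h1 : C.Y K1, ∀ K (hK : C.Y K),
    pm C.D (qm hK.leH) '' C.co K ⊆ pm C.D (qm h1.leH) '' C.co K1 := by
  let S : Set ℕ := {m | ∃ K, ∃ hK : C.Y K, m = (pm C.D (qm hK.leH) '' C.co K).ncard}
  have hb : BddAbove S := by
    refine ⟨(2 * C.G0.card) * C.D.L, ?_⟩
    rintro m ⟨K, hK, rfl⟩
    exact (Set.ncard_image_le hK.co_fin).trans hK.co_card
  have hne : S.Nonempty := ⟨_, _, Ctx.Y.init, rfl⟩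
  obtain ⟨K1, h1, he⟩ := Nat.sSup_mem hne hb
  refine ⟨K1, h1, fun K hK => ?_⟩
  have h2 := hK.sup h1
  have hl : pm C.D (qm hK.leH) '' C.co K ⊆ pm C.D (qm h2.leH) '' C.co (K ⊔ K1) := by
    rintro _ ⟨p, hp, rfl⟩
    exact ⟨_, co_pm (le_sup_left : K ≤ K ⊔ K1) hp, pm_pm _ _ _⟩
  have hr : pm C.D (qm h1.leH) '' C.co K1 ⊆ pm C.D (qm h2.leH) '' C.co (K ⊔ K1) := by
    rintro _ ⟨p, hp, rfl⟩
    exact ⟨_, co_pm (le_sup_right : K1 ≤ K ⊔ K1) hp, pm_pm _ _ _⟩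
  have : pm C.D (qm h1.leH) '' C.co K1 = pm C.D (qm h2.leH) '' C.co (K ⊔ K1) := by
    refine Set.eq_of_subset_of_ncard_le hr ?_ (h2.co_fin.image _)
    rw [← he]
    exact le_csSup hb ⟨_, h2, rfl⟩
  rw [this]; exact hl

/-- the components of the core outside `B0` form an irreducible family -/
lemma J_irr {V : Type} [MulAction (FreeGroup α) V] {D : Dat α} {N B : Set (V × ZMod D.L)}
    (hN : Irr D N) (hB : Irr D B) (hBf : B.Finite)
    (h : ∀ p ∈ N, p.1 ∈ Prod.fst '' B → p ∈ B) : Irr D (N \ B) where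
  sg := by
    rintro p ⟨hp, hpB⟩
    refine ⟨hN.sg p hp, fun h1 => hpB ?_⟩
    obtain ⟨q, hq, h2⟩ := sig_surjOn hBf hB.sg h1
    rwa [← (sig D).injective h2]
  fx := fun p hp => hN.fx p hp.1
  ir := by
    rintro p ⟨hp, hpB⟩
    obtain ⟨q, hq, hne, he⟩ := hN.ir p hp
    refine ⟨q, ⟨hq, fun hqB => hpB ?_⟩, hne, he⟩
    have h1 : srcP D p ∈ B := by
      apply h _ (srcP_mem hN.sg hp)
      refine ⟨_, srcP_mem hB.sg hqB, ?_⟩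
      rw [srcP_fst, srcP_fst, he]
    rw [srcP] at h1
    split_ifs at h1
    · exact h1
    · obtain ⟨q, hq, h2⟩ := sig_surjOn hBf hB.sg h1
      rwa [← (sig D).injective h2]

/-- an extra component carries a nontrivial class -/
lemma exists_class {V : Type} [MulAction (FreeGroup α) V] {D : Dat α} {ℓ : ℕ} [Fact ℓ.Prime]
    (hd : ℓ ∣ D.n) {J : Set (V × ZMod D.L)} (hf : J.Finite) (hJ : Irr D J) (hne : J.Nonempty) :
    ∃ c ∈ Zs ℓ J, res ℓ (eta D '' J) c ∉ cobR ℓ (Prod.fst '' J) (eta D '' J) := by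
  by_contra hcon
  push Not at hcon
  have h1 := dim_bound hd hf hJ
  haveI : Fintype (eta D '' J) := (hf.image _).fintype
  have h2 : (Zs ℓ J).map (res ℓ (eta D '' J)) ≤ cobR ℓ (Prod.fst '' J) (eta D '' J) := by
    rintro _ ⟨c, hc, rfl⟩; exact hcon c hc
  have h3 := Submodule.finrank_mono h2
  have h4 : Module.finrank (ZMod ℓ) (cobR ℓ (Prod.fst '' J) (eta D '' J)) ≤ (Prod.fst '' J).ncard :=
    cobR_finrank (hf.image Prod.fst) _
  obtain ⟨p, hp⟩ := hne
  obtain ⟨m, k, h5, h6⟩ := exists_zero_pt (hJ.fx p hp)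
  have h7 : 0 < {p ∈ J | p.2 = 0}.ncard := by
    rw [Set.ncard_pos (hf.subset (Set.sep_subset _ _))]
    exact ⟨_, sig_pow_mem hJ.sg m hp, h5⟩
  omega

/-- stability data in the limit -/
theorem limit (C : Ctx α) : ∃ K3, C.Y K3 ∧ ∃ B : Set ((FreeGroup α ⧸ C.H) × ZMod C.D.L),
    ∀ K (hK : C.Y K), K3 ≤ K → pm C.D (qm hK.leH) '' C.co K = B ∧
      Set.InjOn (qm hK.leH) (Prod.fst '' C.co K ∪ {bs K}) ∧
      HE C K (C.co K) = HE C K3 (C.co K3) := by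
  obtain ⟨K1, h1, hmax⟩ := exists_K1 C
  obtain ⟨K2, h2, h12, hinj⟩ := h1.merge (X := Prod.fst '' C.co K1 ∪ {bs K1})
    ((h1.co_fin.image _).union (Set.finite_singleton _))
  -- injectivity on `B0`
  have hinj' : ∀ K (hK : C.Y K) (h : K2 ≤ K),
      Set.InjOn (qm hK.leH) (Prod.fst '' (pm C.D (qm (h12.trans h)) '' C.co K1) ∪ {bs K}) := by
    intro K hK h
    have hrep : ∀ x ∈ Prod.fst '' (pm C.D (qm (h12.trans h)) '' C.co K1) ∪ {bs K},
        ∃ y ∈ Prod.fst '' C.co K1 ∪ {bs K1}, qm (h12.trans h) y = x := by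
      rintro x (⟨_, ⟨p, hp, rfl⟩, rfl⟩ | rfl)
      · exact ⟨p.1, Or.inl ⟨p, hp, rfl⟩, rfl⟩
      · exact ⟨bs K1, Or.inr rfl, qm_bs _⟩
    intro x hx y hy hxy
    obtain ⟨x', hx', rfl⟩ := hrep x hx
    obtain ⟨y', hy', rfl⟩ := hrep y hy
    rw [qm_qm, qm_qm] at hxy
    have := hinj x' hx' y' hy' hxy
    rw [← qm_qm h12 h, ← qm_qm h12 h, this]
  have hBirr : ∀ K (h : K1 ≤ K), Irr C.D (pm C.D (qm h) '' C.co K1) :=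
    fun K h => Irr.image (qm_eqv h) (core_irr _)
  have hBfin : ∀ K (h : K1 ≤ K), (pm C.D (qm h) '' C.co K1).Finite := fun K h => h1.co_fin.image _
  have hkey : ∀ K (hK : C.Y K) (h : K2 ≤ K), ∀ p ∈ C.co K,
      p.1 ∈ Prod.fst '' (pm C.D (qm (h12.trans h)) '' C.co K1) →
      p ∈ pm C.D (qm (h12.trans h)) '' C.co K1 := by
    intro K hK h p hp hpV
    obtain ⟨q, hq, he⟩ := hmax K hK ⟨p, hp, rfl⟩
    refine ⟨q, hq, ?_⟩
    have e2 : q.2 = p.2 := (Prod.ext_iff.1 he).2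
    have e1 : qm h1.leH q.1 = qm hK.leH p.1 := (Prod.ext_iff.1 he).1
    refine Prod.ext ?_ e2
    apply hinj' K hK h (Or.inl ⟨_, ⟨q, hq, rfl⟩, rfl⟩) (Or.inl hpV)
    rw [← e1]
    exact qm_qm (h12.trans h) hK.leH _
  -- minimise
  let S : Set ℕ := {m | ∃ K, ∃ hK : C.Y K, ∃ h : K2 ≤ K,
    m = Module.finrank (ZMod C.ℓ) (HE C K (pm C.D (qm (h12.trans h)) '' C.co K1))}
  have hS : S.Nonempty := ⟨_, K2, h2, le_rfl, rfl⟩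
  obtain ⟨K3, h3, h23, he3⟩ := Nat.sInf_mem hS
  have hmin : ∀ K (hK : C.Y K) (h : K3 ≤ K),
      HE C K (pm C.D (qm (h12.trans (h23.trans h))) '' C.co K1) =
        HE C K3 (pm C.D (qm (h12.trans h23)) '' C.co K1) := by
    intro K hK h
    apply Submodule.eq_of_le_of_finrank_le
    · apply HE_anti h
      rintro _ ⟨p, hp, rfl⟩
      exact ⟨p, hp, (pm_pm _ _ _).symm⟩
    · rw [← he3]
      exact Nat.sInf_le ⟨K, hK, h23.trans h, rfl⟩
  -- the core is `B0`
  have hco : ∀ K (hK : C.Y K) (h : K3 ≤ K),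
      C.co K = pm C.D (qm (h12.trans (h23.trans h))) '' C.co K1 := by
    intro K hK h
    set B := pm C.D (qm (h12.trans (h23.trans h))) '' C.co K1 with hBdef
    have hBs : B ⊆ C.co K := by rintro _ ⟨p, hp, rfl⟩; exact co_pm _ hp
    by_contra hne
    have hJne : (C.co K \ B).Nonempty := by
      rw [Set.nonempty_iff_ne_empty, Ne, Set.diff_eq_empty]
      exact fun hle => hne (hle.antisymm hBs)
    have hJ : Irr C.D (C.co K \ B) := J_irr (core_irr _) (hBirr K _) (hBfin K _) (hkey K hK (h23.trans h))
    have hJf : (C.co K \ B).Finite := hK.co_fin.subset Set.diff_subset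
    obtain ⟨c0, hc0, hn0⟩ := exists_class C.hd hJf hJ hJne
    set J := C.co K \ B with hJdef
    have hdisj : ∀ p ∈ B, eta C.D p ∉ eta C.D '' J := by
      intro p hp he
      obtain ⟨q, hq, h5⟩ := (ends_mem hJ.sg he).1
      have h6 := (ends_mem (hBirr K (h12.trans (h23.trans h))).sg ⟨p, hp, rfl⟩).1
      rw [← h5] at h6
      exact hq.2 (hkey K hK (h23.trans h) q hq.1 h6)
    set c1 := ext0 C.ℓ (eta C.D '' J) (res C.ℓ (eta C.D '' J) c0) with hc1
    have hc1J : ∀ e ∈ eta C.D '' J, c1 e = c0 e := fun e he => ext0_mem _ he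
    have hc1B : ∀ p ∈ B, c1 (eta C.D p) = 0 := fun p hp => ext0_not _ (hdisj p hp)
    have hc1Z : c1 ∈ Zs C.ℓ (C.co K) := by
      rw [mem_Zs]
      intro p hp
      by_cases hpB : p ∈ B
      · rw [ahol_eq_zero]
        rw [hol_congr C.D _ (fun _ => 1) (hBirr K (h12.trans (h23.trans h))).sg _ hpB]
        · exact coc_trivial _ _
        · rintro _ ⟨q, hq, rfl⟩
          rw [hc1B q hq]; rfl
      · have hpJ : p ∈ J := ⟨hp, hpB⟩
        rw [ahol_eq_zero, ← ahol_eq_zero.1 (mem_Zs.1 hc0 p hpJ)]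
        exact hol_congr C.D _ _ hJ.sg (fun e he => by rw [hc1J e he]) hpJ
    obtain ⟨c2, hc2, hc2e⟩ := hK.extend c1 hc1Z
    obtain ⟨K', hK', hKK', hm⟩ := hK.merge (X := Prod.fst '' C.co K) (hK.co_fin.image _)
    have hv : C.ev K c2 ∈ HE C K B :=
      mem_HE.2 ⟨c2, hc2, fun p hp => by rw [hc2e _ ⟨p, hBs hp, rfl⟩, hc1B p hp], rfl⟩
    rw [hmin K hK h, ← hmin K' hK' (h.trans hKK')] at hv
    obtain ⟨c', hc', hc'B, hce⟩ := mem_HE.1 hv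
    have hsub := sub_mem hc2 (pull_mem hKK' hc')
    obtain ⟨f, _, hf⟩ := hK.cob hsub (by rw [map_sub, pull_ev, hce, sub_self])
    apply hn0
    have : res C.ℓ (eta C.D '' J) c0 = res C.ℓ (eta C.D '' J) (ORT.cob f) := by
      funext ⟨e, p, hp, hpe⟩
      subst hpe
      rw [res_apply, res_apply, ← hf]
      simp only [Pi.sub_apply]
      rw [hc2e _ ⟨p, hp.1, rfl⟩, hc1J _ ⟨p, hp, rfl⟩, ← eta_pm (qm_eqv hKK'), hc'B, sub_zero]
      obtain ⟨q, hq, he⟩ := hmax K hK ⟨p, hp.1, rfl⟩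
      refine ⟨q, hq, ?_⟩
      have e2 : q.2 = p.2 := (Prod.ext_iff.1 he).2
      have e1 : qm h1.leH q.1 = qm hK.leH p.1 := (Prod.ext_iff.1 he).1
      refine Prod.ext ?_ e2
      have h8 := hm (qm (h12.trans (h23.trans h)) q.1)
        ⟨pm C.D (qm (h12.trans (h23.trans h))) q, hBs ⟨q, hq, rfl⟩, rfl⟩ p.1 ⟨p, hp.1, rfl⟩
        (by rw [← e1]; exact qm_qm (h12.trans (h23.trans h)) hK.leH _)
      rw [qm_qm] at h8
      exact h8
    rw [this]
    exact mem_cobR (fun e he => ends_mem hJ.sg he) f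
  refine ⟨K3, h3, pm C.D (qm h1.leH) '' C.co K1, fun K hK h => ⟨?_, ?_, ?_⟩⟩
  · rw [hco K hK h]
    ext p
    constructor
    · rintro ⟨_, ⟨q, hq, rfl⟩, rfl⟩
      exact ⟨q, hq, (pm_pm _ _ _).symm⟩
    · rintro ⟨q, hq, rfl⟩
      exact ⟨_, ⟨q, hq, rfl⟩, (pm_pm _ _ _)⟩
  · rw [hco K hK h]
    exact hinj' K hK (h23.trans h)
  · rw [hco K hK h, hmin K hK h, hco K3 h3 le_rfl]

end Lim

end ORT


set_option linter.all false

namespace ORT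

noncomputable section Cnt

variable {α : Type}

/-- edges near the base point -/
def TT (K : Subgroup (FreeGroup α)) (ρ : ℕ) : Set ((FreeGroup α ⧸ K) × α) :=
  {e | ∃ (w : List (α × Bool)) (l : α × Bool), w.length ≤ ρ ∧ e = edge l (FreeGroup.mk w • bs K)}

/-- vertices near the base point -/
def UU (K : Subgroup (FreeGroup α)) (ρ : ℕ) : Set (FreeGroup α ⧸ K) :=
  {v | ∃ w : List (α × Bool), w.length ≤ ρ + 1 ∧ v = FreeGroup.mk w • bs K}

variable {K K' : Subgroup (FreeGroup α)} {ρ : ℕ}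

lemma TT_fin [Finite α] : (TT K ρ).Finite := by
  have h : ({l : List (α × Bool) | l.length ≤ ρ} ×ˢ (Set.univ : Set (α × Bool))).Finite :=
    (List.finite_length_le _ _).prod Set.finite_univ
  refine (h.image (fun q => edge q.2 (FreeGroup.mk q.1 • bs K))).subset ?_
  rintro e ⟨w, l, hw, rfl⟩
  exact ⟨(w, l), ⟨hw, trivial⟩, rfl⟩

lemma UU_fin [Finite α] : (UU K ρ).Finite := by
  have h : ({l : List (α × Bool) | l.length ≤ ρ + 1}).Finite := List.finite_length_le _ _
  refine (h.image (fun q => FreeGroup.mk q • bs K)).subset ?_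
  rintro e ⟨w, hw, rfl⟩
  exact ⟨w, hw, rfl⟩

lemma TT_ends {e : (FreeGroup α ⧸ K) × α} (he : e ∈ TT K ρ) :
    e.1 ∈ UU K ρ ∧ FreeGroup.of e.2 • e.1 ∈ UU K ρ := by
  obtain ⟨w, ⟨a, b⟩, hw, rfl⟩ := he
  have h1 : FreeGroup.mk w • bs K ∈ UU K ρ := ⟨w, by omega, rfl⟩
  have h2 : ell (a, b) • FreeGroup.mk w • bs K ∈ UU K ρ :=
    ⟨(a, b) :: w, by simpa using hw, by rw [ell_mk, mul_smul]⟩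
  generalize FreeGroup.mk w • bs K = v at h1 h2
  cases b
  · simp only [edge, ell, Bool.false_eq_true, if_false, smul_inv_smul] at h2 ⊢
    exact ⟨h2, h1⟩
  · simp only [edge, ell, if_true] at h2 ⊢
    exact ⟨h1, h2⟩

lemma TT_em (h : K ≤ K') {e : (FreeGroup α ⧸ K) × α} (he : e ∈ TT K ρ) : em (qm h) e ∈ TT K' ρ := by
  obtain ⟨w, l, hw, rfl⟩ := he
  exact ⟨w, l, hw, by rw [← edge_em (qm_eqv h), qm_smul_bs]⟩

lemma coc_TT {M : Type} [Group M] {c c' : (FreeGroup α ⧸ K) × α → M} (h : ∀ e ∈ TT K ρ, c e = c' e)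
    {w : List (α × Bool)} (hw : w.length ≤ ρ + 1) :
    coc c (FreeGroup.mk w) (bs K) = coc c' (FreeGroup.mk w) (bs K) := by
  apply coc_mk_congr
  intro w1 l w2 e
  apply h
  refine ⟨w2, l, ?_, rfl⟩
  rw [e] at hw; simp at hw; omega

lemma acoc_TT {ℓ : ℕ} {c c' : (FreeGroup α ⧸ K) × α → ZMod ℓ} (h : ∀ e ∈ TT K ρ, c e = c' e)
    {w : List (α × Bool)} (hw : w.length ≤ ρ + 1) :
    acoc ℓ (FreeGroup.mk w) (bs K) c = acoc ℓ (FreeGroup.mk w) (bs K) c' := by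
  rw [acoc_def, acoc_def, coc_TT _ hw]
  intro e he; rw [h e he]

/-- core vertices with base point -/
def VB (C : Ctx α) (K : Subgroup (FreeGroup α)) : Set (FreeGroup α ⧸ K) := Prod.fst '' C.co K ∪ {bs K}

/-- free edges -/
def Xs (C : Ctx α) (K : Subgroup (FreeGroup α)) (ρ : ℕ) (ε : Set ((FreeGroup α ⧸ K) × α)) :
    Set ((FreeGroup α ⧸ K) × α) := TT K ρ \ (eta C.D '' C.co K ∪ ε)

/-- outer vertices -/
def Ys (C : Ctx α) (K : Subgroup (FreeGroup α)) (ρ : ℕ) : Set (FreeGroup α ⧸ K) := UU K ρ \ VB C K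

/-- a frame -/
structure Fr (C : Ctx α) (K : Subgroup (FreeGroup α)) (ρ : ℕ) (ε : Set ((FreeGroup α ⧸ K) × α)) : Prop where
  y : C.Y K
  hF : ∀ p ∈ Fixd C.D (FreeGroup α ⧸ K), eta C.D p ∈ TT K ρ
  hG : ∀ g ∈ C.G0, ∃ w : List (α × Bool), w.length ≤ ρ + 1 ∧ FreeGroup.mk w = g
  hε : ε ⊆ eta C.D '' (Fixd C.D (FreeGroup α ⧸ K))
  hd : Disjoint ε (eta C.D '' C.co K)
  ex : ∀ (M : Type) [Group M] (c : (FreeGroup α ⧸ K) × α → M),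
        (∀ p ∈ C.co K, hol c C.D p = 1) →
        ∃ c' : (FreeGroup α ⧸ K) × α → M, (∀ e ∉ ε, c' e = c e) ∧
          ∀ p ∈ Fixd C.D (FreeGroup α ⧸ K), hol c' C.D p = 1
  un : ∀ (M : Type) [Group M] (c c' : (FreeGroup α ⧸ K) × α → M),
        (∀ p ∈ Fixd C.D (FreeGroup α ⧸ K), hol c C.D p = 1) →
        (∀ p ∈ Fixd C.D (FreeGroup α ⧸ K), hol c' C.D p = 1) →
        (∀ e ∈ eta C.D '' (Fixd C.D (FreeGroup α ⧸ K)), e ∉ ε → c e = c' e) →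
        ∀ e ∈ ε, c e = c' e

/-- a stable pair -/
structure Pr (C : Ctx α) (K K' : Subgroup (FreeGroup α)) : Prop where
  h : K ≤ K'
  hB : C.co K' = pm C.D (qm h) '' C.co K
  inj : Set.InjOn (qm h) (VB C K)
  he : HE C K (C.co K) = HE C K' (C.co K')

lemma lin_count {k A X Y X' Y' : Type} [Field k] [AddCommGroup A] [Module k A]
    [Finite X] [Finite Y] [Finite X'] [Finite Y'] (S : Submodule k A) (I : A →ₗ[k] (X' → k))
    (hI : ∀ c ∈ S, I c = 0 → c = 0) (Φ : A × (Y → k) →ₗ[k] (X → k) × (Y' → k))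
    (hΦ : ∀ x y, ∃ c ∈ S, ∃ t, Φ (c, t) = (x, y)) :
    Nat.card X + Nat.card Y' ≤ Nat.card X' + Nat.card Y := by
  haveI := Fintype.ofFinite X
  haveI := Fintype.ofFinite Y
  haveI := Fintype.ofFinite X'
  haveI := Fintype.ofFinite Y'
  have hinj : Function.Injective (I ∘ₗ S.subtype) := by
    rw [← LinearMap.ker_eq_bot, LinearMap.ker_eq_bot']
    intro c hc
    exact Subtype.ext (hI c.1 c.2 hc)
  haveI : Module.Finite k S := Module.Finite.of_injective _ hinj
  have h1 := LinearMap.finrank_le_finrank_of_injective hinj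
  have h2 : Function.Surjective (Φ ∘ₗ (S.subtype.prodMap LinearMap.id)) := by
    rintro ⟨x, y⟩
    obtain ⟨c, hc, t, h⟩ := hΦ x y
    exact ⟨(⟨c, hc⟩, t), h⟩
  have h3 := LinearMap.finrank_le_finrank_of_surjective h2
  rw [Module.finrank_prod, Module.finrank_prod] at h3
  simp only [Module.finrank_fintype_fun_eq_card] at h1 h3
  simp only [Nat.card_eq_fintype_card]
  omega

/-- coboundary map -/
def cobL (ℓ : ℕ) {V : Type} [MulAction (FreeGroup α) V] :
    (V → ZMod ℓ) →ₗ[ZMod ℓ] (V × α → ZMod ℓ) where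
  toFun := ORT.cob
  map_add' := fun f g => by funext e; simp [ORT.cob]; ring
  map_smul' := fun a f => by funext e; simp [ORT.cob]; ring

variable {C : Ctx α} {ε : Set ((FreeGroup α ⧸ K) × α)} {ε' : Set ((FreeGroup α ⧸ K') × α)}

lemma VB_ends {e : (FreeGroup α ⧸ K) × α} (he : e ∈ eta C.D '' C.co K) :
    e.1 ∈ VB C K ∧ FreeGroup.of e.2 • e.1 ∈ VB C K :=
  ⟨Or.inl (ends_mem (core_irr _).sg he).1, Or.inl (ends_mem (core_irr _).sg he).2⟩

lemma Fr.hol_TT (hF : Fr C K ρ ε) {M : Type} [Group M] {c c' : (FreeGroup α ⧸ K) × α → M}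
    (h : ∀ e ∈ TT K ρ, c e = c' e) {p} (hp : p ∈ Fixd C.D (FreeGroup α ⧸ K)) :
    hol c C.D p = hol c' C.D p :=
  hol_congr C.D c c' (fun p hp => Fixd_sig _ hp) (by rintro _ ⟨q, hq, rfl⟩; exact h _ (hF.hF q hq)) hp

lemma Fr.Zs_TT (hF : Fr C K ρ ε) {c c' : (FreeGroup α ⧸ K) × α → ZMod C.ℓ}
    (h : ∀ e ∈ TT K ρ, c e = c' e) (hc : c ∈ Zs C.ℓ (Fixd C.D (FreeGroup α ⧸ K))) :
    c' ∈ Zs C.ℓ (Fixd C.D (FreeGroup α ⧸ K)) := by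
  rw [mem_Zs] at hc ⊢
  intro p hp
  have h1 := ahol_eq_zero.1 (hc p hp)
  rw [ahol_eq_zero, ← h1]
  exact (hF.hol_TT (fun e he => by rw [h e he]) hp).symm

lemma Fr.ev_TT (hF : Fr C K ρ ε) {c c' : (FreeGroup α ⧸ K) × α → ZMod C.ℓ}
    (h : ∀ e ∈ TT K ρ, c e = c' e) : C.ev K c = C.ev K c' := by
  funext ⟨g, hg⟩
  obtain ⟨w, hw, rfl⟩ := hF.hG g hg
  exact acoc_TT h hw

open Classical in
theorem count [Finite α] (hP : Pr C K K') (hF : Fr C K ρ ε) (hF' : Fr C K' ρ ε') :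
    Nat.card (Xs C K ρ ε) + Nat.card (Ys C K' ρ) ≤ Nat.card (Xs C K' ρ ε') + Nat.card (Ys C K ρ) := by
  haveI : Finite (Xs C K ρ ε) := TT_fin.subset Set.diff_subset
  haveI : Finite (Xs C K' ρ ε') := TT_fin.subset Set.diff_subset
  haveI : Finite (Ys C K ρ) := UU_fin.subset Set.diff_subset
  haveI : Finite (Ys C K' ρ) := UU_fin.subset Set.diff_subset
  choose gw hgw using fun w : Ys C K' ρ => w.2.1
  let S : Submodule (ZMod C.ℓ) ((FreeGroup α ⧸ K') × α → ZMod C.ℓ) :=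
    (Zs C.ℓ (Fixd C.D (FreeGroup α ⧸ K'))) ⊓ LinearMap.ker (res C.ℓ (eta C.D '' C.co K')) ⊓
      LinearMap.ker (res C.ℓ (TT K' ρ)ᶜ)
  have hS : ∀ c, c ∈ S ↔ c ∈ Zs C.ℓ (Fixd C.D (FreeGroup α ⧸ K')) ∧
      (∀ e ∈ eta C.D '' C.co K', c e = 0) ∧ (∀ e ∉ TT K' ρ, c e = 0) := by
    intro c
    constructor
    · rintro ⟨⟨h1, h2⟩, h3⟩
      exact ⟨h1, fun e he => congrFun h2 ⟨e, he⟩, fun e he => congrFun h3 ⟨e, he⟩⟩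
    · rintro ⟨h1, h2, h3⟩
      exact ⟨⟨h1, funext fun e => h2 e.1 e.2⟩, funext fun e => h3 e.1 e.2⟩
  let Φ : ((FreeGroup α ⧸ K') × α → ZMod C.ℓ) × (Ys C K ρ → ZMod C.ℓ) →ₗ[ZMod C.ℓ]
      (Xs C K ρ ε → ZMod C.ℓ) × (Ys C K' ρ → ZMod C.ℓ) :=
    ((res C.ℓ (Xs C K ρ ε)) ∘ₗ ((LinearMap.funLeft (ZMod C.ℓ) (ZMod C.ℓ) (em (qm hP.h))) ∘ₗ LinearMap.fst _ _ _
      + (cobL C.ℓ) ∘ₗ (ext0 C.ℓ (Ys C K ρ)) ∘ₗ LinearMap.snd _ _ _)).prod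
      ((LinearMap.pi fun w : Ys C K' ρ => acoc C.ℓ (FreeGroup.mk (gw w)) (bs K')) ∘ₗ LinearMap.fst _ _ _)
  refine lin_count (k := ZMod C.ℓ) S (res C.ℓ (Xs C K' ρ ε')) ?_ Φ ?_
  · intro c hc hX
    obtain ⟨h1, h2, h3⟩ := (hS c).1 hc
    have hX' : ∀ e ∈ Xs C K' ρ ε', c e = 0 := fun e he => congrFun hX ⟨e, he⟩
    have h4 := hF'.un (Multiplicative (ZMod C.ℓ)) (fun e => Multiplicative.ofAdd (c e)) (fun _ => 1)
      (fun p hp => ahol_eq_zero.1 (mem_Zs.1 h1 p hp)) (fun p hp => coc_trivial _ _) (by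
        rintro _ ⟨p, hp, rfl⟩ hne
        by_cases h5 : eta C.D p ∈ eta C.D '' C.co K'
        · rw [h2 _ h5]; rfl
        · rw [hX' _ ⟨hF'.hF p hp, fun h => h.elim h5 hne⟩]; rfl)
    funext e
    by_cases h5 : e ∈ TT K' ρ
    · by_cases h6 : e ∈ eta C.D '' C.co K'
      · exact h2 _ h6
      · by_cases h7 : e ∈ ε'
        · exact h4 e h7
        · exact hX' e ⟨h5, fun h => h.elim h6 h7⟩
    · exact h3 e h5
  · intro x y
    -- step 1
    set c0 := ext0 C.ℓ (Xs C K ρ ε) x with hc0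
    obtain ⟨c1, hc1, hc1h⟩ := hF.ex (Multiplicative (ZMod C.ℓ)) (fun e => Multiplicative.ofAdd (c0 e)) (by
      intro p hp
      rw [hol_congr C.D _ (fun _ => 1) (core_irr _).sg _ hp]
      · exact coc_trivial _ _
      · intro e he
        have : c0 e = 0 := ext0_not _ (fun h => h.2 (Or.inl he))
        rw [this]; rfl)
    set c : (FreeGroup α ⧸ K) × α → ZMod C.ℓ := fun e => Multiplicative.toAdd (c1 e) with hcdef
    have hce : ∀ e ∉ ε, c e = c0 e := fun e he => by simp [hcdef, hc1 e he]
    have hcZ : c ∈ Zs C.ℓ (Fixd C.D (FreeGroup α ⧸ K)) := mem_Zs.2 fun p hp => ahol_eq_zero.2 (hc1h p hp)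
    have hcB : ∀ p ∈ C.co K, c (eta C.D p) = 0 := by
      intro p hp
      rw [hce _ (fun h => Set.disjoint_left.1 hF.hd h ⟨p, hp, rfl⟩)]
      exact ext0_not _ (fun h => h.2 (Or.inl ⟨p, hp, rfl⟩))
    have hcX : ∀ e (he : e ∈ Xs C K ρ ε), c e = x ⟨e, he⟩ := by
      intro e he
      rw [hce _ (fun h => he.2 (Or.inr h))]
      exact ext0_mem _ he
    -- step 2
    have hv : C.ev K c ∈ HE C K (C.co K) := mem_HE.2 ⟨c, hcZ, hcB, rfl⟩
    rw [hP.he] at hv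
    obtain ⟨d1, hd1, hd1B, hd1e⟩ := mem_HE.1 hv
    let tr : ((FreeGroup α ⧸ K') × α → ZMod C.ℓ) → ((FreeGroup α ⧸ K') × α → ZMod C.ℓ) :=
      fun d e => if e ∈ TT K' ρ then d e else 0
    have htr : ∀ d, ∀ e ∈ TT K' ρ, d e = tr d e := fun d e he => by simp [tr, he]
    have htr0 : ∀ d, ∀ e ∉ TT K' ρ, tr d e = 0 := fun d e he => by simp [tr, he]
    have hco' : ∀ e ∈ eta C.D '' C.co K', e ∈ TT K' ρ := by
      rintro _ ⟨p, hp, rfl⟩; exact hF'.hF p (core_sub _ hp)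
    have hd2Z := hF'.Zs_TT (htr d1) hd1
    have hd2e := hF'.ev_TT (htr d1)
    -- step 3
    have hsub := sub_mem (pull_mem hP.h hd2Z) hcZ
    obtain ⟨t, ht0, ht⟩ := hF.y.cob hsub (by rw [map_sub, pull_ev, ← hd2e, hd1e, sub_self])
    have htB : ∀ p ∈ C.co K, ORT.cob t (eta C.D p) = 0 := by
      intro p hp
      have hp' : pm C.D (qm hP.h) p ∈ C.co K' := co_pm _ hp
      rw [← ht]
      simp only [Pi.sub_apply]
      rw [hcB p hp, ← eta_pm (qm_eqv hP.h), ← htr d1 _ (hco' _ ⟨_, hp', rfl⟩), hd1B _ hp', sub_zero]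
    -- step 4
    let s : FreeGroup α ⧸ K' → ZMod C.ℓ := fun v =>
      if h : ∃ u ∈ VB C K, qm hP.h u = v then t h.choose else
      if h : v ∈ Ys C K' ρ then acoc C.ℓ (FreeGroup.mk (gw ⟨v, h⟩)) (bs K') (tr d1) - y ⟨v, h⟩ else 0
    have hs1 : ∀ u ∈ VB C K, s (qm hP.h u) = t u := by
      intro u hu
      have h : ∃ u' ∈ VB C K, qm hP.h u' = qm hP.h u := ⟨u, hu, rfl⟩
      simp only [s]
      rw [dif_pos h]
      congr 1
      exact hP.inj h.choose_spec.1 hu h.choose_spec.2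
    have hVB : ∀ u ∈ VB C K, qm hP.h u ∈ VB C K' := by
      rintro u (⟨p, hp, rfl⟩ | rfl)
      · exact Or.inl ⟨_, co_pm hP.h hp, rfl⟩
      · exact Or.inr rfl
    have hs2 : ∀ w : Ys C K' ρ, s w.1 = acoc C.ℓ (FreeGroup.mk (gw w)) (bs K') (tr d1) - y w := by
      intro w
      simp only [s]
      rw [dif_neg, dif_pos w.2]
      rintro ⟨u, hu, he⟩
      exact w.2.2 (he ▸ hVB u hu)
    have hs0 : s (bs K') = 0 := by
      have := hs1 (bs K) (Or.inr rfl)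
      rw [qm_bs, ht0] at this
      exact this
    have hsB : ∀ e ∈ eta C.D '' C.co K', ORT.cob s e = 0 := by
      rintro _ ⟨p', hp', rfl⟩
      rw [hP.hB] at hp'
      obtain ⟨p, hp, rfl⟩ := hp'
      rw [eta_pm (qm_eqv hP.h), ← htB p hp]
      have h1 := VB_ends (C := C) (K := K) ⟨p, hp, rfl⟩
      simp only [ORT.cob, em]
      rw [← qm_eqv hP.h, hs1 _ h1.1, hs1 _ h1.2]
    have hsZ : ORT.cob s ∈ Zs C.ℓ (Fixd C.D (FreeGroup α ⧸ K')) :=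
      mem_Zs.2 fun p hp => ahol_cob s hp
    refine ⟨tr d1 - tr (ORT.cob s), (hS _).2 ⟨sub_mem hd2Z (hF'.Zs_TT (htr _) hsZ), ?_, ?_⟩,
      fun v => s (qm hP.h v.1) - t v.1, ?_⟩
    · intro e he
      simp only [Pi.sub_apply]
      rw [← htr _ _ (hco' e he), ← htr _ _ (hco' e he), hsB e he]
      obtain ⟨p, hp, rfl⟩ := he
      rw [hd1B p hp, sub_zero]
    · intro e he
      simp only [Pi.sub_apply]
      rw [htr0 _ _ he, htr0 _ _ he, sub_zero]
    · refine Prod.ext ?_ ?_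
      · funext ⟨e, he⟩
        change (tr d1 - tr (ORT.cob s)) (em (qm hP.h) e) +
          ORT.cob (ext0 C.ℓ (Ys C K ρ) fun v => s (qm hP.h v.1) - t v.1) e = x ⟨e, he⟩
        rw [← hcX e he]
        have h1 := TT_ends he.1
        have key : ∀ v ∈ UU K ρ, ext0 C.ℓ (Ys C K ρ) (fun v => s (qm hP.h v.1) - t v.1) v
            = s (qm hP.h v) - t v := by
          intro v hv
          by_cases hvB : v ∈ VB C K
          · rw [ext0_not _ (fun h => h.2 hvB), hs1 v hvB, sub_self]
          · have hvY : v ∈ Ys C K ρ := ⟨hv, hvB⟩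
            rw [ext0_mem _ hvY]
        have h2 := congrFun ht e
        simp only [Pi.sub_apply, ORT.cob] at h2 ⊢
        rw [key _ h1.1, key _ h1.2, ← htr (ORT.cob s) _ (TT_em hP.h he.1)]
        simp only [ORT.cob]
        have h3 : FreeGroup.of (em (qm hP.h) e).2 • (em (qm hP.h) e).1 = qm hP.h (FreeGroup.of e.2 • e.1) :=
          (qm_eqv hP.h _ _).symm
        have h4 : (em (qm hP.h) e).1 = qm hP.h e.1 := rfl
        rw [h3, h4]
        linear_combination h2
      · funext w
        change acoc C.ℓ (FreeGroup.mk (gw w)) (bs K') (tr d1 - tr (ORT.cob s)) = y w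
        have h1 := (hgw w).2
        rw [map_sub, ← acoc_TT (htr (ORT.cob s)) (hgw w).1, acoc_cob, hs0, ← h1, hs2]
        ring

end Cnt

end ORT


set_option linter.all false

namespace ORT

noncomputable section Inj

section fp
variable {A X X1 X2 P : Type} [Group A] [Group P]

/-- maps out of a free product with a free group -/
def FPl (φ : A →* P) (f : X → P) : FP A X →* P := Monoid.Coprod.lift φ (FreeGroup.lift f)

lemma FPl_inl (φ : A →* P) (f : X → P) (a : A) : FPl φ f (Monoid.Coprod.inl a) = φ a := by
  simp [FPl]

lemma FPl_gx (φ : A →* P) (f : X → P) (x : X) : FPl φ f (gx x) = f x := by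
  simp [FPl]

lemma FP_top [Finite X] (R : Subgroup (FP A X)) (h1 : ∀ a, Monoid.Coprod.inl a ∈ R) (h2 : ∀ x, gx x ∈ R) (g : FP A X) :
    g ∈ R := by
  classical
  haveI := Fintype.ofFinite X
  obtain ⟨w, rfl⟩ := wval_surj g
  rw [wval]
  apply Subgroup.list_prod_mem
  intro x hx
  obtain ⟨l, _, rfl⟩ := List.mem_map.1 hx
  rcases l with a | ⟨j, b⟩
  · exact h1 a
  · cases b
    · exact inv_mem (h2 j)
    · exact h2 j

lemma rel_hopf2 [Finite X1] [Finite X2] (hc : Nat.card X1 ≤ Nat.card X2) (Ψ : FP A X1 →* FP A X2)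
    (hΨ : ∀ a, Ψ (Monoid.Coprod.inl a) = Monoid.Coprod.inl a) (hs : Function.Surjective Ψ) :
    Function.Injective Ψ := by
  classical
  haveI := Fintype.ofFinite X1
  haveI := Fintype.ofFinite X2
  rw [Nat.card_eq_fintype_card, Nat.card_eq_fintype_card] at hc
  obtain ⟨i⟩ := Function.Embedding.nonempty_of_card_le hc
  let rt : FP A X2 →* FP A X1 := FPl Monoid.Coprod.inl
    (fun y => if h : ∃ x, i x = y then gx h.choose else 1)
  have hrt : ∀ x, rt (gx (i x)) = gx x := by
    intro x
    have h : ∃ x', i x' = i x := ⟨x, rfl⟩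
    rw [FPl_gx, dif_pos h]
    congr 2
    exact i.injective h.choose_spec
  have hrs : Function.Surjective rt := by
    intro g
    exact FP_top rt.range (fun a => ⟨_, FPl_inl _ _ a⟩) (fun x => ⟨_, hrt x⟩) g
  have := rel_hopf (rt.comp Ψ) (fun a => by rw [MonoidHom.comp_apply, hΨ, FPl_inl]) (hrs.comp hs)
  exact Function.Injective.of_comp this

end fp

variable {α : Type} {K K' : Subgroup (FreeGroup α)} {ρ : ℕ}
variable {C : Ctx α} {ε : Set ((FreeGroup α ⧸ K) × α)} {ε' : Set ((FreeGroup α ⧸ K') × α)}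

lemma Fr.agree (hF : Fr C K ρ ε) {M : Type} [Group M] {c c' : (FreeGroup α ⧸ K) × α → M}
    (h1 : ∀ p ∈ Fixd C.D (FreeGroup α ⧸ K), hol c C.D p = 1)
    (h2 : ∀ p ∈ Fixd C.D (FreeGroup α ⧸ K), hol c' C.D p = 1)
    (hB : ∀ e ∈ eta C.D '' C.co K, c e = c' e) (hX : ∀ e ∈ Xs C K ρ ε, c e = c' e) :
    ∀ e ∈ TT K ρ, c e = c' e := by
  have h3 : ∀ e ∈ TT K ρ, e ∉ ε → c e = c' e := by
    intro e he hne
    by_cases h : e ∈ eta C.D '' C.co K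
    · exact hB e h
    · exact hX e ⟨he, fun h' => h'.elim h hne⟩
  intro e he
  by_cases hne : e ∈ ε
  · refine hF.un M c c' h1 h2 ?_ e hne
    rintro _ ⟨p, hp, rfl⟩ h
    exact h3 _ (hF.hF p hp) h
  · exact h3 e he hne

open Classical in
theorem inj_main [Finite α] (hP : Pr C K K') (hF : Fr C K ρ ε) (hF' : Fr C K' ρ ε')
    {A : Type} [Group A] (cA : (FreeGroup α ⧸ K) × α → A)
    (hA : ∀ p ∈ Fixd C.D (FreeGroup α ⧸ K), hol cA C.D p = 1) {w : List (α × Bool)} (hw : w.length ≤ ρ + 1)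
    (hwK : FreeGroup.mk w ∈ K)
    (hwR : FreeGroup.mk w ∈ Subgroup.closure ((K' : Set (FreeGroup α)) ∩ C.cj)) :
    coc cA (FreeGroup.mk w) (bs K) = 1 := by
  haveI : Finite (Xs C K ρ ε) := TT_fin.subset Set.diff_subset
  haveI : Finite (Xs C K' ρ ε') := TT_fin.subset Set.diff_subset
  haveI : Finite (Ys C K ρ) := UU_fin.subset Set.diff_subset
  haveI : Finite (Ys C K' ρ) := UU_fin.subset Set.diff_subset
  choose gw hgw using fun w : Ys C K' ρ => w.2.1
  -- the cocycle on the first graph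
  obtain ⟨c, hce, hch⟩ := hF.ex (FP A (Xs C K ρ ε ⊕ Ys C K' ρ))
    (fun e => if h : e ∈ Xs C K ρ ε then gx (Sum.inl ⟨e, h⟩) else Monoid.Coprod.inl (cA e)) (by
      intro p hp
      rw [hol_congr C.D _ (fun e => Monoid.Coprod.inl (cA e)) (core_irr _).sg _ hp]
      · have := coc_map cA (Monoid.Coprod.inl : A →* FP A (Xs C K ρ ε ⊕ Ys C K' ρ)) (C.D.W p.2 C.D.nL) p.1
        rw [hol, this]
        have h2 : coc cA (C.D.W p.2 C.D.nL) p.1 = 1 := hA p (core_sub _ hp)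
        rw [h2, map_one]
      · intro e he
        rw [dif_neg]
        exact fun h => h.2 (Or.inl he))
  have hcB : ∀ e ∈ eta C.D '' C.co K, c e = Monoid.Coprod.inl (cA e) := by
    intro e he
    rw [hce e (fun h => Set.disjoint_left.1 hF.hd h he), dif_neg]
    exact fun h => h.2 (Or.inl he)
  have hcX : ∀ e (he : e ∈ Xs C K ρ ε), c e = gx (Sum.inl ⟨e, he⟩) := by
    intro e he
    rw [hce e (fun h => he.2 (Or.inr h)), dif_pos he]
  -- the cocycle on the second graph
  have hliftE : ∀ e ∈ eta C.D '' C.co K, ∀ h : (∃ e1 ∈ eta C.D '' C.co K, em (qm hP.h) e1 = em (qm hP.h) e),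
      h.choose = e := by
    intro e he h
    have h1 := h.choose_spec
    refine Prod.ext (hP.inj (VB_ends h1.1).1 (VB_ends he).1 (Prod.ext_iff.1 h1.2).1) (Prod.ext_iff.1 h1.2).2
  have hEB' : ∀ e' ∈ eta C.D '' C.co K', ∃ e ∈ eta C.D '' C.co K, em (qm hP.h) e = e' := by
    rintro _ ⟨p', hp', rfl⟩
    rw [hP.hB] at hp'
    obtain ⟨p, hp, rfl⟩ := hp'
    exact ⟨_, ⟨p, hp, rfl⟩, (eta_pm (qm_eqv hP.h) p).symm⟩
  have hEB : ∀ e ∈ eta C.D '' C.co K, em (qm hP.h) e ∈ eta C.D '' C.co K' := by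
    rintro _ ⟨p, hp, rfl⟩
    exact ⟨_, co_pm hP.h hp, eta_pm (qm_eqv hP.h) p⟩
  let b' : (FreeGroup α ⧸ K') × α → FP A (Xs C K' ρ ε' ⊕ Ys C K ρ) := fun e =>
    if h : ∃ e1 ∈ eta C.D '' C.co K, em (qm hP.h) e1 = e then Monoid.Coprod.inl (cA h.choose) else
    if h : e ∈ Xs C K' ρ ε' then gx (Sum.inl ⟨e, h⟩) else 1
  have hb'1 : ∀ e ∈ eta C.D '' C.co K, b' (em (qm hP.h) e) = Monoid.Coprod.inl (cA e) := by
    intro e he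
    have h : ∃ e1 ∈ eta C.D '' C.co K, em (qm hP.h) e1 = em (qm hP.h) e := ⟨e, he, rfl⟩
    simp only [b']
    rw [dif_pos h, hliftE e he h]
  have hb'2 : ∀ e (he : e ∈ Xs C K' ρ ε'), b' e = gx (Sum.inl ⟨e, he⟩) := by
    intro e he
    simp only [b']
    rw [dif_neg, dif_pos he]
    rintro ⟨e1, he1, rfl⟩
    exact he.2 (Or.inl (hEB e1 he1))
  have hb'3 : ∀ e, e ∉ TT K' ρ → b' e = 1 := by
    intro e he
    simp only [b']
    rw [dif_neg, dif_neg]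
    · exact fun h => he h.1
    · rintro ⟨e1, he1, rfl⟩
      obtain ⟨p', hp', hpe⟩ := hEB e1 he1
      rw [← hpe] at he
      exact he (hF'.hF p' (core_sub _ hp'))
  obtain ⟨c', hce', hch'⟩ := hF'.ex (FP A (Xs C K' ρ ε' ⊕ Ys C K ρ)) b' (by
      intro p' hp'
      rw [hP.hB] at hp'
      obtain ⟨p, hp, rfl⟩ := hp'
      rw [← hol_em (qm_eqv hP.h),
        hol_congr C.D _ (fun e => Monoid.Coprod.inl (cA e)) (core_irr _).sg _ hp]
      · have := coc_map cA (Monoid.Coprod.inl : A →* FP A (Xs C K' ρ ε' ⊕ Ys C K ρ)) (C.D.W p.2 C.D.nL) p.1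
        rw [hol, this]
        have h2 : coc cA (C.D.W p.2 C.D.nL) p.1 = 1 := hA p (core_sub _ hp)
        rw [h2, map_one]
      · intro e he
        exact hb'1 e he)
  have hcB' : ∀ e ∈ eta C.D '' C.co K, c' (em (qm hP.h) e) = Monoid.Coprod.inl (cA e) := by
    intro e he
    rw [hce' _ (fun h => Set.disjoint_left.1 hF'.hd h (hEB e he)), hb'1 e he]
  have hcX' : ∀ e (he : e ∈ Xs C K' ρ ε'), c' e = gx (Sum.inl ⟨e, he⟩) := by
    intro e he
    rw [hce' e (fun h => he.2 (Or.inr h)), hb'2 e he]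
  have hcT' : ∀ e ∉ TT K' ρ, c' e = 1 := by
    intro e he
    rw [hce' _ (fun h => he _), hb'3 e he]
    intro h
    obtain ⟨p, hp, rfl⟩ := hF'.hε h
    exact hF'.hF p hp
  -- gauge and comparison map
  let τ : FreeGroup α ⧸ K → FP A (Xs C K' ρ ε' ⊕ Ys C K ρ) := fun v =>
    if h : v ∈ Ys C K ρ then gx (Sum.inr ⟨v, h⟩) else 1
  have hτ1 : ∀ v ∈ VB C K, τ v = 1 := by
    intro v hv
    simp only [τ]
    rw [dif_neg]
    exact fun h => h.2 hv
  have hτ2 : ∀ v (hv : v ∈ Ys C K ρ), τ v = gx (Sum.inr ⟨v, hv⟩) := by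
    intro v hv
    simp only [τ]
    rw [dif_pos hv]
  have hτ0 : τ (bs K) = 1 := hτ1 _ (Or.inr rfl)
  let c2 : (FreeGroup α ⧸ K) × α → FP A (Xs C K' ρ ε' ⊕ Ys C K ρ) := fun e =>
    τ (FreeGroup.of e.2 • e.1) * c' (em (qm hP.h) e) * (τ e.1)⁻¹
  let Ψ : FP A (Xs C K ρ ε ⊕ Ys C K' ρ) →* FP A (Xs C K' ρ ε' ⊕ Ys C K ρ) :=
    FPl Monoid.Coprod.inl (Sum.elim (fun e => c2 e.1) (fun w => coc c' (FreeGroup.mk (gw w)) (bs K')))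
  have hc2 : ∀ g x, coc c2 g x = τ (g • x) * coc c' g (qm hP.h x) * (τ x)⁻¹ := by
    intro g x
    have := coc_gauge (fun e => c' (em (qm hP.h) e)) τ g x
    rw [coc_em (qm_eqv hP.h)] at this
    exact this
  have hag : ∀ e ∈ TT K ρ, Ψ (c e) = c2 e := by
    refine hF.agree ?_ ?_ ?_ ?_
    · intro p hp
      have := coc_map c Ψ (C.D.W p.2 C.D.nL) p.1
      rw [hol, this]
      have h2 : coc c (C.D.W p.2 C.D.nL) p.1 = 1 := hch p hp
      rw [h2, map_one]
    · intro p hp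
      rw [hol, hc2, (mem_Fixd _ _).1 hp]
      have h2 : coc c' (C.D.W p.2 C.D.nL) (qm hP.h p.1) = 1 := hch' _ (Fixd_pm (qm_eqv hP.h) hp)
      rw [h2]; simp
    · intro e he
      have h1 := VB_ends he
      simp only [c2]
      rw [hcB e he, FPl_inl, hτ1 _ h1.1, hτ1 _ h1.2, hcB' e he]
      simp
    · intro e he
      rw [hcX e he, FPl_gx]
      rfl
  have hΨ : ∀ w : List (α × Bool), w.length ≤ ρ + 1 → Ψ (coc c (FreeGroup.mk w) (bs K)) =
      τ (FreeGroup.mk w • bs K) * coc c' (FreeGroup.mk w) (bs K') := by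
    intro w hw
    rw [← coc_map, coc_TT hag hw, hc2, hτ0, qm_bs]
    simp
  -- surjectivity
  have hrK : ∀ k ∈ K', coc c' k (bs K') ∈ Ψ.range := by
    intro k hk
    have : ∀ k ∈ Subgroup.closure (C.G0 ∪ ((K' : Set (FreeGroup α)) ∩ C.cj)),
        k • bs K' = bs K' ∧ coc c' k (bs K') ∈ Ψ.range := by
      intro k hk
      induction hk using Subgroup.closure_induction with
      | mem g hg =>
        rcases hg with hg | hg
        · refine ⟨smul_bs_eq.2 (hF'.y.g0 g hg), ?_⟩
          obtain ⟨w, hw, rfl⟩ := hF.hG g hg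
          refine ⟨_, (hΨ w hw).trans ?_⟩
          rw [smul_bs_eq.2 (hF.y.g0 _ hg), hτ0, one_mul]
        · refine ⟨smul_bs_eq.2 hg.1, ?_⟩
          rw [coc_cj c' hch' hg.1 hg.2]
          exact one_mem _
      | one => simp
      | mul a b _ _ ha hb =>
        rw [mul_smul, coc_mul, hb.1, ha.1]
        exact ⟨rfl, mul_mem ha.2 hb.2⟩
      | inv a _ ha =>
        have h1 : a⁻¹ • bs K' = bs K' := by rw [inv_smul_eq_iff, ha.1]
        rw [coc_inv, h1]
        exact ⟨rfl, inv_mem ha.2⟩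
    exact (this k (hF'.y.cl hk)).2
  have hrU : ∀ u ∈ UU K' ρ, ∃ g : FreeGroup α, g • bs K' = u ∧ coc c' g (bs K') ∈ Ψ.range := by
    intro u hu
    by_cases huB : u ∈ VB C K'
    · obtain ⟨v, hv, hvU, rfl⟩ : ∃ v ∈ VB C K, v ∈ UU K ρ ∧ qm hP.h v = u := by
        rcases huB with ⟨p', hp', rfl⟩ | rfl
        · rw [hP.hB] at hp'
          obtain ⟨p, hp, rfl⟩ := hp'
          refine ⟨p.1, Or.inl ⟨p, hp, rfl⟩, ?_, rfl⟩
          have h1 := TT_ends (hF.hF p (core_sub _ hp))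
          rw [← tgtP_fst, ← srcP_fst] at h1
          rw [srcP, tgtP] at h1
          split_ifs at h1
          · exact h1.1
          · exact h1.2
        · exact ⟨bs K, Or.inr rfl, ⟨[], by simp, by rw [← FreeGroup.one_eq_mk, one_smul]⟩, qm_bs _⟩
      obtain ⟨w, hw, rfl⟩ := hvU
      refine ⟨FreeGroup.mk w, (qm_smul_bs _ _).symm, _, (hΨ w hw).trans ?_⟩
      rw [hτ1 _ hv, one_mul]
    · have huY : u ∈ Ys C K' ρ := ⟨hu, huB⟩
      refine ⟨FreeGroup.mk (gw ⟨u, huY⟩), (hgw ⟨u, huY⟩).2.symm, gx (Sum.inr ⟨u, huY⟩), ?_⟩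
      rw [FPl_gx]; rfl
  have hrT : ∀ e, c' e ∈ Ψ.range := by
    intro e
    by_cases he : e ∈ TT K' ρ
    · have h1 := TT_ends he
      obtain ⟨g, hg, hg'⟩ := hrU _ h1.1
      obtain ⟨g2, hg2, hg2'⟩ := hrU _ h1.2
      have h3 : g2⁻¹ * FreeGroup.of e.2 * g ∈ K' := by
        rw [← smul_bs_eq, mul_smul, mul_smul, hg, inv_smul_eq_iff, hg2]
      have h4 := hrK _ h3
      rw [coc_mul, coc_mul, hg, coc_of, ← hg2, coc_inv, inv_smul_smul] at h4
      have h5 := mul_mem (mul_mem hg2' h4) (inv_mem hg')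
      have h6 : coc c' g2 (bs K') * ((coc c' g2 (bs K'))⁻¹ * c' (e.1, e.2) * coc c' g (bs K')) *
          (coc c' g (bs K'))⁻¹ = c' e := by group
      rwa [h6] at h5
    · rw [hcT' e he]; exact one_mem _
  have hrC : ∀ g x, coc c' g x ∈ Ψ.range := by
    intro g
    induction g using FreeGroup.induction_on with
    | C1 => intro x; rw [coc_one]; exact one_mem _
    | of a => intro x; rw [coc_of]; exact hrT _
    | inv_of a h => intro x; rw [coc_inv]; exact inv_mem (h _)
    | mul a b ha hb => intro x; rw [coc_mul]; exact mul_mem (ha _) (hb _)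
  have hsurj : Function.Surjective Ψ := by
    intro g
    refine FP_top Ψ.range (fun a => ⟨_, FPl_inl _ _ a⟩) ?_ g
    rintro (⟨e, he⟩ | ⟨v, hv⟩)
    · rw [← hcX' e he]; exact hrT e
    · rw [← hτ2 v hv]
      obtain ⟨w, hw, rfl⟩ := hv.1
      have h1 : Ψ (coc c (FreeGroup.mk w) (bs K)) ∈ Ψ.range := ⟨_, rfl⟩
      rw [hΨ w hw] at h1
      exact (Subgroup.mul_mem_cancel_right _ (hrC _ _)).1 h1
  have hinj : Function.Injective Ψ := by
    apply rel_hopf2 _ Ψ (fun a => FPl_inl _ _ a) hsurj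
    rw [Nat.card_sum, Nat.card_sum]
    exact count hP hF hF'
  have h1 : coc c (FreeGroup.mk w) (bs K) = 1 := by
    apply hinj
    rw [hΨ w hw, smul_bs_eq.2 hwK, hτ0, one_mul, map_one]
    exact (coc_closure c' (bs K') _ (fun g hg => smul_bs_eq.2 hg.1)
      (fun g hg => coc_cj c' hch' hg.1 hg.2) _ hwR).2
  let φ : FP A (Xs C K ρ ε ⊕ Ys C K' ρ) →* A :=
    FPl (MonoidHom.id A) (Sum.elim (fun e => cA e.1) (fun _ => 1))
  have h2 : ∀ e ∈ TT K ρ, φ (c e) = cA e := by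
    refine hF.agree ?_ hA ?_ ?_
    · intro p hp
      have := coc_map c φ (C.D.W p.2 C.D.nL) p.1
      rw [hol, this]
      have h2 : coc c (C.D.W p.2 C.D.nL) p.1 = 1 := hch p hp
      rw [h2, map_one]
    · intro e he
      rw [hcB e he, FPl_inl]; rfl
    · intro e he
      rw [hcX e he, FPl_gx]; rfl
  rw [← coc_TT h2 hw, coc_map, h1, map_one]

end Inj

end ORT


set_option linter.all false

namespace ORT

noncomputable section Stab

variable {α : Type} {K K' : Subgroup (FreeGroup α)} {ρ ρ' : ℕ} {C : Ctx α}

lemma TT_mono (h : ρ ≤ ρ') : TT K ρ ⊆ TT K ρ' := by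
  rintro e ⟨w, l, hw, rfl⟩
  exact ⟨w, l, hw.trans h, rfl⟩

lemma exists_TT (e : (FreeGroup α ⧸ K) × α) : ∃ ρ, e ∈ TT K ρ := by
  classical
  obtain ⟨x, a⟩ := e
  obtain ⟨g, rfl⟩ := exists_smul_bs x
  exact ⟨g.toWord.length, g.toWord, (a, true), le_rfl, by simp [edge, FreeGroup.mk_toWord]⟩

lemma bound_of_finite {β : Type} {S : Set β} (hS : S.Finite) (P : ℕ → β → Prop)
    (hm : ∀ i j x, i ≤ j → P i x → P j x) (h : ∀ x ∈ S, ∃ i, P i x) : ∃ i, ∀ x ∈ S, P i x := by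
  induction S, hS using Set.Finite.induction_on with
  | empty => exact ⟨0, by simp⟩
  | insert _ _ ih =>
    rename_i a s _ _
    obtain ⟨i, hi⟩ := ih fun x hx => h x (Set.mem_insert_of_mem _ hx)
    obtain ⟨j, hj⟩ := h a (Set.mem_insert _ _)
    refine ⟨max i j, ?_⟩
    rintro x (rfl | hx)
    · exact hm _ _ _ (le_max_right _ _) hj
    · exact hm _ _ _ (le_max_left _ _) (hi x hx)

lemma Ctx.Y.rho (hK : C.Y K) : ∃ ρ, ∀ p ∈ Fixd C.D (FreeGroup α ⧸ K), eta C.D p ∈ TT K ρ :=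
  bound_of_finite (Fixd_finite hK.fg) (fun i p => eta C.D p ∈ TT K i)
    (fun i j x hij hx => TT_mono hij hx) (fun x _ => exists_TT _)

lemma len_bound (C : Ctx α) (S : Set (FreeGroup α)) (hS : S.Finite) : ∃ ρ, ∀ g ∈ S,
    ∃ w : List (α × Bool), w.length ≤ ρ + 1 ∧ FreeGroup.mk w = g := by
  classical
  refine bound_of_finite hS (fun i g => ∃ w : List (α × Bool), w.length ≤ i + 1 ∧ FreeGroup.mk w = g) ?_ ?_
  · rintro i j g hij ⟨w, h1, h2⟩
    exact ⟨w, by omega, h2⟩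
  · intro g _
    exact ⟨g.toWord.length, g.toWord, by omega, FreeGroup.mk_toWord⟩

/-- a homomorphism on `K` as a labelling -/
lemma exists_lab {A : Type} [Group A] (hK : C.Y K) (φ : K →* A)
    (hφ : ∀ k : K, (k : FreeGroup α) ∈ C.cj → φ k = 1) :
    ∃ cA : (FreeGroup α ⧸ K) × α → A, (∀ p ∈ Fixd C.D (FreeGroup α ⧸ K), hol cA C.D p = 1) ∧
      ∀ k : K, coc cA (k : FreeGroup α) (bs K) = φ k := by
  classical
  choose s0 hs0 using fun x : FreeGroup α ⧸ K => exists_smul_bs x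
  let s : FreeGroup α ⧸ K → FreeGroup α := fun x => if x = bs K then 1 else s0 x
  have hs : ∀ x, s x • bs K = x := by
    intro x
    by_cases h : x = bs K
    · simp [s, h]
    · simp only [s, h, if_false]; exact hs0 x
  have hs1 : s (bs K) = 1 := by simp [s]
  have hm : ∀ (g : FreeGroup α) x, (s (g • x))⁻¹ * g * s x ∈ K := by
    intro g x
    rw [← smul_bs_eq, mul_smul, mul_smul, hs, inv_smul_eq_iff, hs]
  let cA : (FreeGroup α ⧸ K) × α → A := fun e => φ ⟨_, hm (FreeGroup.of e.2) e.1⟩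
  have hc : ∀ g x, φ ⟨_, hm g x⟩ = coc cA g x := by
    intro g
    refine coc_unique cA (fun g x => φ ⟨_, hm g x⟩) ?_ ?_ g
    · intro g h x
      rw [← map_mul]
      congr 1
      apply Subtype.ext
      simp only [Subgroup.coe_mul, mul_smul]
      group
    · intro a x; rfl
  refine ⟨cA, ?_, ?_⟩
  · intro p hp
    rw [hol, ← hc]
    apply hφ
    have hfix : C.D.W p.2 C.D.nL • p.1 = p.1 := by
      have : (sig C.D ^ C.D.nL) p = p := hp
      rw [sig_pow] at this
      exact (Prod.ext_iff.1 this).1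
    refine ⟨(s p.1)⁻¹ * C.D.W 0 p.2.val, ?_⟩
    simp only [hfix]
    have := W_conj C.D p.2 C.D.n
    change C.D.W p.2 C.D.nL = _ * C.D.W 0 C.D.nL * _ at this
    rw [this]
    group
  · intro k
    rw [← hc]
    congr 1
    apply Subtype.ext
    have : (k : FreeGroup α) • bs K = bs K := smul_bs_eq.2 k.2
    simp [this, hs1]

/-- relator subgroup -/
def Ctx.R (C : Ctx α) (K : Subgroup (FreeGroup α)) : Subgroup (FreeGroup α) :=
  Subgroup.closure ((K : Set (FreeGroup α)) ∩ C.cj)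

lemma R_le : C.R K ≤ K := by
  rw [Ctx.R, Subgroup.closure_le]; exact Set.inter_subset_left

lemma cj_conj {h : FreeGroup α} (hh : h ∈ C.cj) (g : FreeGroup α) : g * h * g⁻¹ ∈ C.cj := by
  obtain ⟨u, rfl⟩ := hh
  exact ⟨g * u, by group⟩

lemma R_conj {h : FreeGroup α} (hh : h ∈ C.R K) {g : FreeGroup α} (hg : g ∈ K) : g * h * g⁻¹ ∈ C.R K := by
  induction hh using Subgroup.closure_induction with
  | mem x hx => exact Subgroup.subset_closure ⟨mul_mem (mul_mem hg hx.1) (inv_mem hg), cj_conj hx.2 g⟩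
  | one => simp
  | mul a b _ _ ha hb =>
    have := mul_mem ha hb
    convert this using 1; group
  | inv a _ ha =>
    have := inv_mem ha
    convert this using 1; group

instance R_normal : ((C.R K).subgroupOf K).Normal where
  conj_mem := by
    intro n hn g
    rw [Subgroup.mem_subgroupOf] at hn ⊢
    exact R_conj hn g.2

lemma R_mono (h : K ≤ K') : C.R K ≤ C.R K' :=
  Subgroup.closure_mono (Set.inter_subset_inter_left _ h)

lemma limR (hK : C.Y K) {k : FreeGroup α} (hk : k ∈ Subgroup.closure C.cj) :
    ∃ K', C.Y K' ∧ K ≤ K' ∧ k ∈ C.R K' := by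
  induction hk using Subgroup.closure_induction generalizing K with
  | mem x hx =>
    obtain ⟨K', h1, h2, h3⟩ := hK.adj hx
    exact ⟨K', h1, h2, Subgroup.subset_closure ⟨h3, hx⟩⟩
  | one => exact ⟨K, hK, le_rfl, one_mem _⟩
  | mul a b _ _ ha hb =>
    obtain ⟨K1, h1, h2, h3⟩ := ha hK
    obtain ⟨K2, h4, h5, h6⟩ := hb h1
    exact ⟨K2, h4, h2.trans h5, mul_mem (R_mono h5 h3) h6⟩
  | inv a _ ha =>
    obtain ⟨K1, h1, h2, h3⟩ := ha hK
    exact ⟨K1, h1, h2, inv_mem h3⟩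

theorem stable [Finite α] (C : Ctx α) :
    ∃ K, C.Y K ∧ ∀ k ∈ K, k ∈ Subgroup.closure C.cj → k ∈ C.R K := by
  obtain ⟨K, hK, B, hB⟩ := limit C
  refine ⟨K, hK, fun k hk hkc => ?_⟩
  obtain ⟨K', hK', hKK, hkR⟩ := limR hK hkc
  have hP : Pr C K K' := by
    obtain ⟨b1, b2, b3⟩ := hB K hK le_rfl
    obtain ⟨c1, c2, c3⟩ := hB K' hK' hKK
    refine ⟨hKK, ?_, ?_, c3.symm⟩
    · apply Set.Subset.antisymm
      · intro p' hp'
        have h1 : pm C.D (qm hK'.leH) p' ∈ pm C.D (qm hK.leH) '' C.co K := by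
          rw [b1, ← c1]; exact ⟨p', hp', rfl⟩
        obtain ⟨p, hp, hpp⟩ := h1
        refine ⟨p, hp, ?_⟩
        have h2 := co_pm hKK hp
        apply Prod.ext
        · apply c2 (Or.inl ⟨_, h2, rfl⟩) (Or.inl ⟨_, hp', rfl⟩)
          have := (Prod.ext_iff.1 hpp).1
          simp only [pm] at this ⊢
          rw [qm_qm]; exact this
        · exact (Prod.ext_iff.1 hpp).2
      · rintro _ ⟨p, hp, rfl⟩
        exact co_pm hKK hp
    · intro x hx y hy hxy
      apply b2 hx hy
      rw [← qm_qm hKK hK'.leH, hxy, qm_qm]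
  obtain ⟨ε, e1, e2, e3, e4⟩ := hK.collapse
  obtain ⟨ε', e1', e2', e3', e4'⟩ := hK'.collapse
  obtain ⟨ρ1, h1⟩ := hK.rho
  obtain ⟨ρ2, h2⟩ := hK'.rho
  obtain ⟨ρ3, h3⟩ := len_bound C (insert k (C.G0 : Set (FreeGroup α))) (C.G0.finite_toSet.insert k)
  let ρ := ρ1 + ρ2 + ρ3
  have h3' : ∀ g ∈ insert k (C.G0 : Set (FreeGroup α)), ∃ w : List (α × Bool), w.length ≤ ρ + 1 ∧ FreeGroup.mk w = g := by
    intro g hg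
    obtain ⟨w, hw, hw'⟩ := h3 g hg
    exact ⟨w, by omega, hw'⟩
  have hF : Fr C K ρ ε := ⟨hK, fun p hp => TT_mono (by omega) (h1 p hp),
    fun g hg => h3' g (Or.inr hg), e1, e2, e3, e4⟩
  have hF' : Fr C K' ρ ε' := ⟨hK', fun p hp => TT_mono (by omega) (h2 p hp),
    fun g hg => h3' g (Or.inr hg), e1', e2', e3', e4'⟩
  obtain ⟨w, hw, rfl⟩ := h3' k (Or.inl rfl)
  obtain ⟨cA, hA1, hA2⟩ := exists_lab hK (QuotientGroup.mk' ((C.R K).subgroupOf K)) (by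
    intro k hk
    rw [QuotientGroup.mk'_apply, QuotientGroup.eq_one_iff, Subgroup.mem_subgroupOf]
    exact Subgroup.subset_closure ⟨k.2, hk⟩)
  have := inj_main hP hF hF' cA hA1 hw hk hkR
  rw [hA2 ⟨_, hk⟩, QuotientGroup.mk'_apply, QuotientGroup.eq_one_iff, Subgroup.mem_subgroupOf] at this
  exact this

end Stab

end ORT


set_option linter.all false

namespace ORT

noncomputable section Mag

variable {α : Type} [DecidableEq α] {A : Type} [CommRing A]

lemma pa_inv {X : Type} (s : Equiv.Perm X) (x : X) : s (s⁻¹ x) = x := by simp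

lemma pinv_a {X : Type} (s : Equiv.Perm X) (x : X) : s⁻¹ (s x) = x := by simp

/-- multiplication by `1 + X_a` on power series -/
def tf (a : α) (f : List α → A) : List α → A
  | [] => f []
  | b :: v => f (b :: v) + if b = a then f v else 0

/-- inverse of `tf` -/
def ti (a : α) (f : List α → A) : List α → A
  | [] => f []
  | b :: v => f (b :: v) - if b = a then ti a f v else 0

/-- the permutation -/
def Tm (A : Type) [CommRing A] (a : α) : Equiv.Perm (List α → A) where
  toFun := tf a
  invFun := ti a
  left_inv := by
    intro f; funext v
    induction v with
    | nil => rfl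
    | cons b v ih => simp [tf, ti, ih]
  right_inv := by
    intro f; funext v
    cases v with
    | nil => rfl
    | cons b v => simp [tf, ti]

@[simp] lemma Tm_nil (a : α) (f : List α → A) : Tm A a f [] = f [] := rfl
lemma Tm_cons (a b : α) (v) (f : List α → A) : Tm A a f (b :: v) = f (b :: v) + if b = a then f v else 0 := rfl

/-- Magnus representation -/
def rho (A : Type) [CommRing A] : FreeGroup α →* Equiv.Perm (List α → A) := FreeGroup.lift (Tm A)

lemma rho_ind (P : Equiv.Perm (List α → A) → Prop) (h1 : P 1) (hm : ∀ s t, P s → P t → P (s * t))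
    (hi : ∀ s, P s → P s⁻¹) (hT : ∀ a, P (Tm A a)) (g : FreeGroup α) : P (rho A g) := by
  induction g using FreeGroup.induction_on with
  | C1 => simpa using h1
  | of a => simpa [rho] using hT a
  | inv_of a h => rw [map_inv]; exact hi _ h
  | mul a b ha hb => rw [map_mul]; exact hm _ _ ha hb

lemma rho_nil (g : FreeGroup α) (f : List α → A) : rho A g f [] = f [] := by
  revert f
  refine rho_ind (fun s => ∀ f, s f [] = f []) ?_ ?_ ?_ ?_ g
  · simp
  · intro s t hs ht f; rw [Equiv.Perm.mul_apply, hs, ht]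
  · intro s hs f; rw [← hs (s⁻¹ f), pa_inv]
  · intro a f; rfl

lemma rho_add (g : FreeGroup α) (f f' : List α → A) : rho A g (f + f') = rho A g f + rho A g f' := by
  revert f f'
  refine rho_ind (fun s => ∀ f f', s (f + f') = s f + s f') ?_ ?_ ?_ ?_ g
  · simp
  · intro s t hs ht f f'; simp only [Equiv.Perm.mul_apply]; rw [ht, hs]
  · intro s hs f f'; rw [Equiv.Perm.inv_eq_iff_eq, hs]; simp
  · intro a f f'; funext v
    cases v with
    | nil => simp
    | cons b v => simp only [Pi.add_apply, Tm_cons]; split_ifs <;> ring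

lemma rho_smul (g : FreeGroup α) (c : A) (f : List α → A) : rho A g (c • f) = c • rho A g f := by
  revert f
  refine rho_ind (fun s => ∀ f, s (c • f) = c • s f) ?_ ?_ ?_ ?_ g
  · simp
  · intro s t hs ht f; simp only [Equiv.Perm.mul_apply]; rw [ht, hs]
  · intro s hs f; rw [Equiv.Perm.inv_eq_iff_eq, hs]; simp
  · intro a f; funext v
    cases v with
    | nil => simp
    | cons b v => simp only [Pi.smul_apply, Tm_cons, smul_eq_mul]; split_ifs <;> ring

lemma rho_loc (d : ℕ) (g : FreeGroup α) (f f' : List α → A) :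
    (∀ v, v.length ≤ d → f v = f' v) ↔ (∀ v, v.length ≤ d → rho A g f v = rho A g f' v) := by
  revert f f'
  refine rho_ind (fun s : Equiv.Perm (List α → A) => ∀ f f', (∀ v : List α, v.length ≤ d → f v = f' v) ↔
    (∀ v, v.length ≤ d → s f v = s f' v)) ?_ ?_ ?_ ?_ g
  · simp
  · intro s t hs ht f f'; simp only [Equiv.Perm.mul_apply]; rw [ht, hs]
  · intro s hs f f'; rw [hs (s⁻¹ f)]; simp
  · intro a f f'
    constructor
    · intro h v hv
      cases v with
      | nil => exact h _ hv
      | cons b v =>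
        rw [Tm_cons, Tm_cons, h _ hv, h v (by simp at hv; omega)]
    · intro h v
      induction v with
      | nil => intro hv; exact h _ hv
      | cons b v ih =>
        intro hv
        have h1 := h _ hv
        rw [Tm_cons, Tm_cons, ih (by simp at hv; omega)] at h1
        exact add_right_cancel h1

lemma rho_shift (g : FreeGroup α) (f : List α → A) (h0 : f [] = 0) (b : α) (v : List α) :
    rho A g f (v ++ [b]) = rho A g (fun u => f (u ++ [b])) v := by
  have := rho_ind (fun s => (∀ f, s f [] = f []) ∧ ∀ f : List α → A, f [] = 0 →
    (fun v => s f (v ++ [b])) = s (fun u => f (u ++ [b]))) ?_ ?_ ?_ ?_ g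
  · exact congrFun (this.2 f h0) v
  · simp
  · intro s t hs ht
    refine ⟨fun f => by rw [Equiv.Perm.mul_apply, hs.1, ht.1], fun f hf => ?_⟩
    simp only [Equiv.Perm.mul_apply]
    rw [hs.2 _ (by rw [ht.1, hf]), ht.2 _ hf]
  · intro s hs
    have h1 : ∀ f, s⁻¹ f [] = f [] := fun f => by rw [← hs.1 (s⁻¹ f), pa_inv]
    refine ⟨h1, fun f hf => ?_⟩
    rw [eq_comm, Equiv.Perm.inv_eq_iff_eq, ← hs.2 _ (by rw [h1, hf])]
    simp
  · intro a
    refine ⟨fun f => rfl, fun f hf => ?_⟩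
    funext v
    cases v with
    | nil => simp [Tm_cons, hf]
    | cons c v => simp [Tm_cons]

lemma rho_cast (M : ℕ) (g : FreeGroup α) (f : List α → ℤ) :
    rho (ZMod M) g (fun v => (f v : ZMod M)) = fun v => ((rho ℤ g f v : ℤ) : ZMod M) := by
  induction g using FreeGroup.induction_on generalizing f with
  | C1 => simp
  | of a =>
    simp only [rho, FreeGroup.lift_apply_of]
    funext v
    cases v with
    | nil => rfl
    | cons b v => simp only [Tm_cons]; split_ifs <;> simp
  | inv_of a h =>
    rw [map_inv, map_inv, Equiv.Perm.inv_eq_iff_eq, h]; simp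
  | mul a b ha hb => simp only [map_mul, Equiv.Perm.mul_apply]; rw [hb, ha]

/-- auxiliary shift -/
def nx (a : α) (f : List α → ℤ) : List α → ℤ
  | [] => 0
  | b :: u => if b = a then f u else 0

lemma Tm_nx (a : α) (f : List α → ℤ) (v : List α) :
    rho ℤ (FreeGroup.of a) f v = f v + nx a f v := by
  simp only [rho, FreeGroup.lift_apply_of]
  cases v with
  | nil => simp [nx]
  | cons b u => rw [Tm_cons, nx]

lemma nx_zero (a : α) (f : List α → ℤ) (u : List α) (h : (a :: u).IsChain (· ≠ ·)) : nx a f u = 0 := by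
  cases u with
  | nil => rfl
  | cons c u =>
    simp only [List.isChain_cons_cons] at h
    simp [nx, Ne.symm h.1]

lemma Tm_zpow (a : α) (e : ℤ) (f : List α → ℤ) (v : List α) (hv : v.IsChain (· ≠ ·)) :
    rho ℤ (FreeGroup.of a ^ e) f v = f v + e * nx a f v := by
  have hs : ∀ e : ℤ, ∀ v, rho ℤ (FreeGroup.of a ^ (e + 1)) f v
      = rho ℤ (FreeGroup.of a ^ e) f v + nx a (rho ℤ (FreeGroup.of a ^ e) f) v := by
    intro e v
    rw [add_comm e, zpow_add, zpow_one, map_mul, Equiv.Perm.mul_apply, Tm_nx]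
  -- on the tail of a stutter-free word starting with `a` nothing changes
  have ht : ∀ e : ℤ, (∀ v : List α, v.IsChain (· ≠ ·) → rho ℤ (FreeGroup.of a ^ e) f v = f v + e * nx a f v) →
      ∀ v : List α, v.IsChain (· ≠ ·) → nx a (rho ℤ (FreeGroup.of a ^ e) f) v = nx a f v := by
    intro e he v hv
    cases v with
    | nil => rfl
    | cons b u =>
      by_cases hb : b = a
      · subst hb
        simp only [nx, if_true]
        rw [he u hv.tail, nx_zero _ _ _ hv]; simp
      · simp [nx, hb]
  induction e using Int.induction_on generalizing v with
  | zero => simp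
  | succ i ih =>
    rw [hs, ih v hv, ht _ (fun v hv => ih v hv) v hv]
    ring
  | pred i ih =>
    have hpt : ∀ v : List α, v.IsChain (· ≠ ·) → rho ℤ (FreeGroup.of a ^ (-(i:ℤ) - 1)) f v
        = f v + (-(i:ℤ)) * nx a f v - nx a (rho ℤ (FreeGroup.of a ^ (-(i:ℤ) - 1)) f) v := by
      intro v hv
      have h1 := hs (-(i:ℤ) - 1) v
      rw [sub_add_cancel, ih v hv] at h1
      linarith
    rw [hpt v hv]
    have : nx a (rho ℤ (FreeGroup.of a ^ (-(i:ℤ) - 1)) f) v = nx a f v := by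
      cases v with
      | nil => rfl
      | cons b u =>
        by_cases hb : b = a
        · subst hb
          simp only [nx, if_true]
          rw [hpt u hv.tail, nx_zero _ _ _ hv, nx_zero _ _ _ hv]; simp
        · simp [nx, hb]
    rw [this]; ring

/-- value of a syllable list -/
def sval (S : List (α × ℤ)) : FreeGroup α := (S.map fun s => FreeGroup.of s.1 ^ s.2).prod

lemma exists_syll (g : FreeGroup α) : ∃ S : List (α × ℤ), sval S = g ∧ (S.map Prod.fst).IsChain (· ≠ ·) ∧
    ∀ s ∈ S, s.2 ≠ 0 := by
  have key : ∀ (a : α) (e : ℤ) (g : FreeGroup α), e ≠ 0 → (∃ S : List (α × ℤ), sval S = g ∧ (S.map Prod.fst).IsChain (· ≠ ·) ∧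
    ∀ s ∈ S, s.2 ≠ 0) → ∃ S : List (α × ℤ), sval S = FreeGroup.of a ^ e * g ∧ (S.map Prod.fst).IsChain (· ≠ ·) ∧
    ∀ s ∈ S, s.2 ≠ 0 := by
    rintro a e g he ⟨S, rfl, h1, h2⟩
    rcases S with _ | ⟨⟨b, x⟩, S⟩
    · exact ⟨[(a, e)], by simp [sval], by simp, by simpa using he⟩
    · by_cases hb : b = a
      · subst hb
        by_cases hx : e + x = 0
        · refine ⟨S, ?_, h1.tail, fun s hs => h2 s (List.mem_cons_of_mem _ hs)⟩
          simp only [sval, List.map_cons, List.prod_cons]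
          rw [← mul_assoc, ← zpow_add, hx]; simp
        · refine ⟨(b, e + x) :: S, ?_, by simpa using h1, ?_⟩
          · simp only [sval, List.map_cons, List.prod_cons]
            rw [← mul_assoc, ← zpow_add]
          · intro s hs
            rcases List.mem_cons.1 hs with rfl | hs
            · exact hx
            · exact h2 s (List.mem_cons_of_mem _ hs)
      · refine ⟨(a, e) :: (b, x) :: S, by simp [sval], ?_, ?_⟩
        · simp only [List.map_cons, List.isChain_cons_cons] at h1 ⊢
          exact ⟨fun h => hb h.symm, h1⟩
        · intro s hs
          rcases List.mem_cons.1 hs with rfl | hs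
          · exact he
          · exact h2 s hs
  have : ∀ w : List (α × Bool), ∃ S : List (α × ℤ), sval S = FreeGroup.mk w ∧ (S.map Prod.fst).IsChain (· ≠ ·) ∧
    ∀ s ∈ S, s.2 ≠ 0 := by
    intro w
    induction w with
    | nil => exact ⟨[], by simp [sval, FreeGroup.one_eq_mk], by simp, by simp⟩
    | cons l w ih =>
      rcases l with ⟨a, b⟩
      rw [ell_mk]
      cases b
      · have := key a (-1) _ (by norm_num) ih
        simpa [ell] using this
      · have := key a 1 _ (by norm_num) ih
        simpa [ell] using this
  have h := this g.toWord
  rwa [FreeGroup.mk_toWord] at h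

lemma sval_coef (S : List (α × ℤ)) (hS : (S.map Prod.fst).IsChain (· ≠ ·)) :
    (∀ v : List α, v.IsChain (· ≠ ·) → S.length < v.length →
      rho ℤ (sval S) (Pi.single [] 1) v = 0) ∧
    rho ℤ (sval S) (Pi.single [] 1) (S.map Prod.fst) = (S.map Prod.snd).prod := by
  induction S with
  | nil =>
    constructor
    · intro v hv hl
      have : v ≠ [] := by rintro rfl; simp at hl
      simp [sval, this]
    · simp [sval]
  | cons s S ih =>
    obtain ⟨i1, i2⟩ := ih hS.tail
    have e : ∀ v, rho ℤ (sval (s :: S)) (Pi.single [] 1) v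
      = rho ℤ (FreeGroup.of s.1 ^ s.2) (rho ℤ (sval S) (Pi.single [] 1)) v := by
      intro v
      simp only [sval, List.map_cons, List.prod_cons, map_mul, Equiv.Perm.mul_apply]
    constructor
    · intro v hv hl
      rw [e, Tm_zpow _ _ _ _ hv, i1 v hv (by simp at hl; omega)]
      cases v with
      | nil => simp [nx]
      | cons b u =>
        rw [nx, i1 u hv.tail (by simpa using hl)]; simp
    · rw [e, Tm_zpow _ _ _ _ hS, i1 _ hS (by simp)]
      simp [i2, nx]

lemma rho_ne {r : FreeGroup α} (hr : r ≠ 1) : ∃ v : List α, rho ℤ r (Pi.single [] 1) v ≠ (Pi.single [] 1 : List α → ℤ) v := by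
  obtain ⟨S, rfl, h1, h2⟩ := exists_syll r
  have hS : S ≠ [] := by rintro rfl; simp [sval] at hr
  refine ⟨S.map Prod.fst, ?_⟩
  rw [(sval_coef S h1).2, Pi.single_eq_of_ne (by simpa using hS)]
  apply List.prod_ne_zero
  intro h
  obtain ⟨s, hs, h0⟩ := List.mem_map.1 h
  exact h2 s hs h0

theorem exists_quot [Finite α] {r : FreeGroup α} (hr : r ≠ 1) {n : ℕ} (hn : 0 < n) :
    ∃ F0 : Subgroup (FreeGroup α), F0.Normal ∧ F0.FiniteIndex ∧ ∀ k : ℕ, r ^ k ∈ F0 ↔ n ∣ k := by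
  have hex : ∃ d, ∃ (f : List α → ℤ) (v : List α), v.length ≤ d ∧ rho ℤ r f v ≠ f v := by
    obtain ⟨v, hv⟩ := rho_ne hr
    exact ⟨_, _, v, le_rfl, hv⟩
  classical
  let d := Nat.find hex
  have hmin : ∀ (f : List α → ℤ) (v : List α), v.length < d → rho ℤ r f v = f v := by
    intro f v hv
    have := Nat.find_min hex hv
    push Not at this
    exact this f v le_rfl
  let δ : List α → ℤ := Pi.single [] 1
  have hδ : δ [] = 1 := by simp [δ]
  let c : List α → ℤ := fun v => rho ℤ r δ v - δ v
  have h1 : ∀ (f : List α → ℤ) (v : List α), v.length ≤ d → rho ℤ r f v = f v + f [] * c v := by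
    intro f v hv
    let f0 := f + (-f []) • δ
    have hf0 : f0 [] = 0 := by simp [f0, hδ]
    have h2 : rho ℤ r f0 v = f0 v := by
      rcases List.eq_nil_or_concat v with rfl | ⟨u, b, rfl⟩
      · rw [rho_nil]
      · rw [List.concat_eq_append] at hv ⊢
        rw [rho_shift _ _ hf0, hmin]
        simpa using hv
    have h3 : rho ℤ r f0 v = rho ℤ r f v + (-f []) * rho ℤ r δ v := by
      simp only [f0]; rw [rho_add, rho_smul]; rfl
    rw [h3] at h2
    have h4 : f0 v = f v + (-f []) * δ v := rfl
    simp only [c]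
    linarith
  have hk : ∀ (k : ℕ) (f : List α → ℤ) (v : List α), v.length ≤ d → rho ℤ (r ^ k) f v = f v + k * f [] * c v := by
    intro k
    induction k with
    | zero => simp
    | succ k ih =>
      intro f v hv
      rw [pow_succ', map_mul, Equiv.Perm.mul_apply, h1 _ _ hv, ih _ _ hv, rho_nil]
      push_cast; ring
  obtain ⟨v0, hv0, hc0⟩ : ∃ v, v.length ≤ d ∧ c v ≠ 0 := by
    obtain ⟨f, v, hv, h⟩ := Nat.find_spec hex
    refine ⟨v, hv, fun h0 => h ?_⟩
    rw [h1 f v hv, h0]; simp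
  let I : Ideal ℤ := Ideal.span {x | ∃ v : List α, v.length ≤ d ∧ x = c v}
  let g := Submodule.IsPrincipal.generator I
  have hg : ∀ x, x ∈ I ↔ g ∣ x := fun x => Submodule.IsPrincipal.mem_iff_generator_dvd I
  have hcg : ∀ v : List α, v.length ≤ d → g ∣ c v := fun v hv => (hg _).1 (Ideal.subset_span ⟨v, hv, rfl⟩)
  have hg0 : g ≠ 0 := by
    intro h
    have := hcg v0 hv0
    rw [h, zero_dvd_iff] at this
    exact hc0 this
  let M := g.natAbs * n
  haveI : NeZero M := ⟨by simp [M, hg0]; omega⟩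
  have hdvd : ∀ k : ℕ, (∀ v : List α, v.length ≤ d → (M : ℤ) ∣ k * c v) ↔ n ∣ k := by
    intro k
    have hM : ∀ x : ℤ, (M : ℤ) ∣ x ↔ g * n ∣ x := by
      intro x
      rw [← Int.natAbs_dvd_natAbs, ← Int.natAbs_dvd_natAbs]
      rw [Int.natAbs_mul, Int.natAbs_natCast, Int.natAbs_natCast]
    simp only [hM]
    constructor
    · intro h
      have hI : I ≤ Submodule.comap (LinearMap.mulLeft ℤ (k : ℤ)) (Ideal.span {g * (n : ℤ)}) := by
        rw [Ideal.span_le]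
        rintro _ ⟨v, hv, rfl⟩
        change (k : ℤ) * c v ∈ Ideal.span {g * (n : ℤ)}
        rw [Ideal.mem_span_singleton]
        exact h v hv
      have h2 : g * n ∣ k * g := Ideal.mem_span_singleton.1 (hI ((hg g).2 dvd_rfl))
      rw [mul_comm (k : ℤ)] at h2
      exact Int.natCast_dvd_natCast.1 (Int.dvd_of_mul_dvd_mul_left hg0 h2)
    · rintro ⟨q, rfl⟩ v hv
      obtain ⟨y, hy⟩ := hcg v hv
      exact ⟨q * y, by rw [hy]; push_cast; ring⟩
  let F0 : Subgroup (FreeGroup α) :=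
    { carrier := {g | ∀ (f : List α → ZMod M) (v : List α), v.length ≤ d → rho (ZMod M) g f v = f v}
      one_mem' := by intro f v _; simp
      mul_mem' := by
        intro a b ha hb f v hv
        rw [map_mul, Equiv.Perm.mul_apply, ha _ _ hv, hb _ _ hv]
      inv_mem' := by
        intro a ha f v hv
        rw [← ha (rho (ZMod M) a⁻¹ f) _ hv, map_inv, pa_inv] }
  have hF0 : ∀ x, x ∈ F0 ↔ ∀ (f : List α → ZMod M) (v : List α), v.length ≤ d → rho (ZMod M) x f v = f v :=
    fun x => Iff.rfl
  refine ⟨F0, ⟨?_⟩, ?_, ?_⟩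
  · intro a ha h f v hv
    rw [map_mul, map_mul, Equiv.Perm.mul_apply, Equiv.Perm.mul_apply]
    have := (rho_loc d h (rho (ZMod M) a (rho (ZMod M) h⁻¹ f)) (rho (ZMod M) h⁻¹ f)).1
      (fun v hv => ha _ v hv) v hv
    rw [this, map_inv, pa_inv]
  · let X := {v : List α // v.length ≤ d}
    haveI : Finite X := List.finite_length_le α d
    let ext : (X → ZMod M) → List α → ZMod M := fun f v => if h : v.length ≤ d then f ⟨v, h⟩ else 0
    let Θ : FreeGroup α → (X → ZMod M) → (X → ZMod M) := fun g f x => rho (ZMod M) g (ext f) x.1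
    have hΘ : ∀ g g', Θ g = Θ g' → g⁻¹ * g' ∈ F0 := by
      intro g g' h f v hv
      let fr : X → ZMod M := fun x => f x.1
      have e1 : ∀ v, v.length ≤ d → f v = ext fr v := by
        intro v hv; simp [ext, fr, hv]
      have e2 : ∀ v, v.length ≤ d → rho (ZMod M) g' f v = rho (ZMod M) g f v := by
        intro v hv
        rw [(rho_loc d g' _ _).1 e1 v hv, (rho_loc d g _ _).1 e1 v hv]
        exact (congrFun (congrFun h fr) ⟨v, hv⟩).symm
      rw [map_mul, Equiv.Perm.mul_apply, (rho_loc d g⁻¹ _ _).1 e2 v hv, map_inv, pinv_a]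
    haveI : Finite (FreeGroup α ⧸ F0) := by
      refine Finite.of_injective (fun q : FreeGroup α ⧸ F0 => Θ q.out) ?_
      intro a b hab
      have := hΘ _ _ hab
      rw [← QuotientGroup.eq] at this
      simpa using this
    exact Subgroup.finiteIndex_of_finite_quotient
  · intro k
    rw [← hdvd, hF0]
    constructor
    · intro h v hv
      have h2 := h (fun v => (δ v : ZMod M)) v hv
      rw [rho_cast] at h2
      beta_reduce at h2
      rw [hk k _ _ hv, hδ] at h2
      rw [← ZMod.intCast_zmod_eq_zero_iff_dvd]
      push_cast at h2 ⊢
      simpa using h2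
    · intro h f v hv
      have hf : f = fun v => (((f v).val : ℤ) : ZMod M) := by funext v; simp
      rw [hf, rho_cast]
      beta_reduce
      rw [hk k _ _ hv]
      have h3 := (ZMod.intCast_zmod_eq_zero_iff_dvd _ M).2 (h v hv)
      push_cast at h3 ⊢
      rw [mul_right_comm, h3]; simp

end Mag

end ORT


set_option linter.all false

namespace ORT

noncomputable section Fin

open Group

lemma finite_of_fg {X : Type} [h : Group.FG (FreeGroup X)] : Finite X := by
  classical
  obtain ⟨S, hS⟩ := h.out
  let U : Set X := ⋃ g ∈ S, {x | x ∈ (g.toWord.map Prod.fst)}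
  have hU : U.Finite := by
    refine Set.Finite.biUnion S.finite_toSet fun g _ => ?_
    exact List.finite_toSet _
  suffices U = Set.univ by rw [this] at hU; exact Set.finite_univ_iff.1 hU
  by_contra hne
  obtain ⟨x, hx⟩ := (Set.ne_univ_iff_exists_notMem _).1 hne
  let φ : FreeGroup X →* Multiplicative ℤ := FreeGroup.lift fun y => if y = x then Multiplicative.ofAdd 1 else 1
  have hw : ∀ w : List (X × Bool), x ∉ w.map Prod.fst → φ (FreeGroup.mk w) = 1 := by
    intro w hw
    induction w with
    | nil => rw [← FreeGroup.one_eq_mk, map_one]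
    | cons l w ih =>
      rcases l with ⟨a, b⟩
      simp only [List.map_cons, List.mem_cons, not_or] at hw
      have hax : ¬ a = x := fun h => hw.1 h.symm
      rw [ell_mk, map_mul, ih hw.2]
      cases b <;> simp [ell, φ, hax]
  have h1 : (⊤ : Subgroup (FreeGroup X)) ≤ φ.ker := by
    rw [← hS, Subgroup.closure_le]
    intro g hg
    have := hw g.toWord (fun h => hx (Set.mem_biUnion hg h))
    rw [FreeGroup.mk_toWord] at this
    exact this
  have h2 : φ (FreeGroup.of x) = 1 := h1 (Subgroup.mem_top _)
  simp [φ] at h2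

lemma fp_sub {α : Type} {K : Subgroup (FreeGroup α)} (hK : K.FG) : IsFinitelyPresented K := by
  haveI : Group.FG K := (Group.fg_iff_subgroup_fg K).2 hK
  haveI : IsFreeGroup K := inferInstance
  have e := IsFreeGroup.mulEquiv K
  haveI : Group.FG (FreeGroup (IsFreeGroup.Generators K)) :=
    Group.fg_of_surjective (f := (e.symm : K →* _)) e.symm.surjective
  haveI := finite_of_fg (X := IsFreeGroup.Generators K)
  exact IsFinitelyPresented.equiv e

theorem fp_ext {H : Type} [Group H] (N : Subgroup H) [N.Normal] [hN : IsFinitelyPresented N]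
    [hQ : IsFinitelyPresented (H ⧸ N)] : IsFinitelyPresented H := by
  obtain ⟨a, φN, hφN, SN, hSN, hkN⟩ := hN.out
  obtain ⟨b, φQ, hφQ, SQ, hSQ, hkQ⟩ := hQ.out
  choose lq hlq using fun y : Fin b => QuotientGroup.mk_surjective (φQ (FreeGroup.of y))
  let i : FreeGroup (Fin a) →* (FreeGroup (Fin a ⊕ Fin b)) := FreeGroup.map Sum.inl
  let j : FreeGroup (Fin b) →* (FreeGroup (Fin a ⊕ Fin b)) := FreeGroup.map Sum.inr
  let f : (FreeGroup (Fin a ⊕ Fin b)) →* H := FreeGroup.lift (Sum.elim (fun x => (φN (FreeGroup.of x) : H)) lq)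
  have hfi : ∀ u, f (i u) = φN u := by
    intro u
    have : f.comp i = N.subtype.comp φN := by ext x; simp [f, i]
    exact DFunLike.congr_fun this u
  have hfj : ∀ u, (f (j u) : H ⧸ N) = φQ u := by
    intro u
    have : (QuotientGroup.mk' N).comp (f.comp j) = φQ := by ext x; simp [f, j, hlq]
    exact DFunLike.congr_fun this u
  choose c hc using hφN
  classical
  let tt : (FreeGroup (Fin a ⊕ Fin b)) → (FreeGroup (Fin a ⊕ Fin b)) := fun e => if h : f e ∈ N then e * (i (c ⟨f e, h⟩))⁻¹ else 1
  have htt : ∀ e, f (tt e) = 1 := by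
    intro e
    by_cases h : f e ∈ N
    · simp only [tt, h, dif_pos]
      rw [map_mul, map_inv, hfi, hc]; simp
    · simp [tt, h]
  let X : Fin a → (FreeGroup (Fin a ⊕ Fin b)) := fun x => FreeGroup.of (Sum.inl x)
  let Y : Fin b → (FreeGroup (Fin a ⊕ Fin b)) := fun y => FreeGroup.of (Sum.inr y)
  let T : Set (FreeGroup (Fin a ⊕ Fin b)) := (i '' SN) ∪ (tt '' (j '' SQ)) ∪
    (tt '' (Set.range fun q : Fin b × Fin a => Y q.1 * X q.2 * (Y q.1)⁻¹)) ∪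
    (tt '' (Set.range fun q : Fin b × Fin a => (Y q.1)⁻¹ * X q.2 * Y q.1))
  have hT : T.Finite := by
    refine Set.Finite.union (Set.Finite.union (Set.Finite.union ?_ ?_) ?_) ?_
    · exact hSN.image _
    · exact (hSQ.image _).image _
    · exact (Set.finite_range _).image _
    · exact (Set.finite_range _).image _
  have hfs : Function.Surjective f := by
    intro h
    obtain ⟨u, hu⟩ := hφQ (h : H ⧸ N)
    rw [← hfj, QuotientGroup.eq] at hu
    refine ⟨j u * i (c ⟨_, hu⟩), ?_⟩
    rw [map_mul, hfi, hc]; simp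
  have hTk : Subgroup.normalClosure T ≤ f.ker := by
    apply Subgroup.normalClosure_le_normal
    rintro t (((⟨s, hs, rfl⟩ | ⟨e, _, rfl⟩) | ⟨e, _, rfl⟩) | ⟨e, _, rfl⟩)
    · change f (i s) = 1
      have : s ∈ φN.ker := by rw [← hkN]; exact Subgroup.subset_normalClosure hs
      rw [hfi, MonoidHom.mem_ker.1 this]; rfl
    all_goals exact htt e
  have hcl : ∀ t ∈ T, t ∈ Subgroup.normalClosure T := fun t ht => Subgroup.subset_normalClosure ht
  refine IsFinitelyPresented.of_surjective f hfs ⟨T, hT, le_antisymm hTk ?_⟩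
  -- the subgroup generated by the images of `i` and the relators
  set Z := Subgroup.normalClosure T with hZ
  let M : Subgroup (FreeGroup (Fin a ⊕ Fin b)) := i.range ⊔ Z
  have hiM : ∀ u, i u ∈ M := fun u => (le_sup_left : i.range ≤ M) ⟨u, rfl⟩
  have hZM : ∀ z ∈ Z, z ∈ M := fun z hz => (le_sup_right : Z ≤ M) hz
  have htM : ∀ e, f e ∈ N → tt e ∈ Z → e ∈ M := by
    intro e he h
    simp only [tt, he, dif_pos] at h
    have := mul_mem (hZM _ h) (hiM (c ⟨f e, he⟩))
    simpa using this
  have hXN : ∀ x, f (X x) ∈ N := by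
    intro x; simp [f, X]
  have hMn : M.Normal := by
    have key : ∀ e : (FreeGroup (Fin a ⊕ Fin b)), (∀ x, e * X x * e⁻¹ ∈ M) → ∀ m ∈ M, e * m * e⁻¹ ∈ M := by
      intro e he m hm
      have : M ≤ M.comap (MulAut.conj e).toMonoidHom := by
        refine sup_le ?_ ?_
        · rintro _ ⟨u, rfl⟩
          change e * i u * e⁻¹ ∈ M
          induction u using FreeGroup.induction_on with
          | C1 => simp
          | of x => simpa [i] using he x
          | inv_of x h =>
            have := inv_mem h
            convert this using 1
            rw [map_inv]; group
          | mul x y hx hy =>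
            have := mul_mem hx hy
            convert this using 1
            simp [mul_assoc]
        · intro z hz
          exact hZM _ ((Subgroup.normalClosure_normal).conj_mem z hz e)
      exact this hm
    constructor
    intro m hm g
    have : ∀ g : (FreeGroup (Fin a ⊕ Fin b)), (∀ m ∈ M, g * m * g⁻¹ ∈ M) ∧ (∀ m ∈ M, g⁻¹ * m * g ∈ M) := by
      intro g
      induction g using FreeGroup.induction_on with
      | C1 => simp
      | of x =>
        rcases x with x | y
        · have hx : FreeGroup.of (Sum.inl x) ∈ M := by simpa [i] using hiM (FreeGroup.of x)
          exact ⟨fun m hm => mul_mem (mul_mem hx hm) (inv_mem hx),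
            fun m hm => mul_mem (mul_mem (inv_mem hx) hm) hx⟩
        · constructor
          · refine key _ fun x => htM _ ?_ (hcl _ (Or.inl (Or.inr ⟨_, ⟨(y, x), rfl⟩, rfl⟩)))
            rw [map_mul, map_mul, map_inv]
            exact Subgroup.Normal.conj_mem inferInstance _ (hXN x) _
          · intro m hm
            have := key (Y y)⁻¹ (fun x => by
              rw [inv_inv]
              refine htM _ ?_ (hcl _ (Or.inr ⟨_, ⟨(y, x), rfl⟩, rfl⟩))
              rw [map_mul, map_mul, map_inv]
              have := Subgroup.Normal.conj_mem (inferInstance : N.Normal) _ (hXN x) (f (Y y))⁻¹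
              rwa [inv_inv] at this) m hm
            rwa [inv_inv] at this
      | inv_of x h => exact ⟨fun m hm => by simpa using h.2 m hm, fun m hm => by simpa using h.1 m hm⟩
      | mul x y hx hy =>
        constructor
        · intro m hm
          have := hx.1 _ (hy.1 m hm)
          convert this using 1; group
        · intro m hm
          have := hy.2 _ (hx.2 m hm)
          convert this using 1; group
    exact (this g).1 m hm
  have hE : ∀ e : (FreeGroup (Fin a ⊕ Fin b)), ∃ v : FreeGroup (Fin b), e * (j v)⁻¹ ∈ M := by
    have h1 : ∀ e : (FreeGroup (Fin a ⊕ Fin b)), (e : (FreeGroup (Fin a ⊕ Fin b)) ⧸ M) ∈ ((QuotientGroup.mk' M).comp j).range := by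
      intro e
      induction e using FreeGroup.induction_on with
      | C1 => exact one_mem _
      | of x =>
        rcases x with x | y
        · have hx : FreeGroup.of (Sum.inl x) ∈ M := by simpa [i] using hiM (FreeGroup.of x)
          have : ((FreeGroup.of (Sum.inl x) : (FreeGroup (Fin a ⊕ Fin b))) : (FreeGroup (Fin a ⊕ Fin b)) ⧸ M) = 1 := (QuotientGroup.eq_one_iff _).2 hx
          change ((FreeGroup.of (Sum.inl x) : (FreeGroup (Fin a ⊕ Fin b))) : (FreeGroup (Fin a ⊕ Fin b)) ⧸ M) ∈ _
          rw [this]; exact one_mem _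
        · exact ⟨FreeGroup.of y, by simp [j]⟩
      | inv_of x h => exact inv_mem h
      | mul x y hx hy => exact mul_mem hx hy
    intro e
    obtain ⟨v, hv⟩ := h1 e
    refine ⟨v, ?_⟩
    rw [← QuotientGroup.eq_one_iff]
    simp only [MonoidHom.comp_apply, QuotientGroup.mk'_apply] at hv
    rw [QuotientGroup.mk_mul, QuotientGroup.mk_inv, hv]; simp
  have hjM : ∀ v, φQ v = 1 → j v ∈ M := by
    intro v hv
    have h1 : v ∈ φQ.ker := hv
    rw [← hkQ] at h1
    have h2 : Subgroup.normalClosure SQ ≤ M.comap j := by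
      apply Subgroup.normalClosure_le_normal
      intro s hs
      refine htM _ ?_ (hcl _ (Or.inl (Or.inl (Or.inr ⟨_, ⟨s, hs, rfl⟩, rfl⟩))))
      rw [← QuotientGroup.eq_one_iff, hfj]
      have : s ∈ φQ.ker := by rw [← hkQ]; exact Subgroup.subset_normalClosure hs
      exact this
    exact h2 h1
  intro e he
  have he : f e = 1 := he
  have heM : e ∈ M := by
    obtain ⟨v, hv⟩ := hE e
    have hMN : M ≤ N.comap f := by
      refine sup_le ?_ ?_
      · rintro _ ⟨u, rfl⟩
        change f (i u) ∈ N
        rw [hfi]; exact (φN u).2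
      · intro z hz
        have : f z = 1 := hTk hz
        change f z ∈ N
        rw [this]; exact one_mem _
    have h1 : f (e * (j v)⁻¹) ∈ N := hMN hv
    rw [map_mul, he, one_mul, map_inv, inv_mem_iff, ← QuotientGroup.eq_one_iff, hfj] at h1
    have := mul_mem hv (hjM v h1)
    simpa using this
  obtain ⟨_, ⟨u, rfl⟩, z, hz, rfl⟩ := (Subgroup.mem_sup_of_normal_right).1 heM
  refine mul_mem ?_ hz
  have hz1 : f z = 1 := hTk hz
  rw [map_mul, hz1, mul_one, hfi] at he
  have h1 : u ∈ φN.ker := by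
    rw [MonoidHom.mem_ker]; exact Subtype.ext he
  rw [← hkN] at h1
  have h2 : Subgroup.normalClosure SN ≤ Z.comap i := by
    haveI : Z.Normal := Subgroup.normalClosure_normal
    apply Subgroup.normalClosure_le_normal
    intro s hs
    exact hcl _ (Or.inl (Or.inl (Or.inl ⟨s, hs, rfl⟩)))
  exact h2 h1

section
variable {α : Type} {C : Ctx α} {K : Subgroup (FreeGroup α)}

lemma R_fng (hK : C.Y K) : ((C.R K).subgroupOf K).IsFinitelyNormallyGenerated := by
  classical
  choose s hs using fun x : FreeGroup α ⧸ K => exists_smul_bs x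
  let P : Set (FreeGroup α ⧸ K) := {x | C.D.W 0 C.D.nL • x = x}
  have hP : P.Finite := by
    refine ((Fixd_finite (D := C.D) hK.fg).image Prod.fst).subset ?_
    intro x hx
    refine ⟨(x, 0), ?_, rfl⟩
    change (sig C.D ^ C.D.nL) _ = _
    rw [sig_pow]
    apply Prod.ext
    · exact hx
    · simp [Dat.nL]
  let q : FreeGroup α ⧸ K → FreeGroup α := fun x => (s x)⁻¹ * C.D.W 0 C.D.nL * s x
  have hq : ∀ x ∈ P, q x ∈ K := by
    intro x hx
    rw [← smul_bs_eq, mul_smul, mul_smul, hs, show C.D.W 0 C.D.nL • x = x from hx, inv_smul_eq_iff, hs]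
  have hqc : ∀ x, q x ∈ C.cj := fun x => ⟨(s x)⁻¹, by simp [q]⟩
  let S : Set K := {k | ∃ x ∈ P, (k : FreeGroup α) = q x}
  have hS : S.Finite := by
    refine Set.Finite.of_injOn (f := fun k : K => (k : FreeGroup α)) (t := q '' P) ?_ ?_ (hP.image q)
    · rintro k ⟨x, hx, h⟩; exact ⟨x, hx, h.symm⟩
    · intro a _ b _ h; exact Subtype.ext h
  refine ⟨S, hS, le_antisymm ?_ ?_⟩
  · apply Subgroup.normalClosure_le_normal
    rintro k ⟨x, hx, h⟩
    change (k : FreeGroup α) ∈ C.R K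
    exact Subgroup.subset_closure ⟨k.2, by rw [h]; exact hqc x⟩
  · have h1 : C.R K ≤ (Subgroup.normalClosure S).map K.subtype := by
      rw [Ctx.R, Subgroup.closure_le]
      rintro k ⟨hk, u, rfl⟩
      let x := u⁻¹ • bs K
      have hx : x ∈ P := by
        change C.D.W 0 C.D.nL • u⁻¹ • bs K = u⁻¹ • bs K
        rw [eq_inv_smul_iff, ← mul_smul, ← mul_smul, smul_bs_eq]
        exact hk
      have hc : (s x)⁻¹ * u⁻¹ ∈ K := by
        rw [← smul_bs_eq, mul_smul, inv_smul_eq_iff, hs]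
      have h2 : (⟨q x, hq x hx⟩ : K) ∈ Subgroup.normalClosure S := Subgroup.subset_normalClosure ⟨x, hx, rfl⟩
      have h3 := Subgroup.normalClosure_normal.conj_mem _ h2 (⟨_, hc⟩ : K)⁻¹
      refine ⟨_, h3, ?_⟩
      simp [q]
      group
    intro k hk
    obtain ⟨k', hk', e⟩ := h1 (Subgroup.mem_subgroupOf.1 hk)
    have : k' = k := Subtype.ext e
    rwa [← this]

theorem ctx_fp [Finite α] (C : Ctx α) {G : Type} [Group G] (π : FreeGroup α →* G)
    (hπ : π.ker = Subgroup.closure C.cj) :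
    IsFinitelyPresented ((Subgroup.closure (C.G0 : Set (FreeGroup α))).map π) := by
  obtain ⟨K, hK, hst⟩ := stable C
  have hKm : (Subgroup.closure (C.G0 : Set (FreeGroup α))).map π = K.map π := by
    apply le_antisymm
    · apply Subgroup.map_mono
      rw [Subgroup.closure_le]
      exact hK.g0
    · rw [Subgroup.map_le_iff_le_comap]
      refine hK.leH.trans ?_
      rw [Ctx.H, Subgroup.closure_le]
      rintro g (hg | hg)
      · exact ⟨g, Subgroup.subset_closure hg, rfl⟩
      · have : g ∈ π.ker := by rw [hπ]; exact Subgroup.subset_closure hg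
        rw [SetLike.mem_coe, Subgroup.mem_comap, MonoidHom.mem_ker.1 this]; exact one_mem _
  rw [hKm]
  haveI := fp_sub hK.fg
  refine IsFinitelyPresented.of_surjective (π.subgroupMap K) (π.subgroupMap_surjective K) ?_
  have : (π.subgroupMap K).ker = (C.R K).subgroupOf K := by
    ext k
    rw [MonoidHom.mem_ker, Subgroup.mem_subgroupOf]
    have h1 : π.subgroupMap K k = 1 ↔ π k = 1 := by
      rw [Subtype.ext_iff]; rfl
    rw [h1, ← MonoidHom.mem_ker, hπ]
    constructor
    · exact hst k k.2
    · intro h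
      exact Subgroup.closure_mono Set.inter_subset_right h
  rw [this]
  exact R_fng hK
end

theorem main_fp {α : Type} [DecidableEq α] [Finite α] {r : FreeGroup α} (hr : r ≠ 1)
    (hcyc : ∀ x : α × Bool, r.toWord.head? = some x → r.toWord.getLast? ≠ some (x.1, !x.2))
    (hpow : ¬ ∃ (s : FreeGroup α) (k : ℕ), 2 ≤ k ∧ r = s ^ k) (n : ℕ) (hn : 2 ≤ n)
    {G : Type} [Group G] (π : FreeGroup α →* G) (hs : Function.Surjective π)
    (hk : π.ker = Subgroup.normalClosure {r ^ n}) (H : Subgroup G) [Group.FG H] :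
    IsFinitelyPresented H := by
  classical
  obtain ⟨D, hDn, hDr⟩ := exists_dat hr hcyc hpow n hn
  have hW : ∀ k : ℕ, D.W 0 (k * D.L) = r ^ k := by
    intro k
    induction k with
    | zero => simp [Dat.W]
    | succ k ih =>
      have := W_add D 0 (k * D.L) D.L
      rw [Nat.succ_mul, this, ih, pow_succ']
      simp [hDr]
  have hWn : D.W 0 D.nL = r ^ n := by rw [Dat.nL, hW, hDn]
  obtain ⟨F0, hF0n, hF0i, hF0⟩ := exists_quot hr (n := n) (by omega)
  let N0 : Subgroup G := F0.map π
  haveI hN0 : N0.Normal := hF0n.map π hs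
  haveI hN0i : N0.FiniteIndex := by
    constructor
    have := Subgroup.index_map_dvd F0 hs
    intro h
    rw [h, zero_dvd_iff] at this
    exact hF0i.index_ne_zero this
  let N : Subgroup H := N0.subgroupOf H
  haveI : N.Normal := inferInstance
  haveI : N.FiniteIndex := inferInstance
  have hNfg : N.FG := (Group.fg_iff_subgroup_fg N).1 inferInstance
  have hN'fg : (N.map H.subtype).FG := by
    haveI : Group.FG N := (Group.fg_iff_subgroup_fg N).2 hNfg
    haveI : Group.FG (N.map H.subtype) :=
      Group.fg_of_surjective (H.subtype.subgroupMap_surjective N)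
    exact (Group.fg_iff_subgroup_fg _).1 inferInstance
  obtain ⟨S, hS⟩ := hN'fg
  have hl : ∀ g : S, ∃ u ∈ F0, π u = g := by
    intro g
    have : (g : G) ∈ N.map H.subtype := by rw [← hS]; exact Subgroup.subset_closure g.2
    obtain ⟨x, hx, h⟩ := this
    have hx' : (x : G) ∈ N0 := hx
    rw [← h]
    exact hx'
  choose u hu1 hu2 using hl
  let G0 : Finset (FreeGroup α) := Finset.univ.image u
  let C : Ctx α :=
    { D := D
      G0 := G0
      F0 := F0
      rF := fun v => by
        rw [hWn]; exact hF0n.conj_mem _ ((hF0 n).2 dvd_rfl) v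
      G0F := fun g hg => by
        obtain ⟨x, _, rfl⟩ := Finset.mem_image.1 hg
        exact hu1 x
      tfF := fun g k h0 hkn h => by
        have h2 := hF0n.conj_mem _ h g⁻¹
        rw [hW] at h2
        have h3 : r ^ k ∈ F0 := by convert h2 using 1; group
        have := Nat.le_of_dvd h0 ((hF0 k).1 h3)
        omega
      ℓ := n.minFac
      hp := ⟨Nat.minFac_prime (by omega)⟩
      hd := by rw [hDn]; exact n.minFac_dvd }
  have hker : π.ker = Subgroup.closure C.cj := by
    rw [hk, Subgroup.normalClosure]
    congr 1
    ext x
    rw [Group.mem_conjugatesOfSet_iff]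
    change _ ↔ ∃ u, x = u * D.W 0 D.nL * u⁻¹
    rw [hWn]
    simp [isConj_iff, eq_comm]
  have hfp := ctx_fp C π hker
  have hmap : (Subgroup.closure (C.G0 : Set (FreeGroup α))).map π = N.map H.subtype := by
    rw [MonoidHom.map_closure, ← hS]
    congr 1
    ext g
    constructor
    · rintro ⟨x, hx, rfl⟩
      obtain ⟨y, _, rfl⟩ := Finset.mem_image.1 hx
      rw [hu2]; exact y.2
    · intro hg
      exact ⟨u ⟨g, hg⟩, Finset.mem_coe.2 (Finset.mem_image_of_mem u (Finset.mem_univ _)), hu2 _⟩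
  rw [hmap] at hfp
  haveI : IsFinitelyPresented N :=
    IsFinitelyPresented.equiv (N.equivMapOfInjective H.subtype H.subtype_injective).symm
  haveI : Finite (H ⧸ N) := inferInstance
  exact fp_ext N

end Fin

end ORT

/-- **Louder–Wilton (2018), Wise (2018), Baumslag's third conjecture:** every
one-relator group with torsion is coherent, i.e. each finitely generated
subgroup is finitely presented. -/
theorem one_relator_with_torsion_coherent
    (m : ℕ) (r : FreeGroup (Fin m)) (hr : r ≠ 1) (hcyc : FreeGroup.CyclicallyReduced r)
    (hpow : ¬ ∃ (s : FreeGroup (Fin m)) (k : ℕ), 2 ≤ k ∧ r = s ^ k)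
    (n : ℕ) (hn : 2 ≤ n) :
    ∀ H : Subgroup (PresentedGroup ({r ^ n} : Set (FreeGroup (Fin m)))),
      Group.FG H →
        ∃ (k : ℕ) (rels : Set (FreeGroup (Fin k))), rels.Finite ∧
          Nonempty (H ≃* PresentedGroup rels) := by
  intro H hH
  haveI := hH
  haveI := ORT.main_fp hr hcyc hpow n hn (PresentedGroup.mk {r ^ n})
    (PresentedGroup.mk_surjective _) (QuotientGroup.ker_mk' _) H
  exact Group.IsFinitelyPresented.exists_mulEquiv_presentedGroup
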